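/- arXiv:1110.6405 — 6 statements merged into one kernel-verified Lean document; each statement's English description precedes it below -/
import Mathlib

section
/- Let t, s ≥ 1, let P_1,…,P_s ∈ ℂ[X_1,…,X_t] be polynomials and α_1,…,α_s ∈ ℂ^t. Then there exists a positive integer N such that for every q ∈ ℚ^t that is a nondegenerate solution of the equation ∑_{i=1}^s P_i(q)·exp(q·α_i) = 0, one has π'(q) ∈ ((1/N)ℤ)^t. -/
lemma vdw_aux (C s : ℕ) : ∃ X : ℕ, ∀ c : ℕ → Fin C, ∃ b d : ℕ, 0 < d ∧ d ≤ X ∧ b + d * s ≤ X ∧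
    ∀ l ≤ s, c (b + d * l) = c b := by
  classical
  obtain ⟨ι, _inst, hι⟩ := Combinatorics.Line.exists_mono_in_high_dimension (Fin (s+1)) (Fin C)
  refine ⟨Fintype.card ι * (s + 1), fun c => ?_⟩
  obtain ⟨l, col, hl⟩ := hι fun v => c (∑ i, (v i : ℕ))
  set S : Finset ι := {i | l.idxFun i = none} with hS
  set b : ℕ := ∑ i ∈ Sᶜ, ((l.idxFun i).getD 0 : ℕ) with hb
  have key : ∀ x : Fin (s+1), ∑ i, ((l x i : Fin (s+1)) : ℕ) = b + S.card * x := by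
    intro x
    rw [← Finset.sum_add_sum_compl S, add_comm]
    congr 1
    · apply Finset.sum_congr rfl
      intro i hi
      have : l.idxFun i ≠ none := by simpa [hS] using hi
      obtain ⟨y, hy⟩ := Option.ne_none_iff_exists'.1 this
      simp [hy, Combinatorics.Line.coe_apply]
    · rw [Finset.sum_congr rfl (g := fun _ => (x : ℕ))]
      · simp
      · intro i hi
        have : l.idxFun i = none := by simpa [hS] using hi
        simp [this, Combinatorics.Line.coe_apply]
  have hpos : 0 < S.card := Finset.card_pos.mpr ⟨l.proper.choose, by
    rw [hS, Finset.mem_filter]; exact ⟨Finset.mem_univ _, l.proper.choose_spec⟩⟩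
  refine ⟨b, S.card, hpos, ?_, ?_, ?_⟩
  · calc S.card ≤ Fintype.card ι := Finset.card_le_univ _
      _ ≤ _ := Nat.le_mul_of_pos_right _ (by omega)
  · have h := key (Fin.last s)
    simp only [Fin.val_last] at h
    rw [← h]
    calc _ ≤ ∑ i : ι, (s + 1) := Finset.sum_le_sum fun i _ => (Fin.is_lt _).le
      _ = _ := by simp
  · intro k hk
    have h1 := hl ⟨k, by omega⟩
    have h0 := hl 0
    simp only [key] at h1 h0
    simp only [Fin.val_zero, mul_zero, add_zero] at h0
    rw [h0]; exact h1

lemma all_eq_of_nondeg {F ι : Type*} [Field F] [Fintype ι] (v z : ι → F)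
    (h : ∀ l ≤ Fintype.card ι, ∑ i, v i * z i ^ l = 0)
    (hnd : ∀ I : Finset ι, I.Nonempty → I ≠ Finset.univ → ∑ i ∈ I, v i ≠ 0) (i j : ι) :
    z i = z j := by
  classical
  set Z : Finset F := (Finset.univ.image z).erase (z j)
  set P : Polynomial F := ∏ x ∈ Z, (Polynomial.X - Polynomial.C x) with hP
  have hdeg : P.natDegree ≤ Fintype.card ι := by
    rw [hP, Polynomial.natDegree_prod_of_monic _ _ (fun _ _ => Polynomial.monic_X_sub_C _)]
    simp only [Polynomial.natDegree_X_sub_C, Finset.sum_const, smul_eq_mul, mul_one]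
    calc Z.card ≤ (Finset.univ.image z).card := Finset.card_le_card (Finset.erase_subset _ _)
      _ ≤ _ := Finset.card_image_le
  have hsum : ∑ i, v i * P.eval (z i) = 0 := by
    simp_rw [Polynomial.eval_eq_sum_range, Finset.mul_sum]
    rw [Finset.sum_comm]
    apply Finset.sum_eq_zero
    intro l hl
    have := h l (by rw [Finset.mem_range] at hl; omega)
    calc _ = P.coeff l * ∑ i, v i * z i ^ l := by
          rw [Finset.mul_sum]; exact Finset.sum_congr rfl fun i _ => by ring
      _ = 0 := by rw [this, mul_zero]
  have hz : ∀ i, z i ≠ z j → P.eval (z i) = 0 := by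
    intro i hi
    rw [hP, Polynomial.eval_prod]
    exact Finset.prod_eq_zero (i := z i) (by simp [Z, hi]) (by simp)
  have hnz : P.eval (z j) ≠ 0 := by
    rw [hP, Polynomial.eval_prod, Finset.prod_ne_zero_iff]
    intro x hx
    simp only [Polynomial.eval_sub, Polynomial.eval_X, Polynomial.eval_C, sub_ne_zero]
    exact (Finset.ne_of_mem_erase hx).symm
  have h2 : ∑ i ∈ Finset.univ.filter (fun i => z i = z j), v i = 0 := by
    have : (∑ i ∈ Finset.univ.filter (fun i => z i = z j), v i) * P.eval (z j) = 0 := by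
      rw [← hsum, Finset.sum_mul, Finset.sum_filter]
      refine Finset.sum_congr rfl fun i _ => ?_
      split_ifs with hi
      · rw [hi]
      · rw [hz i hi, mul_zero]
    exact (mul_eq_zero.1 this).resolve_right hnz
  by_contra hij
  refine hnd _ ⟨j, by simp⟩ ?_ h2
  intro he
  have : i ∈ Finset.univ.filter (fun i => z i = z j) := by
    rw [he]; exact Finset.mem_univ i
  exact hij (by simpa using this)

lemma exists_M (X m : ℕ) (hm : 0 < m) : ∃ M : ℕ, (∀ x ≤ X, Nat.Coprime (1 + M * x) m) ∧
    ∀ d, 0 < d → d ≤ X → m ∣ M * d → m ∣ (X + 1).factorial * X.factorial := by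
  set f := (X+1).factorial with hf
  -- m = m1 * m2
  obtain ⟨m1, m2, hm12, hm1, hm2⟩ : ∃ m1 m2 : ℕ, m = m1 * m2 ∧ (∀ p, p.Prime → p ∣ m1 → p ∣ f) ∧
      Nat.Coprime m2 f := by
    clear_value f
    induction m using Nat.strong_induction_on with
    | _ m ih =>
    by_cases hc : Nat.Coprime m f
    · exact ⟨1, m, by simp, fun p hp h => absurd (Nat.dvd_one.1 h) hp.one_lt.ne', hc⟩
    · obtain ⟨p, hp, hpm, hpf⟩ := Nat.Prime.not_coprime_iff_dvd.1 hc
      obtain ⟨m', rfl⟩ := hpm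
      have hm' : 0 < m' := Nat.pos_of_mul_pos_left hm
      obtain ⟨a, b, hab, ha, hb⟩ := ih m' (by nlinarith [hp.two_le]) hm'
      refine ⟨p * a, b, by rw [hab]; ring, ?_, hb⟩
      intro r hr hd
      rcases (hr.dvd_mul).1 hd with h | h
      · rwa [(Nat.prime_dvd_prime_iff_eq hr hp).1 h]
      · exact ha r hr h
  have hcop : Nat.Coprime m1 m2 := by
    refine Nat.Coprime.symm ?_
    by_contra hc
    obtain ⟨p, hp, h2, h1⟩ := Nat.Prime.not_coprime_iff_dvd.1 hc
    exact Nat.Prime.not_coprime_iff_dvd.2 ⟨p, hp, h2, hm1 p hp h1⟩ hm2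
  obtain ⟨M, hM1, hM2⟩ := Nat.chineseRemainder hcop f 1
  refine ⟨M, ?_, ?_⟩
  · intro x hx
    by_contra hc
    obtain ⟨p, hp, h1, h2⟩ := Nat.Prime.not_coprime_iff_dvd.1 hc
    rw [hm12] at h2
    rcases hp.dvd_mul.1 h2 with h | h
    · have : p ∣ M := by
        have := (hM1.of_dvd h)
        exact (this.dvd_iff dvd_rfl).2 (hm1 p hp h)
      have h3 : p ∣ 1 := (Nat.dvd_add_left (this.mul_right x)).1 h1
      exact hp.one_lt.ne' (Nat.dvd_one.1 h3)
    · have h3 : M ≡ 1 [MOD p] := hM2.of_dvd h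
      have h4 : 1 + M * x ≡ 1 + 1 * x [MOD p] := (h3.mul_right x).add_left 1
      have h5 : p ∣ 1 + 1 * x := (h4.dvd_iff dvd_rfl).1 h1
      have h6 : p ≤ X + 1 := by have := Nat.le_of_dvd (by omega) h5; omega
      exact Nat.Prime.not_coprime_iff_dvd.2 ⟨p, hp, h, hp.dvd_factorial.2 h6⟩ hm2
  · intro d hd hdX hdvd
    have hdf : d ∣ X.factorial := Nat.dvd_factorial hd hdX
    rw [hm12] at hdvd
    have h2 : m2 ∣ d := by
      have h3 : M * d ≡ 1 * d [MOD m2] := hM2.mul_right d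
      simpa using (h3.dvd_iff dvd_rfl).1 ((Dvd.intro_left m1 rfl).trans hdvd)
    have h1 : m1 ∣ f * d := 
      ((hM1.mul_right d).dvd_iff dvd_rfl).1 ((Dvd.intro m2 rfl).trans hdvd)
    rw [hm12]
    exact (hcop.mul_dvd_of_dvd_of_dvd h1 (h2.mul_left f)).trans (mul_dvd_mul_left _ hdf)

lemma exists_prim (K L : Type*) [Field K] [CharZero K] [Field L] [Algebra K L] [IsAlgClosure K L]
    (n : ℕ) (hn : 0 < n) : ∃ ξ : L, IsPrimitiveRoot ξ n := by
  have : IsAlgClosed L := IsAlgClosure.isAlgClosed K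
  have : CharZero L := charZero_of_injective_algebraMap (algebraMap K L).injective
  have : NeZero (n : L) := ⟨by exact_mod_cast hn.ne'⟩
  have : NeZero n := ⟨hn.ne'⟩
  exact HasEnoughRootsOfUnity.exists_primitiveRoot L n

lemma gal_pow {K L : Type*} [Field K] [Field L] [Algebra K L] {n : ℕ} [NeZero n] {ξ : L}
    (hξ : IsPrimitiveRoot ξ n) (σ : L ≃ₐ[K] L) {t : L} (ht : t ^ n = 1) :
    σ t = t ^ ((hξ.autToPow K σ : ZMod n).val) := by
  obtain ⟨i, _, rfl⟩ := hξ.eq_pow_of_pow_eq_one ht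
  rw [map_pow, ← hξ.autToPow_spec K σ, ← pow_mul, ← pow_mul, mul_comm]

lemma schinzel {K L : Type*} [Field K] [CharZero K] [Field L] [Algebra K L] [IsAlgClosure K L]
    (w : ℕ) (hw : ∀ ζ : K, ∀ n : ℕ, 0 < n → ζ ^ n = 1 → ζ ^ w = 1)
    (h : L) (h0 : h ≠ 0) (n : ℕ) (hn : 0 < n) (a : K) (ha : h ^ n = algebraMap K L a)
    (hcomm : ∀ σ τ : L ≃ₐ[K] L, σ (τ h) = τ (σ h)) :
    ∃ (η : L) (b : K), η ^ n = 1 ∧ h ^ w = η * algebraMap K L b := by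
  have : NeZero n := ⟨hn.ne'⟩
  have : IsGalois K L := inferInstance
  obtain ⟨ξ, hξ⟩ := exists_prim K L n hn
  set z : (L ≃ₐ[K] L) → L := fun σ => σ h / h with hz
  have hσ0 : ∀ σ : L ≃ₐ[K] L, σ h ≠ 0 := fun σ => by simpa using h0
  have hz0 : ∀ σ, z σ ≠ 0 := fun σ => div_ne_zero (hσ0 σ) h0
  have hzn : ∀ σ, z σ ^ n = 1 := by
    intro σ
    have : σ h ^ n = h ^ n := by rw [← map_pow, ha, AlgEquiv.commutes]
    rw [hz]; simp only [div_pow]; rw [this, div_self (pow_ne_zero _ h0)]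
  let I : AddSubgroup ℤ :=
    { carrier := {a | ∃ η : L, η ^ n = 1 ∧ ∀ σ, σ η = η * z σ ^ a}
      zero_mem' := ⟨1, by simp, by simp⟩
      add_mem' := by
        rintro a b ⟨η, h1, h2⟩ ⟨θ, h3, h4⟩
        refine ⟨η * θ, by rw [mul_pow, h1, h3, one_mul], fun σ => ?_⟩
        rw [map_mul, h2, h4, zpow_add₀ (hz0 σ)]; ring
      neg_mem' := by
        rintro a ⟨η, h1, h2⟩
        refine ⟨η⁻¹, by rw [inv_pow, h1, inv_one], fun σ => ?_⟩
        rw [map_inv₀, h2, zpow_neg, mul_inv] }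
  have hnI : (n : ℤ) ∈ I := ⟨1, by simp, fun σ => by simp [hzn]⟩
  have hτI : ∀ τ : L ≃ₐ[K] L, (((hξ.autToPow K τ : ZMod n).val : ℤ) - 1) ∈ I := by
    intro τ
    refine ⟨z τ, hzn τ, fun σ => ?_⟩
    have h1 := gal_pow hξ τ (hzn σ)
    rw [zpow_sub₀ (hz0 σ), zpow_natCast, zpow_one, ← h1]
    simp only [hz, map_div₀]
    rw [hcomm σ τ]
    have := hσ0 σ
    have := hσ0 τ
    field_simp
  obtain ⟨g, hg⟩ := Int.subgroup_cyclic I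
  rw [← AddSubgroup.zmultiples_eq_closure] at hg
  have hgd : ∀ x : ℤ, x ∈ I ↔ (g.natAbs : ℤ) ∣ x := by
    intro x; rw [hg, Int.mem_zmultiples_iff, Int.natAbs_dvd]
  set w' := g.natAbs
  have hw'n : w' ∣ n := by exact_mod_cast (hgd _).1 hnI
  obtain ⟨e, he⟩ := hw'n
  have hprim : IsPrimitiveRoot (ξ ^ e) w' := hξ.pow hn (by rw [he, mul_comm])
  have hfix : ∀ τ : L ≃ₐ[K] L, τ (ξ ^ e) = ξ ^ e := by
    intro τ
    have h1 := gal_pow hξ τ (t := ξ ^ e) (by rw [← pow_mul, mul_comm, pow_mul, hξ.pow_eq_one, one_pow])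
    obtain ⟨c, hc⟩ := (hgd _).1 (hτI τ)
    have h0 : ξ ^ e ≠ 0 := pow_ne_zero _ (hξ.ne_zero hn.ne')
    rw [h1, ← zpow_natCast (ξ ^ e), eq_add_of_sub_eq hc, zpow_add₀ h0, zpow_mul, zpow_natCast,
      hprim.pow_eq_one]
    simp
  obtain ⟨ζ, hζ⟩ := (InfiniteGalois.mem_range_algebraMap_iff_fixed (ξ ^ e)).2 hfix
  have hw'0 : 0 < w' := Nat.pos_of_ne_zero (by rintro h; rw [h] at he; omega)
  have hζw : ζ ^ w = 1 := by
    apply hw ζ w' hw'0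
    apply (algebraMap K L).injective
    rw [map_pow, hζ, hprim.pow_eq_one, map_one]
  have hdvd : w' ∣ w := by
    apply hprim.dvd_of_pow_eq_one
    rw [← hζ, ← map_pow, hζw, map_one]
  obtain ⟨η, hη, hησ⟩ := (hgd w).2 (by exact_mod_cast hdvd)
  have hη0 : η ≠ 0 := by rintro rfl; simp [hn.ne'] at hη
  obtain ⟨b, hb⟩ := (InfiniteGalois.mem_range_algebraMap_iff_fixed (K := L) (k := K) (h ^ w / η)).2 (by
    intro σ
    rw [map_div₀, hησ, map_pow, zpow_natCast]
    simp only [hz, div_pow]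
    have := hσ0 σ
    field_simp)
  exact ⟨η, b, hη, by rw [hb]; field_simp⟩

theorem thmA {K L : Type*} [Field K] [CharZero K] [Field L] [Algebra K L] [IsAlgClosure K L]
    (w : ℕ) (hw0 : 0 < w) (hw : ∀ ζ : K, ∀ n : ℕ, 0 < n → ζ ^ n = 1 → ζ ^ w = 1)
    (D : ℕ) (hD : ∀ (m : ℕ) [NeZero m] (ξ : L) (hξ : IsPrimitiveRoot ξ m),
      (hξ.autToPow K).range.index ≤ D) (s : ℕ) :
    ∃ N : ℕ, 0 < N ∧ ∀ (c : Fin s → K) (g : Fin s → L), (∀ i, g i ≠ 0) →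
      (∃ n : ℕ, 0 < n ∧ ∀ i, ∃ a : K, g i ^ n = algebraMap K L a) →
      ∑ i, algebraMap K L (c i) * g i = 0 →
      (∀ I : Finset (Fin s), I.Nonempty → I ≠ Finset.univ →
        ∑ i ∈ I, algebraMap K L (c i) * g i ≠ 0) →
      ∀ i j, ∃ a : K, (g i / g j) ^ N = algebraMap K L a := by
  classical
  obtain ⟨X, hX⟩ := vdw_aux (w ^ s * D) s
  refine ⟨w * ((X + 1).factorial * X.factorial), by positivity, ?_⟩
  rintro c g hg0 ⟨n, hn, hgn⟩ hsum hnd i0 j0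
  -- step 1: commuting
  have hcommI : ∀ i, ∀ σ τ : L ≃ₐ[K] L, σ (τ (g i / g j0)) = τ (σ (g i / g j0)) := by
    intro i σ τ
    have : NeZero n := ⟨hn.ne'⟩
    obtain ⟨ξ, hξ⟩ := exists_prim K L n hn
    -- ρ acts trivially on n-th roots of unity
    have key : ∀ ρ : L ≃ₐ[K] L, hξ.autToPow K ρ = 1 → ρ (g i / g j0) = g i / g j0 := by
      intro ρ hρ
      have hfix : ∀ t : L, t ^ n = 1 → ρ t = t := by
        intro t ht
        have h1 := gal_pow hξ ρ ht
        rw [hρ, Units.val_one] at h1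
        rw [h1, ← pow_one t, ← pow_mul, one_mul]
        apply pow_eq_pow_of_modEq _ ht
        rw [← ZMod.natCast_eq_natCast_iff, ZMod.natCast_zmod_val, Nat.cast_one]
      set z : Fin s → L := fun i => ρ (g i) / g i with hz
      have hzn : ∀ i, z i ^ n = 1 := by
        intro i
        obtain ⟨a, ha⟩ := hgn i
        have : ρ (g i) ^ n = g i ^ n := by rw [← map_pow, ha, AlgEquiv.commutes]
        rw [hz]; simp only [div_pow]; rw [this, div_self (pow_ne_zero _ (hg0 i))]
      have hρg : ∀ i, ρ (g i) = g i * z i := fun i => by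
        simp only [hz]; rw [mul_div_cancel₀ _ (hg0 i)]
      have hl : ∀ l : ℕ, ∑ i, (algebraMap K L (c i) * g i) * z i ^ l = 0 := by
        intro l
        induction l with
        | zero => simpa using hsum
        | succ l ih =>
          have h2 := congrArg ρ ih
          rw [map_sum, map_zero] at h2
          rw [← h2]
          refine Finset.sum_congr rfl fun i _ => ?_
          rw [map_mul, map_mul, map_pow, AlgEquiv.commutes, hρg, hfix _ (hzn i)]
          ring
      have hzz := all_eq_of_nondeg _ z (fun l _ => hl l) hnd i j0
      rw [map_div₀, hρg, hρg, hzz, mul_div_mul_right]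
      intro h0
      have := hzn j0
      rw [h0, zero_pow hn.ne'] at this
      exact zero_ne_one this
    have h1 := key (σ⁻¹ * τ⁻¹ * σ * τ) (by
      simp only [map_mul, map_inv]
      rw [mul_comm (hξ.autToPow K σ)⁻¹, mul_assoc, mul_assoc]
      simp)
    have h2 := congrArg (fun x => τ (σ x)) h1
    simp only [AlgEquiv.mul_apply] at h2
    rw [show ∀ y : L, σ (σ⁻¹ y) = y from fun y => σ.apply_symm_apply y,
      show ∀ y : L, τ (τ⁻¹ y) = y from fun y => τ.apply_symm_apply y] at h2
    exact h2
  -- step 2 : decomposition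
  have hdec : ∀ i, ∃ η b : L, g i / g j0 = η * b ∧ (∃ m : ℕ, 0 < m ∧ η ^ m = 1) ∧
      (∃ a : K, b ^ w = algebraMap K L a) ∧ (i = j0 → η = 1) := by
    intro i
    by_cases hij : i = j0
    · subst hij
      exact ⟨1, 1, by rw [div_self (hg0 _), one_mul], ⟨1, one_pos, by simp⟩, ⟨1, by simp⟩, fun _ => rfl⟩
    have hdiv : ∃ a : K, (g i / g j0) ^ n = algebraMap K L a := by
      obtain ⟨a, ha⟩ := hgn i
      obtain ⟨b, hb⟩ := hgn j0
      exact ⟨a / b, by rw [div_pow, ha, hb, map_div₀]⟩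
    obtain ⟨a, ha⟩ := hdiv
    obtain ⟨η, b, hη, hb⟩ := schinzel w hw _ (div_ne_zero (hg0 i) (hg0 j0)) n hn a ha (hcommI i)
    have : IsAlgClosed L := IsAlgClosure.isAlgClosed K
    obtain ⟨θ, hθ⟩ := IsAlgClosed.exists_pow_nat_eq η hw0
    have hη0 : η ≠ 0 := by rintro rfl; simp [hn.ne'] at hη
    have hθ0 : θ ≠ 0 := by rintro rfl; simp [hw0.ne'] at hθ; exact hη0 hθ.symm
    refine ⟨θ, (g i / g j0) / θ, by field_simp, ⟨w * n, by positivity, by rw [pow_mul, hθ, hη]⟩,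
      ⟨b, ?_⟩, fun h => absurd h hij⟩
    rw [div_pow, hb, hθ]; field_simp
  choose η b hηb hηt hbw hη1 using hdec
  -- step 3
  set m : ℕ := Finset.univ.lcm (fun i => orderOf (η i)) with hm
  have hordpos : ∀ i, 0 < orderOf (η i) := by
    intro i
    obtain ⟨m, hm, h⟩ := hηt i
    exact orderOf_pos_iff.2 (isOfFinOrder_iff_pow_eq_one.2 ⟨m, hm, h⟩)
  have hm0 : m ≠ 0 := by
    intro h0
    rw [hm, Finset.lcm_eq_zero_iff] at h0
    obtain ⟨i, _, hi⟩ := h0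
    exact (hordpos i).ne' hi
  have : NeZero m := ⟨hm0⟩
  have hηm : ∀ i, η i ^ m = 1 := fun i =>
    orderOf_dvd_iff_pow_eq_one.1 (Finset.dvd_lcm (Finset.mem_univ i))
  obtain ⟨ξ, hξ⟩ := exists_prim K L m (Nat.pos_of_ne_zero hm0)
  set χ := hξ.autToPow K with hχ
  let H1 : Subgroup (L ≃ₐ[K] L) := ⨅ i, MulAction.stabilizer (L ≃ₐ[K] L) (b i)
  have horb : ∀ i, (MulAction.stabilizer (L ≃ₐ[K] L) (b i)).index ≠ 0 ∧
      (MulAction.stabilizer (L ≃ₐ[K] L) (b i)).index ≤ w := by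
    intro i
    obtain ⟨a, ha⟩ := hbw i
    have hsub : MulAction.orbit (L ≃ₐ[K] L) (b i) ⊆
        ((Polynomial.nthRoots w (algebraMap K L a)).toFinset : Set L) := by
      rintro _ ⟨σ, rfl⟩
      simp only [Finset.mem_coe, Multiset.mem_toFinset, Polynomial.mem_nthRoots hw0]
      change (σ (b i)) ^ w = _
      rw [← map_pow, ha, AlgEquiv.commutes]
    rw [MulAction.index_stabilizer]
    constructor
    · exact ((Set.ncard_pos (Set.Finite.subset (Finset.finite_toSet _) hsub)).2
        (MulAction.nonempty_orbit _)).ne'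
    · refine (Set.ncard_le_ncard hsub (Finset.finite_toSet _)).trans ?_
      rw [Set.ncard_coe_finset]
      exact (Multiset.toFinset_card_le _).trans (Polynomial.card_nthRoots _ _)
  have hH10 : H1.index ≠ 0 := Subgroup.index_iInf_ne_zero fun i => (horb i).1
  have hH1 : H1.index ≤ w ^ s := by
    refine (Subgroup.index_iInf_le _).trans ?_
    refine (Finset.prod_le_pow_card _ _ w fun i _ => (horb i).2).trans ?_
    simp
  set Q := (ZMod m)ˣ ⧸ (H1.map χ) with hQ
  have hcard : Nat.card Q ≤ w ^ s * D := by
    change (H1.map χ).index ≤ _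
    rw [Subgroup.index_map]
    refine Nat.mul_le_mul ?_ (hD m ξ hξ)
    exact (Nat.le_of_dvd (Nat.pos_of_ne_zero hH10) (Subgroup.index_dvd_of_le le_sup_left)).trans hH1
  have : Finite Q := inferInstance
  let emb : Q → Fin (w ^ s * D) := fun x => Fin.castLE hcard (Finite.equivFin Q x)
  have hemb : Function.Injective emb := fun x y h =>
    (Finite.equivFin Q).injective (Fin.castLE_injective hcard h)
  obtain ⟨M, hM, hMd⟩ := exists_M X m (Nat.pos_of_ne_zero hm0)
  let u : ℕ → (ZMod m)ˣ := fun x =>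
    if h : Nat.Coprime (1 + M * x) m then ZMod.unitOfCoprime _ h else 1
  have hu : ∀ x ≤ X, (u x : ZMod m) = ((1 + M * x : ℕ) : ZMod m) := by
    intro x hx
    simp only [u, dif_pos (hM x hx), ZMod.coe_unitOfCoprime]
  obtain ⟨x0, d, hd0, hdX, hxX, hcol⟩ := hX (fun x => emb (QuotientGroup.mk (u x)))
  have hcol' : ∀ l ≤ s, ∃ σ : L ≃ₐ[K] L, σ ∈ H1 ∧ χ σ = (u x0)⁻¹ * u (x0 + d * l) := by
    intro l hl
    have := (QuotientGroup.eq.1 (hemb (hcol l hl)).symm)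
    obtain ⟨σ, h1, h2⟩ := this
    exact ⟨σ, h1, h2⟩
  set r : ℕ := (((u x0)⁻¹ : (ZMod m)ˣ) : ZMod m).val with hr
  have hrc : Nat.Coprime r m := ZMod.val_coe_unit_coprime _
  have hrcast : (r : ZMod m) = (((u x0)⁻¹ : (ZMod m)ˣ) : ZMod m) := ZMod.natCast_zmod_val _
  have hl : ∀ l ≤ Fintype.card (Fin s),
      ∑ i, (algebraMap K L (c i) * g i) * (η i ^ (M * d * r)) ^ l = 0 := by
    intro l hl
    rw [Fintype.card_fin] at hl
    obtain ⟨σ, hσ, hσχ⟩ := hcol' l hl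
    have hσb : ∀ i, σ (b i) = b i := fun i => (Subgroup.mem_iInf.1 hσ i)
    have hση : ∀ i, σ (η i) = η i * (η i ^ (M * d * r)) ^ l := by
      intro i
      rw [gal_pow hξ σ (hηm i), ← pow_mul, ← pow_succ']
      apply pow_eq_pow_of_modEq _ (hηm i)
      rw [← ZMod.natCast_eq_natCast_iff, ZMod.natCast_zmod_val]
      have hle : x0 + d * l ≤ X := le_trans (by gcongr) hxX
      have h1 : (u x0 : ZMod m) * r = 1 := by rw [hrcast]; simp
      rw [hu x0 (by omega)] at h1
      rw [← hχ, hσχ, Units.val_mul, ← hrcast, hu _ hle]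
      push_cast at h1 ⊢
      linear_combination h1
    have h2 : ∑ i, algebraMap K L (c i) * (g i / g j0) = 0 := by
      simp_rw [← mul_div_assoc]
      rw [← Finset.sum_div, hsum, zero_div]
    have h3 := congrArg σ h2
    rw [map_sum, map_zero] at h3
    have h4 : g j0 * ∑ i, σ (algebraMap K L (c i) * (g i / g j0)) = 0 := by rw [h3, mul_zero]
    rw [← h4, Finset.mul_sum]
    refine Finset.sum_congr rfl fun i _ => ?_
    have h5 : g i = g j0 * (η i * b i) := by
      rw [← hηb, mul_div_cancel₀ _ (hg0 j0)]
    rw [map_mul, AlgEquiv.commutes, hηb, map_mul, hσb, hση]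
    nth_rewrite 1 [h5]
    ring
  have heq := fun i => all_eq_of_nondeg _ _ hl hnd i j0
  have hmdvd : m ∣ M * d * r := by
    apply Finset.lcm_dvd
    intro i _
    rw [orderOf_dvd_iff_pow_eq_one, heq i, hη1 j0 rfl, one_pow]
  have hfin := hMd d hd0 hdX (Nat.Coprime.dvd_of_dvd_mul_right hrc.symm hmdvd)
  obtain ⟨a, ha⟩ := hbw i0
  refine ⟨a ^ ((X + 1).factorial * X.factorial), ?_⟩
  rw [hηb, mul_pow, pow_mul (b i0), ha, map_pow]
  obtain ⟨e, he⟩ := hfin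
  rw [mul_comm w, he, mul_assoc m, pow_mul, hηm, one_pow, one_mul]

open scoped IntermediateField.algebraAdjoinAdjoin in
theorem finite_algClosure (F K : Type*) [Field F] [Field K] [Algebra F K] [Algebra.EssFiniteType F K] :
    FiniteDimensional F (algebraicClosure F K) := by
  classical
  obtain ⟨ι, x, hx⟩ := exists_isTranscendenceBasis' F K
  have hx' : AlgebraicIndependent (algebraicClosure F K) x := hx.1.algebraicClosure
  have halg := hx.isAlgebraic_field
  have hE : Algebra.EssFiniteType (IntermediateField.adjoin F (Set.range x)) K :=
    Algebra.EssFiniteType.of_comp F _ _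
  have hfin : Module.Finite (IntermediateField.adjoin F (Set.range x)) K :=
    Algebra.finite_of_essFiniteType_of_isAlgebraic
  let b := Module.Basis.ofVectorSpace F (algebraicClosure F K)
  have hli : LinearIndependent (Algebra.adjoin F (Set.range x)) (fun i => (b i : K)) := by
    rw [linearIndependent_iff']
    intro s g hg
    have hp : ∀ i, ∃ p : MvPolynomial ι F, MvPolynomial.aeval x p = (g i : K) := by
      intro i
      have h5 : ∀ y ∈ Algebra.adjoin F (Set.range x), ∃ p : MvPolynomial ι F,
          MvPolynomial.aeval x p = y := by
        intro y hy
        rw [Algebra.adjoin_range_eq_range_aeval] at hy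
        exact hy
      exact h5 _ (g i).2
    choose p hp using hp
    have h0 : MvPolynomial.aeval x (∑ i ∈ s, MvPolynomial.C (b i) *
        MvPolynomial.map (algebraMap F (algebraicClosure F K)) (p i)) = 0 := by
      rw [map_sum, ← hg]
      refine Finset.sum_congr rfl fun i _ => ?_
      rw [map_mul, MvPolynomial.aeval_map_algebraMap, hp, MvPolynomial.aeval_C, mul_comm]
      rfl
    have h1 := (injective_iff_map_eq_zero _).1 hx' _ h0
    intro i hi
    have h2 : p i = 0 := by
      ext m
      have h3 := congrArg (MvPolynomial.coeff m) h1
      rw [MvPolynomial.coeff_sum] at h3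
      simp only [MvPolynomial.coeff_C_mul, MvPolynomial.coeff_map, MvPolynomial.coeff_zero] at h3
      have h4 : ∑ i ∈ s, (MvPolynomial.coeff m (p i)) • b i = 0 := by
        rw [← h3]
        refine Finset.sum_congr rfl fun i _ => ?_
        rw [Algebra.smul_def, mul_comm]
      exact linearIndependent_iff'.1 b.linearIndependent s _ h4 i hi
    apply Subtype.ext
    rw [← hp, h2, map_zero]; rfl
  have hli2 := (LinearIndependent.iff_fractionRing (Algebra.adjoin F (Set.range x))
    (IntermediateField.adjoin F (Set.range x))).1 hli
  have := hli2.finite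
  exact Module.Finite.of_basis b

theorem exists_numberField (K : Type) [Field K] [CharZero K] [Algebra.EssFiniteType ℚ K] :
    ∃ (k : Type) (_ : Field k) (_ : NumberField k) (_ : Algebra k K),
      ∀ x : K, IsAlgebraic ℚ x → ∃ a : k, algebraMap k K a = x := by
  have h1 := finite_algClosure ℚ K
  have hN : NumberField (algebraicClosure ℚ K) :=
    { to_charZero := inferInstance
      to_finiteDimensional := by convert h1 }
  refine ⟨algebraicClosure ℚ K, inferInstance, hN, inferInstance, ?_⟩
  intro x hx
  exact ⟨⟨x, mem_algebraicClosure_iff.2 hx⟩, rfl⟩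

theorem exists_w {k K : Type*} [Field k] [NumberField k] [Field K] [CharZero K] [Algebra k K]
    (hk : ∀ x : K, IsAlgebraic ℚ x → ∃ a : k, algebraMap k K a = x) :
    ∃ w : ℕ, 0 < w ∧ ∀ ζ : K, ∀ n : ℕ, 0 < n → ζ ^ n = 1 → ζ ^ w = 1 := by
  refine ⟨NumberField.Units.torsionOrder k, NumberField.Units.torsionOrder_pos k, ?_⟩
  intro ζ n hn hζ
  have hint : IsIntegral ℚ ζ := IsIntegral.of_pow hn (by rw [hζ]; exact isIntegral_one)
  obtain ⟨a, rfl⟩ := hk ζ hint.isAlgebraic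
  have ha : a ^ n = 1 := by
    apply (algebraMap k K).injective
    rw [map_pow, hζ, map_one]
  have hai : IsIntegral ℤ a := IsIntegral.of_pow hn (by rw [ha]; exact isIntegral_one)
  obtain ⟨b, hb⟩ : ∃ b : NumberField.RingOfIntegers k,
      algebraMap (NumberField.RingOfIntegers k) k b = a := ⟨⟨a, hai⟩, rfl⟩
  have ha' : b ^ n = 1 := by
    apply NumberField.RingOfIntegers.coe_injective
    rw [map_pow, hb, ha, map_one]
  let u : (NumberField.RingOfIntegers k)ˣ := Units.ofPowEqOne _ n ha' hn.ne'
  have hu : u ∈ NumberField.Units.torsion k := by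
    rw [NumberField.Units.torsion, CommGroup.mem_torsion, isOfFinOrder_iff_pow_eq_one]
    exact ⟨n, hn, Units.pow_ofPowEqOne ha' hn.ne'⟩
  have h2 : (⟨u, hu⟩ : NumberField.Units.torsion k) ^ NumberField.Units.torsionOrder k = 1 :=
    pow_card_eq_one'
  have h3 : u ^ NumberField.Units.torsionOrder k = 1 := congrArg Subtype.val h2
  have h4 : a ^ NumberField.Units.torsionOrder k = 1 := by
    have h5 : b ^ NumberField.Units.torsionOrder k = 1 := congrArg Units.val h3
    rw [← hb, ← map_pow, h5, map_one]
  rw [← map_pow, h4, map_one]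

theorem index_le {k K L : Type*} [Field k] [NumberField k] [Field K] [CharZero K] [Algebra k K]
    (hk : ∀ x : K, IsAlgebraic ℚ x → ∃ a : k, algebraMap k K a = x)
    [Field L] [Algebra K L] [IsAlgClosure K L] (m : ℕ) [NeZero m] (ξ : L)
    (hξ : IsPrimitiveRoot ξ m) :
    (hξ.autToPow K).range.index ≤ Module.finrank ℚ k := by
  classical
  have hcL : CharZero L := charZero_of_injective_algebraMap (algebraMap K L).injective
  have hm : 0 < m := NeZero.pos m
  have hac : IsAlgClosed L := IsAlgClosure.isAlgClosed K
  have hnorm : Normal K L := IsAlgClosure.normal K L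
  have halg : Algebra.IsAlgebraic K L := IsAlgClosure.isAlgebraic
  let r := Nat.card (hξ.autToPow K).range
  have hint : IsIntegral K ξ := (halg.isAlgebraic ξ).isIntegral
  -- degree bound over K
  have hdeg : (minpoly K ξ).natDegree ≤ r := by
    have hsep : (minpoly K ξ).Separable := (minpoly.irreducible hint).separable
    have h1 : Fintype.card ((minpoly K ξ).rootSet L) = (minpoly K ξ).natDegree :=
      Polynomial.card_rootSet_eq_natDegree hsep (IsAlgClosed.splits _)
    rw [← h1, ← Nat.card_eq_fintype_card]
    have h2 : ∀ y : (minpoly K ξ).rootSet L, ∃ z : (hξ.autToPow K).range,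
        (y : L) = ξ ^ ((z : (ZMod m)ˣ) : ZMod m).val := by
      rintro ⟨y, hy⟩
      obtain ⟨σ, hσ⟩ := minpoly.exists_algEquiv_of_root' (halg.isAlgebraic ξ)
        (Polynomial.aeval_eq_zero_of_mem_rootSet hy)
      refine ⟨⟨hξ.autToPow K σ, σ, rfl⟩, ?_⟩
      exact hσ.symm.trans (hξ.autToPow_spec K σ).symm
    choose f hf using h2
    exact Nat.card_le_card_of_injective f fun a b hab => by
      apply Subtype.ext
      rw [hf, hf, hab]
  -- descend to k
  let : Algebra k L := ((algebraMap K L).comp (algebraMap k K)).toAlgebra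
  have : IsScalarTower k K L := IsScalarTower.of_algebraMap_eq fun _ => rfl
  have hlift : minpoly K ξ ∈ Polynomial.lifts (algebraMap (integralClosure ℚ K) K) := by
    refine integralClosure.mem_lifts_of_monic_of_dvd_map K
      (f := (Polynomial.X ^ m - 1 : Polynomial ℚ)) (Polynomial.monic_X_pow_sub_C 1 hm.ne')
      (minpoly.monic hint) ?_
    apply minpoly.dvd
    simp [hξ.pow_eq_one]
  have hlift2 : minpoly K ξ ∈ Polynomial.lifts (algebraMap k K) := by
    rw [Polynomial.lifts_iff_coeff_lifts] at hlift ⊢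
    intro n
    obtain ⟨a, ha⟩ := hlift n
    obtain ⟨b, hb⟩ := hk _ (show IsIntegral ℚ (a : K) from a.2).isAlgebraic
    exact ⟨b, hb.trans ha⟩
  obtain ⟨p, hp, hpd, hpm⟩ := Polynomial.lifts_and_natDegree_eq_and_monic hlift2 (minpoly.monic hint)
  have hpx : Polynomial.aeval ξ p = 0 := by
    rw [← Polynomial.aeval_map_algebraMap K, hp, minpoly.aeval]
  have hintk : IsIntegral k ξ := ⟨p, hpm, hpx⟩
  have hfr : Module.finrank k (IntermediateField.adjoin k {ξ}) ≤ r := by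
    rw [IntermediateField.adjoin.finrank hintk]
    refine le_trans (Polynomial.natDegree_le_of_dvd (minpoly.dvd _ _ hpx) hpm.ne_zero) ?_
    rw [hpd]; exact hdeg
  have : FiniteDimensional k (IntermediateField.adjoin k {ξ}) :=
    IntermediateField.adjoin.finiteDimensional hintk
  have : FiniteDimensional ℚ (IntermediateField.adjoin k {ξ}) := Module.Finite.trans k _
  have hg : IsPrimitiveRoot (IntermediateField.AdjoinSimple.gen k ξ) m := by
    apply IsPrimitiveRoot.of_map_of_injective
      (f := algebraMap (IntermediateField.adjoin k {ξ}) L)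
    · simpa using hξ
    · exact (algebraMap (IntermediateField.adjoin k {ξ}) L).injective
  have hphi : m.totient ≤ Module.finrank ℚ (IntermediateField.adjoin k {ξ}) := by
    rw [← Polynomial.natDegree_cyclotomic m ℚ, Polynomial.cyclotomic_eq_minpoly_rat hg hm]
    exact minpoly.natDegree_le _
  have hmul := Module.finrank_mul_finrank ℚ k (IntermediateField.adjoin k {ξ})
  have hidx := (hξ.autToPow K).range.card_mul_index
  rw [Nat.card_eq_fintype_card, Nat.card_eq_fintype_card, ZMod.card_units_eq_totient,
    ← Nat.card_eq_fintype_card] at hidx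
  have hr : 0 < r := Nat.card_pos
  have : r * (hξ.autToPow K).range.index ≤ r * Module.finrank ℚ k := by
    calc _ = m.totient := hidx
      _ ≤ _ := hphi
      _ = Module.finrank ℚ k * Module.finrank k (IntermediateField.adjoin k {ξ}) := hmul.symm
      _ ≤ Module.finrank ℚ k * r := Nat.mul_le_mul_left _ hfr
      _ = _ := mul_comm _ _
  exact Nat.le_of_mul_le_mul_left this hr

open IsDedekindDomain in
/-- The valuation of a height one prime as a homomorphism to the integers. -/
noncomputable def ordHom {O K : Type*} [CommRing O] [IsDedekindDomain O] [Field K] [Algebra O K]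
    [IsFractionRing O K] (v : HeightOneSpectrum O) : Kˣ →* Multiplicative ℤ :=
  (WithZero.unitsWithZeroEquiv (α := Multiplicative ℤ)).toMonoidHom.comp
    (Units.map ((v.valuation K : Valuation K (WithZero (Multiplicative ℤ))) :
      K →* WithZero (Multiplicative ℤ)))

open IsDedekindDomain in
theorem ordHom_eq_one {O K : Type*} [CommRing O] [IsDedekindDomain O] [Field K] [Algebra O K]
    [IsFractionRing O K] (v : HeightOneSpectrum O) (x : Kˣ) (h : ordHom v x = 1) :
    v.valuation K (x : K) = 1 := by
  have h1 : (Units.map ((v.valuation K : Valuation K (WithZero (Multiplicative ℤ))) :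
      K →* WithZero (Multiplicative ℤ))) x = 1 :=
    (map_eq_one_iff _ (WithZero.unitsWithZeroEquiv (α := Multiplicative ℤ)).injective).1 h
  exact congrArg Units.val h1

open scoped IntermediateField.algebraAdjoinAdjoin in
open IsDedekindDomain in
theorem exists_val_aux {F K : Type*} [Field F] [Field K] [CharZero F] [Algebra F K]
    [Algebra.EssFiniteType F K] (x : Kˣ) (hx : Transcendental F (x : K))
    (halg : Algebra.IsAlgebraic (IntermediateField.adjoin F {(x : K)}) K) :
    ∃ v : Kˣ →* Multiplicative ℤ, v x ≠ 1 := by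
  let R := Algebra.adjoin F {(x : K)}
  let E := IntermediateField.adjoin F {(x : K)}
  have hE : Algebra.EssFiniteType E K := Algebra.EssFiniteType.of_comp F _ _
  have hfin : Module.Finite E K := Algebra.finite_of_essFiniteType_of_isAlgebraic
  have hmemR : ∀ y : R, ∃ p : Polynomial F, Polynomial.aeval (x : K) p = y := by
    have h5 : ∀ y ∈ Algebra.adjoin F {(x : K)}, ∃ p : Polynomial F,
        Polynomial.aeval (x : K) p = y := by
      intro y hy
      rw [Algebra.adjoin_singleton_eq_range_aeval] at hy
      exact hy
    exact fun y => h5 _ y.2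
  let xR : R := ⟨x, Algebra.self_mem_adjoin_singleton F _⟩
  have hpid : IsPrincipalIdealRing R := by
    let f : Polynomial F →ₐ[F] R := Polynomial.aeval xR
    refine IsPrincipalIdealRing.of_surjective f.toRingHom ?_
    intro y
    obtain ⟨p, hp⟩ := hmemR y
    refine ⟨p, ?_⟩
    apply Subtype.ext
    rw [← hp]
    change R.val (Polynomial.aeval xR p) = _
    rw [← Polynomial.aeval_algHom_apply]
    rfl
  have hded : IsDedekindDomain R := inferInstance
  have hcE : CharZero E := charZero_of_injective_algebraMap (algebraMap F E).injective
  have hsep : Algebra.IsSeparable E K := inferInstance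
  let O := integralClosure R K
  have hO : IsDedekindDomain O := integralClosure.isDedekindDomain R E K
  have hOf : IsFractionRing O K := integralClosure.isFractionRing_of_finite_extension E K
  let xO : O := algebraMap R O xR
  have hnu : ¬ IsUnit xO := by
    intro h
    have hinj : Function.Injective (algebraMap R O) := by
      intro a b hab
      apply Subtype.ext
      have := congrArg (algebraMap O K) hab
      exact this
    have hfs : FaithfulSMul R O := (faithfulSMul_iff_algebraMap_injective R O).2 hinj
    have hint : Algebra.IsIntegral R O := inferInstance
    have h2 : IsUnit xR := (Algebra.IsIntegral.isLocalHom (R := R) (S := O)).map_nonunit _ h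
    obtain ⟨y, hy⟩ := h2.exists_right_inv
    obtain ⟨p, hp⟩ := hmemR y
    have h3 : Polynomial.aeval (x : K) (Polynomial.X * p) = Polynomial.aeval (x : K) (1 : Polynomial F) := by
      rw [map_mul, Polynomial.aeval_X, hp, map_one]
      exact congrArg Subtype.val hy
    have h4 := transcendental_iff_injective.1 hx h3
    exact Polynomial.not_isUnit_X (IsUnit.of_mul_eq_one _ h4)
  obtain ⟨m, hm, hxm⟩ := exists_max_ideal_of_mem_nonunits hnu
  have hx0 : xO ≠ 0 := by
    intro h
    have : (x : K) = 0 := congrArg (algebraMap O K) h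
    exact x.ne_zero this
  let v : HeightOneSpectrum O := ⟨m, hm.isPrime, fun h => hx0 (by rw [h] at hxm; simpa using hxm)⟩
  refine ⟨ordHom v, fun h => ?_⟩
  have h1 := ordHom_eq_one v x h
  have h2 : v.valuation K (algebraMap O K xO) < 1 := (v.valuation_lt_one_iff_mem xO).2 hxm
  exact (ne_of_lt h2) h1

open scoped IntermediateField.algebraAdjoinAdjoin in
theorem exists_val {F K : Type*} [Field F] [Field K] [CharZero F] [Algebra F K]
    [Algebra.EssFiniteType F K] (x : Kˣ) (hx : Transcendental F (x : K)) :
    ∃ v : Kˣ →* Multiplicative ℤ, v x ≠ 1 := by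
  have h1 : AlgebraicIndepOn F id {(x : K)} := by
    rw [AlgebraicIndepOn, algebraicIndependent_unique_type_iff]
    exact hx
  obtain ⟨t, hxt, ht⟩ := exists_isTranscendenceBasis_superset h1
  let M := IntermediateField.adjoin F (t \ {(x : K)})
  have hxM : Transcendental M (x : K) := by
    have h2 := ht.1.transcendental_adjoin (s := {y | (y : K) ≠ x})
      (i := ⟨(x : K), hxt rfl⟩) (by simp)
    have h3 : (((↑) : t → K) '' {y | (y : K) ≠ x}) = t \ {(x : K)} := by
      ext z
      simp only [Set.mem_image, Set.mem_ofPred_eq, Subtype.exists, Set.mem_sdiff,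
        Set.mem_singleton_iff]
      constructor
      · rintro ⟨a, b, c, rfl⟩
        exact ⟨b, c⟩
      · rintro ⟨a, b⟩
        exact ⟨z, a, b, rfl⟩
    rw [h3] at h2
    exact h2.extendScalars M
  have hE : Algebra.EssFiniteType M K := Algebra.EssFiniteType.of_comp F _ _
  have hcM : CharZero M := charZero_of_injective_algebraMap (algebraMap F M).injective
  refine exists_val_aux x hxM ?_
  have halg := ht.isAlgebraic_field
  rw [Subtype.range_coe] at halg
  let E := IntermediateField.adjoin M {(x : K)}
  have hle : IntermediateField.adjoin F t ≤ E.restrictScalars F := by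
    rw [IntermediateField.adjoin_le_iff]
    intro z hz
    by_cases h : z = x
    · subst h
      exact IntermediateField.mem_adjoin_simple_self M _
    · have : z ∈ M := IntermediateField.subset_adjoin F _ ⟨hz, h⟩
      exact E.algebraMap_mem ⟨z, this⟩
  let : Algebra (IntermediateField.adjoin F t) E :=
    (IntermediateField.inclusion hle).toRingHom.toAlgebra
  have : IsScalarTower (IntermediateField.adjoin F t) E K :=
    IsScalarTower.of_algebraMap_eq fun _ => rfl
  exact Algebra.IsAlgebraic.tower_top (K := IntermediateField.adjoin F t) E

lemma noeth_of_ker {A P : Type*} [AddCommGroup A] [AddCommGroup P] [IsNoetherian ℤ P]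
    (g : A →ₗ[ℤ] P) (h : IsNoetherian ℤ (LinearMap.ker g)) : IsNoetherian ℤ A :=
  isNoetherian_of_range_eq_ker (LinearMap.ker g).subtype g (Submodule.range_subtype _)

lemma noeth_of_le {A : Type*} [AddCommGroup A] {p q : Submodule ℤ A} (h : p ≤ q)
    (hq : IsNoetherian ℤ q) : IsNoetherian ℤ p :=
  isNoetherian_of_injective (Submodule.inclusion h) (Submodule.inclusion_injective h)

lemma noeth_comap {A B : Type*} [AddCommGroup A] [AddCommGroup B] (i : B →ₗ[ℤ] A)
    (hi : Function.Injective i) (q : Submodule ℤ A) (p : Submodule ℤ B) (h : ∀ b ∈ p, i b ∈ q)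
    (hq : IsNoetherian ℤ q) : IsNoetherian ℤ p :=
  isNoetherian_of_injective (i.restrict h) (fun a b hab => by
    apply Subtype.ext
    apply hi
    exact congrArg Subtype.val hab)

theorem stage (n : ℕ) : ∀ (A : Type) [AddCommGroup A], Module.rank ℤ A ≤ n →
    ∀ (ι : Type) (f : A →ₗ[ℤ] (ι → ℤ)), IsNoetherian ℤ (LinearMap.ker f) → IsNoetherian ℤ A := by
  induction n using Nat.strong_induction_on with
  | _ n ih =>
    intro A _ hA ι f hf
    by_cases h0 : f = 0
    · subst h0
      rw [LinearMap.ker_zero] at hf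
      exact isNoetherian_top_iff.1 hf
    obtain ⟨i, hi⟩ : ∃ i, (LinearMap.proj i).comp f ≠ (0 : A →ₗ[ℤ] ℤ) := by
      by_contra! h
      apply h0
      ext a i
      exact LinearMap.congr_fun (h i) a
    set g : A →ₗ[ℤ] ℤ := (LinearMap.proj i).comp f with hg
    have hr := LinearMap.rank_range_add_rank_ker g
    have hpos : 1 ≤ Module.rank ℤ (LinearMap.range g) := by
      rw [Cardinal.one_le_iff_ne_zero]
      intro h
      rw [Submodule.rank_eq_zero, LinearMap.range_eq_bot] at h
      exact hi h
    have hker : Module.rank ℤ (LinearMap.ker g) + 1 ≤ n := by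
      rw [add_comm]
      exact (add_le_add_left hpos _).trans (hr.le.trans hA)
    obtain ⟨m, hm⟩ : ∃ m : ℕ, Module.rank ℤ (LinearMap.ker g) = m := by
      apply Cardinal.lt_aleph0.1
      exact lt_of_le_of_lt (le_trans (self_le_add_right _ _) hker) Cardinal.natCast_lt_aleph0
    rw [hm] at hker
    have hmn : m < n := by exact_mod_cast hker
    apply noeth_of_ker g
    refine ih m hmn (LinearMap.ker g) hm.le ι (f.comp (LinearMap.ker g).subtype) ?_
    exact noeth_comap (LinearMap.ker g).subtype Subtype.val_injective (LinearMap.ker f) _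
      (fun b hb => hb) hf

lemma lift_hom {A M N : Type*} [AddCommGroup A] [CommGroup M] [CommGroup N] {J : Type*}
    (φ : M →* N) (hφ : Function.Injective φ) (U : A →ₗ[ℤ] (J → Additive N))
    (h : ∀ a j, ∃ m, φ m = (U a j).toMul) :
    ∃ U' : A →ₗ[ℤ] (J → Additive M), ∀ a j, φ (U' a j).toMul = (U a j).toMul := by
  choose u hu using h
  let f : A →+ (J → Additive M) := AddMonoidHom.mk' (fun a j => Additive.ofMul (u a j)) (by
    intro a b
    funext j
    apply Additive.toMul.injective
    apply hφ
    simp [hu])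
  exact ⟨f.toIntLinearMap, fun a j => hu a j⟩

lemma toInts {A M : Type} [AddCommGroup A] [CommGroup M] {J I : Type}
    (U : A →ₗ[ℤ] (J → Additive M)) (v : I → (M →* Multiplicative ℤ)) :
    ∃ f : A →ₗ[ℤ] (J × I → ℤ), ∀ a, f a = 0 ↔ ∀ j i, v i (U a j).toMul = 1 := by
  let f : A →+ (J × I → ℤ) := AddMonoidHom.mk' (fun a p => (v p.2 (U a p.1).toMul).toAdd) (by
    intro a b
    funext p
    simp)
  refine ⟨f.toIntLinearMap, fun a => ?_⟩
  constructor
  · intro h j i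
    exact Multiplicative.toAdd.injective (congrFun h (j, i))
  · intro h
    funext p
    change (v p.2 (U a p.1).toMul).toAdd = 0
    rw [h]; rfl

open IsDedekindDomain in
theorem noeth_numberField {k : Type} [Field k] [NumberField k] (n : ℕ) (A : Type) [AddCommGroup A]
    (hA : Module.rank ℤ A ≤ n) (J : Type) [Finite J] (U : A →ₗ[ℤ] (J → Additive kˣ))
    (hU : IsNoetherian ℤ (LinearMap.ker U)) : IsNoetherian ℤ A := by
  let O := NumberField.RingOfIntegers k
  obtain ⟨f, hf⟩ := toInts U (fun v : HeightOneSpectrum O => ordHom (K := k) v)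
  refine stage n A hA _ f ?_
  let φ : Oˣ →* kˣ := Units.map (algebraMap O k : O →* k)
  have hφ : Function.Injective φ :=
    Units.map_injective (FaithfulSMul.algebraMap_injective O k)
  obtain ⟨U', hU'⟩ := lift_hom φ hφ (U.comp (LinearMap.ker f).subtype) (by
    rintro ⟨a, ha⟩ j
    have h1 := (hf a).1 ha j
    set x : kˣ := (U a j).toMul with hx
    have h2 : ∀ v : HeightOneSpectrum O, v.valuation k (x : k) = 1 :=
      fun v => ordHom_eq_one v x (h1 v)
    have h3 : ∀ v : HeightOneSpectrum O, v.valuation k ((x⁻¹ : kˣ) : k) = 1 :=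
      fun v => ordHom_eq_one v x⁻¹ (by rw [map_inv, h1 v, inv_one])
    obtain ⟨y, hy⟩ := HeightOneSpectrum.mem_integers_of_valuation_le_one (R := O) k (x : k)
      fun v => (h2 v).le
    obtain ⟨z, hz⟩ := HeightOneSpectrum.mem_integers_of_valuation_le_one (R := O) k ((x⁻¹ : kˣ) : k)
      fun v => (h3 v).le
    have hyz : y * z = 1 := by
      apply FaithfulSMul.algebraMap_injective O k
      rw [map_mul, hy, hz, map_one]
      simp
    refine ⟨⟨y, z, hyz, by rw [mul_comm, hyz]⟩, ?_⟩
    apply Units.ext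
    exact hy)
  have : IsNoetherian ℤ (Additive Oˣ) := isNoetherian_of_isNoetherianRing_of_finite ℤ _
  apply noeth_of_ker U'
  refine noeth_comap (LinearMap.ker f).subtype Subtype.val_injective (LinearMap.ker U) _ ?_ hU
  intro b hb
  rw [LinearMap.mem_ker] at hb ⊢
  funext j
  apply Additive.toMul.injective
  have h1 := hU' b j
  rw [hb] at h1
  simpa using h1.symm

theorem noeth_fg {K : Type} [Field K] [CharZero K] [Algebra.EssFiniteType ℚ K]
    (n : ℕ) (A : Type) [AddCommGroup A]
    (hA : Module.rank ℤ A ≤ n) (J : Type) [Finite J] (U : A →ₗ[ℤ] (J → Additive Kˣ))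
    (hU : IsNoetherian ℤ (LinearMap.ker U)) : IsNoetherian ℤ A := by
  obtain ⟨k, _, _, _, hk⟩ := exists_numberField K
  obtain ⟨f, hf⟩ := toInts U (fun v : Kˣ →* Multiplicative ℤ => v)
  refine stage n A hA _ f ?_
  let φ : kˣ →* Kˣ := Units.map (algebraMap k K : k →* K)
  have hφ : Function.Injective φ := Units.map_injective (algebraMap k K).injective
  obtain ⟨U', hU'⟩ := lift_hom φ hφ (U.comp (LinearMap.ker f).subtype) (by
    rintro ⟨a, ha⟩ j
    have h1 := (hf a).1 ha j
    set x : Kˣ := (U a j).toMul with hx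
    have h2 : IsAlgebraic ℚ (x : K) := by
      by_contra h
      obtain ⟨v, hv⟩ := exists_val x h
      exact hv (h1 v)
    obtain ⟨y, hy⟩ := hk _ h2
    have hy0 : y ≠ 0 := by
      rintro rfl
      rw [map_zero] at hy
      exact x.ne_zero hy.symm
    refine ⟨Units.mk0 y hy0, ?_⟩
    apply Units.ext
    exact hy)
  refine noeth_numberField n (LinearMap.ker f) ((Submodule.rank_le _).trans hA) J U' ?_
  refine noeth_comap (LinearMap.ker f).subtype Subtype.val_injective (LinearMap.ker U) _ ?_ hU
  intro b hb
  rw [LinearMap.mem_ker] at hb ⊢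
  funext j
  apply Additive.toMul.injective
  have h1 := hU' b j
  rw [hb] at h1
  simpa using h1.symm

/-- The linear form `q ↦ q·β` on rational vectors. -/
noncomputable def dotHom {t : ℕ} (β : Fin t → ℂ) : (Fin t → ℚ) →+ ℂ :=
  AddMonoidHom.mk' (fun q => ∑ j, (q j : ℂ) * β j) (by
    intro a b
    rw [← Finset.sum_add_distrib]
    refine Finset.sum_congr rfl fun j _ => ?_
    rw [Pi.add_apply]
    push_cast
    ring)

lemma common_den {t : ℕ} (G : Submodule ℤ (Fin t → ℚ)) (hG : IsNoetherian ℤ G) :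
    ∃ N : ℕ, 0 < N ∧ ∀ q ∈ G, ∀ j, ∃ z : ℤ, (N : ℚ) * q j = z := by
  have hfg : G.FG := Module.Finite.iff_fg.1 (inferInstance : Module.Finite ℤ G)
  obtain ⟨S, hS⟩ := hfg
  refine ⟨∏ g ∈ S, ∏ j, (g j).den, Finset.prod_pos fun g _ => Finset.prod_pos fun j _ => (g j).pos, ?_⟩
  intro q hq
  rw [← hS] at hq
  induction hq using Submodule.span_induction with
  | mem x hx =>
    intro j
    have h1 : (x j).den ∣ ∏ g ∈ S, ∏ j, (g j).den :=
      (Finset.dvd_prod_of_mem (fun j => (x j).den) (Finset.mem_univ j)).trans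
        (Finset.dvd_prod_of_mem (fun g : Fin t → ℚ => ∏ j, (g j).den) hx)
    obtain ⟨c, hc⟩ := h1
    refine ⟨c * (x j).num, ?_⟩
    rw [hc]
    push_cast
    have := Rat.mul_den_eq_num (x j)
    linear_combination (c : ℚ) * this
  | zero => intro j; exact ⟨0, by simp⟩
  | add x y _ _ hx hy =>
    intro j
    obtain ⟨a, ha⟩ := hx j
    obtain ⟨b, hb⟩ := hy j
    exact ⟨a + b, by rw [Pi.add_apply, mul_add, ha, hb]; push_cast; rfl⟩
  | smul m x _ hx =>
    intro j
    obtain ⟨a, ha⟩ := hx j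
    refine ⟨m * a, ?_⟩
    rw [Pi.smul_apply, zsmul_eq_mul, Int.cast_mul, ← ha]
    ring

theorem essFinite_rat (K : IntermediateField ℚ ℂ) (hK : K.FG) :
    @Algebra.EssFiniteType ℚ K _ _ DivisionRing.toRatAlgebra := by
  have h := IntermediateField.essFiniteType_iff.2 hK
  have e : (DivisionRing.toRatAlgebra : Algebra ℚ K) = K.algebra' := Subsingleton.elim _ _
  rw [e]
  exact h

theorem denG (t s : ℕ) (α : Fin s → Fin t → ℂ) (V' : Submodule ℚ (Fin t → ℚ))
    (K : IntermediateField ℚ ℂ) (hK : K.FG)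
    (hV' : ∀ q ∈ V', (∀ i i', dotHom (α i) q = dotHom (α i') q) → q = 0) :
    ∃ N : ℕ, 0 < N ∧ ∀ q ∈ V',
      (∀ i i', Complex.exp (dotHom (α i) q - dotHom (α i') q) ∈ K) →
      ∀ j, ∃ z : ℤ, (N : ℚ) * q j = z := by
  have hE := essFinite_rat K hK
  let G : Submodule ℤ (Fin t → ℚ) :=
    { carrier := {q | q ∈ V' ∧ ∀ i i', Complex.exp (dotHom (α i) q - dotHom (α i') q) ∈ K}
      zero_mem' := ⟨V'.zero_mem, fun i i' => by simp⟩
      add_mem' := by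
        rintro a b ⟨ha, ha'⟩ ⟨hb, hb'⟩
        refine ⟨V'.add_mem ha hb, fun i i' => ?_⟩
        rw [map_add, map_add, add_sub_add_comm, Complex.exp_add]
        exact mul_mem (ha' i i') (hb' i i')
      smul_mem' := by
        rintro m a ⟨ha, ha'⟩
        refine ⟨zsmul_mem ha m, fun i i' => ?_⟩
        rw [map_zsmul, map_zsmul, ← smul_sub, zsmul_eq_mul, Complex.exp_int_mul]
        exact zpow_mem (ha' i i') m }
  have hG : IsNoetherian ℤ G := by
    let u : G → (Fin s × Fin s → Additive Kˣ) := fun q p =>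
      Additive.ofMul (Units.mk0 (⟨_, q.2.2 p.1 p.2⟩ : K)
        (fun h => Complex.exp_ne_zero _ (congrArg Subtype.val h)))
    let U : G →ₗ[ℤ] (Fin s × Fin s → Additive Kˣ) := (AddMonoidHom.mk' u (by
      intro a b
      funext p
      apply Additive.toMul.injective
      apply Units.ext
      apply Subtype.ext
      change Complex.exp (dotHom (α p.1) (a.1 + b.1) - dotHom (α p.2) (a.1 + b.1)) =
        Complex.exp (dotHom (α p.1) a.1 - dotHom (α p.2) a.1) *
        Complex.exp (dotHom (α p.1) b.1 - dotHom (α p.2) b.1)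
      rw [map_add, map_add, add_sub_add_comm, Complex.exp_add])).toIntLinearMap
    have hrank : Module.rank ℤ G ≤ (t : ℕ) := by
      refine (Submodule.rank_le G).trans ?_
      rw [← IsFractionRing.rank_right_eq ℤ ℚ (Fin t → ℚ)]
      simp
    refine noeth_fg (K := K) t G hrank _ U ?_
    have h1 : ∀ (q : LinearMap.ker U) (p : Fin s × Fin s), ∃ n : ℤ,
        dotHom (α p.1) q.1.1 - dotHom (α p.2) q.1.1 = n * (2 * Real.pi * Complex.I) := by
      intro q p
      rw [← Complex.exp_eq_one_iff]
      have h2 : U q.1 = 0 := q.2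
      have h3 := congrFun h2 p
      have h4 : (((U q.1 p).toMul : Kˣ) : K) = 1 := by rw [h3]; rfl
      exact congrArg Subtype.val h4
    choose n hn using h1
    have hpi : (2 * Real.pi * Complex.I : ℂ) ≠ 0 := Complex.two_pi_I_ne_zero
    let f : LinearMap.ker U →ₗ[ℤ] (Fin s × Fin s → ℤ) := (AddMonoidHom.mk' n (by
      intro a b
      funext p
      have h2 := hn (a + b) p
      have h3 : ((a + b : LinearMap.ker U) : G).1 = a.1.1 + b.1.1 := rfl
      rw [h3, map_add, map_add, add_sub_add_comm, hn, hn, ← add_mul] at h2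
      have h4 := mul_right_cancel₀ hpi h2
      exact_mod_cast h4.symm)).toIntLinearMap
    refine isNoetherian_of_injective f ?_
    rw [injective_iff_map_eq_zero]
    intro q hq
    apply Subtype.ext
    apply Subtype.ext
    refine hV' _ q.1.2.1 fun i i' => ?_
    have h2 := hn q (i, i')
    have h3 : n q (i, i') = 0 := congrFun hq (i, i')
    rw [h3] at h2
    simpa [sub_eq_zero] using h2
  obtain ⟨N, hN, h⟩ := common_den G hG
  exact ⟨N, hN, fun q hq hq' => h q ⟨hq, hq'⟩⟩

lemma eval_mem_K {t : ℕ} (K : IntermediateField ℚ ℂ) (p : MvPolynomial (Fin t) ℂ)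
    (hp : ∀ d ∈ p.support, p.coeff d ∈ K) (q : Fin t → ℚ) :
    MvPolynomial.eval (fun j => (q j : ℂ)) p ∈ K := by
  rw [MvPolynomial.eval_eq']
  refine sum_mem fun d hd => mul_mem (hp d hd) (prod_mem fun j _ => pow_mem ?_ _)
  exact SubfieldClass.ratCast_mem K (q j)

lemma exp_pow_mem {t : ℕ} (K : IntermediateField ℚ ℂ) (β : Fin t → ℂ)
    (hβ : ∀ j, Complex.exp (β j) ∈ K) (q : Fin t → ℚ) :
    Complex.exp (dotHom β q) ^ (∏ j, (q j).den) ∈ K := by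
  rw [← Complex.exp_nat_mul]
  have h1 : ∀ j, ∃ z : ℤ, ((∏ j, (q j).den : ℕ) : ℚ) * q j = z := by
    intro j
    obtain ⟨c, hc⟩ := Finset.dvd_prod_of_mem (fun j => (q j).den) (Finset.mem_univ j)
    refine ⟨c * (q j).num, ?_⟩
    rw [hc]
    push_cast
    have := Rat.mul_den_eq_num (q j)
    linear_combination (c : ℚ) * this
  choose z hz using h1
  have h2 : ((∏ j, (q j).den : ℕ) : ℂ) * dotHom β q = ∑ j, (z j : ℂ) * β j := by
    change _ * ∑ j, (q j : ℂ) * β j = _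
    rw [Finset.mul_sum]
    refine Finset.sum_congr rfl fun j _ => ?_
    have h3 : ((∏ j, (q j).den : ℕ) : ℂ) * (q j : ℂ) = z j := by exact_mod_cast congrArg (Rat.cast : ℚ → ℂ) (hz j)
    rw [← mul_assoc, h3]
  rw [h2, Complex.exp_sum]
  refine prod_mem fun j _ => ?_
  rw [Complex.exp_int_mul]
  exact zpow_mem (hβ j) _

theorem ratio_mem (t s : ℕ) (P : Fin s → MvPolynomial (Fin t) ℂ) (α : Fin s → Fin t → ℂ)
    (K : IntermediateField ℚ ℂ) (hK : K.FG) (hP : ∀ i, ∀ d ∈ (P i).support, (P i).coeff d ∈ K)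
    (hα : ∀ i j, Complex.exp (α i j) ∈ K) :
    ∃ N : ℕ, 0 < N ∧ ∀ q : Fin t → ℚ,
      (∑ i, MvPolynomial.eval (fun j => (q j : ℂ)) (P i) * Complex.exp (dotHom (α i) q) = 0) →
      (∀ I : Finset (Fin s), I.Nonempty → I ≠ Finset.univ →
          (∑ i ∈ I, MvPolynomial.eval (fun j => (q j : ℂ)) (P i) *
            Complex.exp (dotHom (α i) q)) ≠ 0) →
      ∀ i i', Complex.exp (dotHom (α i) q - dotHom (α i') q) ^ N ∈ K := by
  have hE := essFinite_rat K hK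
  obtain ⟨k, _, _, _, hk⟩ := exists_numberField K
  obtain ⟨w, hw0, hw⟩ := exists_w hk
  let L := algebraicClosure K ℂ
  obtain ⟨N, hN, h⟩ := thmA (K := K) (L := L) w hw0 hw (Module.finrank ℚ k)
    (fun m _ ξ hξ => index_le hk m ξ hξ) s
  refine ⟨N, hN, fun q h1 h2 i i' => ?_⟩
  let n := ∏ j, (q j).den
  have hn : 0 < n := Finset.prod_pos fun j _ => (q j).pos
  have hpow : ∀ i, Complex.exp (dotHom (α i) q) ^ n ∈ K := fun i => exp_pow_mem K _ (hα i) q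
  let c : Fin s → K := fun i => ⟨_, eval_mem_K K (P i) (hP i) q⟩
  let g : Fin s → L := fun i => ⟨Complex.exp (dotHom (α i) q), by
    rw [mem_algebraicClosure_iff]
    apply IsIntegral.isAlgebraic
    refine IsIntegral.of_pow hn ?_
    exact isIntegral_algebraMap (R := K) (x := ⟨_, hpow i⟩)⟩
  have hsum : ∀ I : Finset (Fin s), ((∑ i ∈ I, algebraMap K L (c i) * g i : L) : ℂ) =
      ∑ i ∈ I, MvPolynomial.eval (fun j => (q j : ℂ)) (P i) * Complex.exp (dotHom (α i) q) := by
    intro I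
    have := map_sum (algebraMap L ℂ) (fun i => algebraMap K L (c i) * g i) I
    exact this
  obtain ⟨a, ha⟩ := h c g (fun i h => Complex.exp_ne_zero _ (congrArg Subtype.val h))
    ⟨n, hn, fun i => ⟨⟨_, hpow i⟩, Subtype.ext rfl⟩⟩
    (Subtype.ext ((hsum _).trans h1))
    (fun I hI hI' h0 => h2 I hI hI' ((hsum I).symm.trans (congrArg Subtype.val h0))) i i'
  have ha' := congrArg Subtype.val ha
  rw [Complex.exp_sub]
  have h3 : (Complex.exp (dotHom (α i) q) / Complex.exp (dotHom (α i') q)) ^ N = (a : ℂ) := ha'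
  rw [h3]
  exact a.2

/-- **Theorem 1 (main theorem).** Given `P₁,…,P_s ∈ ℂ[X₁,…,X_t]` and `α₁,…,α_s ∈ ℂ^t`,
there is `N ∈ ℕ^{>0}` such that if `q ∈ ℚ^t` is a nondegenerate solution of
`∑ᵢ Pᵢ(q)·exp(q·αᵢ) = 0`, then `π'(q) ∈ ((1/N)ℤ)^t`.  Here `V` is the space of rational
vectors `q` with `q·αᵢ = q·αᵢ'` for all `i,i'`, `V'` is a complement of `V` in `ℚ^t`,
and `π, π'` are the associated projections. -/
theorem rational_solutions_polyExp_denominator_bound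
    (t s : ℕ) (ht : 0 < t) (hs : 0 < s)
    (P : Fin s → MvPolynomial (Fin t) ℂ) (α : Fin s → Fin t → ℂ)
    (V V' : Submodule ℚ (Fin t → ℚ))
    (hV : ∀ q : Fin t → ℚ, q ∈ V ↔ ∀ i i' : Fin s,
      (∑ j, (q j : ℂ) * α i j) = ∑ j, (q j : ℂ) * α i' j)
    (hcompl : IsCompl V V')
    (π π' : (Fin t → ℚ) →ₗ[ℚ] (Fin t → ℚ))
    (hproj : ∀ q : Fin t → ℚ, π q ∈ V ∧ π' q ∈ V' ∧ π q + π' q = q) :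
    ∃ N : ℕ, 0 < N ∧ ∀ q : Fin t → ℚ,
      -- `q` is a nondegenerate solution of `∑ᵢ Pᵢ(q)·exp(q·αᵢ) = 0` :
      ((∑ i, MvPolynomial.eval (fun j => (q j : ℂ)) (P i) *
          Complex.exp (∑ j, (q j : ℂ) * α i j) = 0) ∧
        (∀ I : Finset (Fin s), I.Nonempty → I ≠ Finset.univ →
          (∑ i ∈ I, MvPolynomial.eval (fun j => (q j : ℂ)) (P i) *
            Complex.exp (∑ j, (q j : ℂ) * α i j)) ≠ 0)) →
      -- conclusion: `π'(q) ∈ ((1/N)ℤ)^t`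
      ∀ j : Fin t, ∃ z : ℤ, π' q j = (z : ℚ) / (N : ℚ) := by
  classical
  let S : Set ℂ := (⋃ i : Fin s, ((P i).coeff '' ((P i).support : Set (Fin t →₀ ℕ)))) ∪
    Set.range (fun p : Fin s × Fin t => Complex.exp (α p.1 p.2))
  have hS : S.Finite := by
    refine Set.Finite.union (Set.finite_iUnion fun i => ?_) (Set.finite_range _)
    exact ((P i).support.finite_toSet).image _
  let K : IntermediateField ℚ ℂ := IntermediateField.adjoin ℚ S
  have hK : K.FG := IntermediateField.fg_adjoin_of_finite hS
  have hSK : S ⊆ K := IntermediateField.subset_adjoin ℚ S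
  obtain ⟨N, hN, h1⟩ := ratio_mem t s P α K hK
    (fun i d hd => hSK (Or.inl (Set.mem_iUnion.2 ⟨i, d, hd, rfl⟩)))
    (fun i j => hSK (Or.inr ⟨(i, j), rfl⟩))
  obtain ⟨N2, hN2, h2⟩ := denG t s α V' K hK (by
    intro q hq h
    have hqV : q ∈ V := (hV q).2 h
    have := hcompl.disjoint.le_bot ⟨hqV, hq⟩
    simpa using this)
  refine ⟨N2 * N, Nat.mul_pos hN2 hN, ?_⟩
  rintro q ⟨hq1, hq2⟩ j
  obtain ⟨ha, hb, hab⟩ := hproj q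
  have h3 := h1 q hq1 hq2
  have h4 : ∀ i i', dotHom (α i) q - dotHom (α i') q = dotHom (α i) (π' q) - dotHom (α i') (π' q) := by
    intro i i'
    have h5 : dotHom (α i) (π q) = dotHom (α i') (π q) := (hV _).1 ha i i'
    have h6 : ∀ i, dotHom (α i) q = dotHom (α i) (π q) + dotHom (α i) (π' q) := by
      intro i
      rw [← map_add, hab]
    rw [h6, h6, h5]
    ring
  obtain ⟨z, hz⟩ := h2 (N • π' q) (V'.smul_of_tower_mem N hb) (by
    intro i i'
    rw [map_nsmul, map_nsmul, ← smul_sub, ← h4, nsmul_eq_mul, Complex.exp_nat_mul]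
    exact h3 i i') j
  refine ⟨z, ?_⟩
  rw [eq_div_iff (by positivity), ← hz, Pi.smul_apply, nsmul_eq_mul]
  push_cast
  ring
end

section
/- Let S be a finite subset of ℂ and let R be a subring of the ring \bar{ℚ}[S] (the subring of ℂ generated by the algebraic numbers \bar{ℚ} together with S). Let b_1,…,b_q ∈ R and let q' be the dimension over \bar{ℚ} of the \bar{ℚ}-linear span of b_1,…,b_q in ℂ. Then there exist ring homomorphisms φ_1,…,φ_{q'} from R to \bar{ℚ} fixing k := R ∩ \bar{ℚ} pointwise, such that for all α_1,…,α_q ∈ k with α_1b_1+⋯+α_qb_q ≠ 0 there is some i ∈ {1,…,q'} with φ_i(α_1b_1+⋯+α_qb_q) ≠ 0. -/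
theorem aux_point {K A : Type*} [Field K] [IsAlgClosed K] [CommRing A] [IsDomain A] [Algebra K A]
    [Algebra.FiniteType K A] (f : A) (hf : f ≠ 0) : ∃ φ : A →ₐ[K] K, φ f ≠ 0 := by
  have : IsJacobsonRing A := isJacobsonRing_of_finiteType (A := K)
  have h1 : (⊥ : Ideal A).jacobson = ⊥ := by
    rw [← Ideal.radical_eq_jacobson]
    exact (Ideal.isPrime_bot (α := A)).radical
  have h2 : f ∉ (⊥ : Ideal A).jacobson := by
    rw [h1]; simpa using hf
  rw [Ideal.jacobson, Submodule.mem_sInf] at h2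
  push Not at h2
  obtain ⟨(m : Ideal A), ⟨-, hm⟩, hfm⟩ := h2
  have : m.IsMaximal := hm
  let : Field (A ⧸ m) := Ideal.Quotient.field m
  have : Algebra.FiniteType K (A ⧸ m) :=
    Algebra.FiniteType.of_surjective (Ideal.Quotient.mkₐ K m) (Ideal.Quotient.mkₐ_surjective K m)
  have : Module.Finite K (A ⧸ m) := finite_of_finite_type_of_isJacobsonRing K (A ⧸ m)
  have hb : Function.Bijective (algebraMap K (A ⧸ m)) :=
    IsAlgClosed.algebraMap_bijective_of_isIntegral
  let e : K ≃ₐ[K] (A ⧸ m) := AlgEquiv.ofBijective (Algebra.ofId K (A ⧸ m)) hb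
  refine ⟨(e.symm : (A ⧸ m) →ₐ[K] K).comp (Ideal.Quotient.mkₐ K m), ?_⟩
  intro h
  apply hfm
  have : e.symm (Ideal.Quotient.mk m f) = 0 := h
  rw [map_eq_zero_iff _ e.symm.injective] at this
  exact Ideal.Quotient.eq_zero_iff_mem.mp this

theorem aux_points {K A : Type*} [Field K] [IsAlgClosed K] [CommRing A] [IsDomain A] [Algebra K A]
    [Algebra.FiniteType K A] (n : ℕ) : ∀ (W : Submodule K A) [FiniteDimensional K W],
    Module.finrank K W ≤ n →
    ∃ φ : Fin n → (A →ₐ[K] K), ∀ w ∈ W, w ≠ 0 → ∃ i, φ i w ≠ 0 := by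
  induction n with
  | zero =>
    intro W _ h
    refine ⟨Fin.elim0, fun w hw hw0 => ?_⟩
    have : W = ⊥ := Submodule.finrank_eq_zero.mp (Nat.le_zero.mp h)
    subst this
    exact absurd (by simpa using hw) hw0
  | succ n ih =>
    intro W _ h
    by_cases hW : ∃ w ∈ W, w ≠ 0
    · obtain ⟨w, hw, hw0⟩ := hW
      obtain ⟨ψ, hψ⟩ := aux_point (K := K) w hw0
      have hlt : W ⊓ LinearMap.ker ψ.toLinearMap < W := by
        refine lt_of_le_of_ne inf_le_left fun heq => hψ ?_
        rw [← heq] at hw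
        exact hw.2
      have := Submodule.finrank_lt_finrank_of_lt hlt
      have : FiniteDimensional K ↥(W ⊓ LinearMap.ker ψ.toLinearMap) :=
        Submodule.finiteDimensional_of_le inf_le_left
      obtain ⟨φ, hφ⟩ := ih (W ⊓ LinearMap.ker ψ.toLinearMap) (by omega)
      refine ⟨Fin.cons ψ φ, fun v hv hv0 => ?_⟩
      by_cases hv1 : ψ v = 0
      · obtain ⟨i, hi⟩ := hφ v ⟨hv, hv1⟩ hv0
        exact ⟨i.succ, by simpa using hi⟩
      · exact ⟨0, by simpa using hv1⟩
    · push Not at hW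
      obtain ⟨ψ, -⟩ := aux_point (K := K) (1 : A) one_ne_zero
      exact ⟨fun _ => ψ, fun w hw hw0 => absurd (hW w hw) hw0⟩

set_option synthInstance.maxHeartbeats 400000 in
set_option maxHeartbeats 1000000 in
theorem aux_main
    (K : IntermediateField ℚ ℂ) [IsAlgClosed K]
    (S : Finset ℂ) (R : Subring ℂ)
    (hR : R ≤ Subring.closure ((K : Set ℂ) ∪ (S : Set ℂ)))
    (q : ℕ) (b : Fin q → R)
    (q' : ℕ)
    (hq' : q' = Set.finrank (K) (Set.range fun i => (b i : ℂ))) :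
    ∃ φ : Fin q' → (R →+* ℂ),
      -- each `φᵢ` takes values in `ℚ̄` :
      (∀ i : Fin q', ∀ x : R, φ i x ∈ K) ∧
      -- each `φᵢ` fixes `k = R ∩ ℚ̄` pointwise :
      (∀ i : Fin q', ∀ x : R, (x : ℂ) ∈ K → φ i x = x) ∧
      -- detection of nonzero `k`-linear combinations of the `bᵢ` :
      (∀ a : Fin q → R, (∀ i, (a i : ℂ) ∈ K) →
        (∑ i, a i * b i) ≠ 0 → ∃ i : Fin q', φ i (∑ i, a i * b i) ≠ 0) := by
  classical
  let A : Subalgebra K ℂ := Algebra.adjoin K (S : Set ℂ)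
  have : Algebra.FiniteType K A := (Subalgebra.fg_iff_finiteType A).mp ⟨S, rfl⟩
  have hRA : ∀ x : R, (x : ℂ) ∈ A := by
    intro x
    have h2 : Subring.closure ((K : Set ℂ) ∪ (S : Set ℂ)) ≤ A.toSubring := by
      rw [Subring.closure_le]
      rintro y (hy | hy)
      · exact A.algebraMap_mem (⟨y, hy⟩ : K)
      · exact Algebra.subset_adjoin hy
    exact h2 (hR x.2)
  let ι : R →+* A := R.subtype.codRestrict A hRA
  let W : Submodule K A := Submodule.span K (Set.range fun i => ι (b i))
  have : FiniteDimensional K W := FiniteDimensional.span_of_finite K (Set.finite_range _)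
  have hWr : Module.finrank K W ≤ q' := by
    rw [hq', Set.finrank]
    have h1 : Submodule.span K (Set.range fun i => (b i : ℂ)) = W.map A.val.toLinearMap := by
      rw [Submodule.map_span, ← Set.range_comp]
      rfl
    rw [h1]
    exact (LinearEquiv.finrank_eq
      (Submodule.equivMapOfInjective A.val.toLinearMap Subtype.val_injective W)).le
  obtain ⟨φ, hφ⟩ := aux_points q' W hWr
  refine ⟨fun i => (algebraMap K ℂ).comp ((φ i : A →+* K).comp ι), ?_, ?_, ?_⟩
  · intro i x
    exact (φ i (ι x)).2
  · intro i x hx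
    have h1 : ι x = algebraMap K A ⟨x, hx⟩ := Subtype.ext rfl
    change ((φ i (ι x) : K) : ℂ) = x
    rw [h1, AlgHom.commutes]
    rfl
  · intro a ha hne
    have hmem : ι (∑ i, a i * b i) ∈ W := by
      rw [map_sum]
      refine Submodule.sum_mem _ fun i _ => ?_
      have h1 : ι (a i * b i) = (⟨a i, ha i⟩ : K) • ι (b i) := Subtype.ext rfl
      rw [h1]
      exact Submodule.smul_mem _ _ (Submodule.subset_span ⟨i, rfl⟩)
    have h0 : ι (∑ i, a i * b i) ≠ 0 := by
      intro h
      apply hne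
      have := congrArg (Subtype.val : A → ℂ) h
      exact Subtype.ext this
    obtain ⟨i, hi⟩ := hφ _ hmem h0
    refine ⟨i, fun h => hi ?_⟩
    exact Subtype.ext h

/-- **Lemma (specialization lemma).** Let `R` be a subring of `ℚ̄[S]`, where `S` is a finite
subset of `ℂ`.  Suppose `b₁,…,b_q ∈ R` and let `q'` be the dimension over `ℚ̄` of the
`ℚ̄`-linear span of the `bᵢ`.  Then there are ring homomorphisms `φ₁,…,φ_{q'} : R → ℚ̄`
fixing `k := R ∩ ℚ̄` such that for all `α₁,…,α_q ∈ k` with `α₁b₁+⋯+α_qb_q ≠ 0` there is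
some `i` with `φᵢ(α₁b₁+⋯+α_qb_q) ≠ 0`.  (Here `ℚ̄ = algebraicClosure ℚ ℂ` is the field of
algebraic numbers in `ℂ`.) -/
theorem exists_specializations_detecting_nonzero_combinations
    (S : Finset ℂ) (R : Subring ℂ)
    (hR : R ≤ Subring.closure ((algebraicClosure ℚ ℂ : Set ℂ) ∪ (S : Set ℂ)))
    (q : ℕ) (b : Fin q → R)
    (q' : ℕ)
    (hq' : q' = Set.finrank (algebraicClosure ℚ ℂ) (Set.range fun i => (b i : ℂ))) :
    ∃ φ : Fin q' → (R →+* ℂ),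
      -- each `φᵢ` takes values in `ℚ̄` :
      (∀ i : Fin q', ∀ x : R, φ i x ∈ algebraicClosure ℚ ℂ) ∧
      -- each `φᵢ` fixes `k = R ∩ ℚ̄` pointwise :
      (∀ i : Fin q', ∀ x : R, (x : ℂ) ∈ algebraicClosure ℚ ℂ → φ i x = x) ∧
      -- detection of nonzero `k`-linear combinations of the `bᵢ` :
      (∀ a : Fin q → R, (∀ i, (a i : ℂ) ∈ algebraicClosure ℚ ℂ) →
        (∑ i, a i * b i) ≠ 0 → ∃ i : Fin q', φ i (∑ i, a i * b i) ≠ 0) := by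
  have : IsAlgClosed (algebraicClosure ℚ ℂ) := (algebraicClosure.isAlgClosure ℚ ℂ).isAlgClosed
  exact aux_main (algebraicClosure ℚ ℂ) S R hR q b q' hq'
end

section
/- Let S be a finite subset of ℂ and let R be a subring of \bar{ℚ}[S] (the subring of ℂ generated by the algebraic numbers \bar{ℚ} together with S). If b_1,…,b_q ∈ R are linearly independent over \bar{ℚ}, then there exist ring homomorphisms φ_1,…,φ_q from R to \bar{ℚ}, each fixing R ∩ \bar{ℚ} pointwise, such that the q×q determinant det(φ_i(b_j))_{1≤i,j≤q} is nonzero. -/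
theorem aux_exists_hom {K A : Type*} [Field K] [IsAlgClosed K] [CommRing A] [IsDomain A]
    [Algebra K A] [Algebra.FiniteType K A] (x : A) (hx : x ≠ 0) :
    ∃ f : A →ₐ[K] K, f x ≠ 0 := by
  have : IsJacobsonRing A := isJacobsonRing_of_finiteType (A := K)
  have h1 : (⊥ : Ideal A).jacobson = ⊥ :=
    IsJacobsonRing.out inferInstance (Ideal.isPrime_bot).isRadical
  have h2 : x ∉ (⊥ : Ideal A).jacobson := by
    rw [h1]; simpa using hx
  rw [Ideal.jacobson, Ideal.mem_sInf] at h2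
  push Not at h2
  obtain ⟨m, ⟨-, hm⟩, hxm⟩ := h2
  let : Field (A ⧸ m) := Ideal.Quotient.field m
  have : Module.Finite K (A ⧸ m) := finite_of_finite_type_of_isJacobsonRing K (A ⧸ m)
  have : Algebra.IsAlgebraic K (A ⧸ m) := Algebra.IsAlgebraic.of_finite K (A ⧸ m)
  let g : (A ⧸ m) →ₐ[K] K := IsAlgClosed.lift
  refine ⟨g.comp (Ideal.Quotient.mkₐ K m), ?_⟩
  intro h
  apply hxm
  rw [← Ideal.Quotient.eq_zero_iff_mem]
  exact (map_eq_zero g.toRingHom).1 h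

theorem aux_exists_det {K A : Type*} [Field K] [IsAlgClosed K] [CommRing A] [IsDomain A]
    [Algebra K A] [Algebra.FiniteType K A] (q : ℕ) (b : Fin q → A)
    (hb : LinearIndependent K b) :
    ∃ f : Fin q → (A →ₐ[K] K), Matrix.det (Matrix.of fun i j : Fin q => f i (b j)) ≠ 0 := by
  let s : Set (Fin q → K) := Set.range (fun f : A →ₐ[K] K => fun j => f (b j))
  have hs : Submodule.span K s = ⊤ := by
    by_contra hne
    obtain ⟨l, hl0, hl⟩ := Submodule.exists_le_ker_of_lt_top _ (lt_top_iff_ne_top.2 hne)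
    have key : ∑ j, l (Pi.single j 1) • b j = 0 := by
      by_contra hx
      obtain ⟨f, hf⟩ := aux_exists_hom (K := K) _ hx
      apply hf
      have h1 : l (fun j => f (b j)) = 0 := hl (Submodule.subset_span ⟨f, rfl⟩)
      rw [LinearMap.pi_apply_eq_sum_univ l] at h1
      rw [map_sum, ← h1]
      refine Finset.sum_congr rfl fun j _ => ?_
      rw [map_smul, smul_eq_mul, smul_eq_mul, mul_comm]
      congr 2
      ext k
      simp [Pi.single_apply, eq_comm]
    have h0 := Fintype.linearIndependent_iff.1 hb _ key
    apply hl0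
    apply LinearMap.pi_ext'
    intro j
    ext
    simpa using h0 j
  obtain ⟨v, hv, -, hli⟩ := Submodule.exists_fun_fin_finrank_span_eq K s
  have hq : Module.finrank K (Submodule.span K s) = q := by
    rw [hs]; simp
  choose f hf using hv
  refine ⟨fun i => f (Fin.cast hq.symm i), ?_⟩
  have hli' := hli.comp (Fin.cast hq.symm) (Fin.cast_injective _)
  have : LinearIndependent K
      (Matrix.of fun i j : Fin q => f (Fin.cast hq.symm i) (b j)).row := by
    have e : (Matrix.of fun i j : Fin q => f (Fin.cast hq.symm i) (b j)).row
        = v ∘ Fin.cast hq.symm := by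
      funext i
      exact hf (Fin.cast hq.symm i)
    rw [e]
    exact hli'
  rw [Matrix.linearIndependent_rows_iff_isUnit, Matrix.isUnit_iff_isUnit_det] at this
  exact this.ne_zero

/-- **Specialization lemma, determinant form.** Let `R` be a subring of `ℚ̄[S]` with `S ⊆ ℂ`
finite.  If `b₁,…,b_q ∈ R` are linearly independent over `ℚ̄`, then there are ring
homomorphisms `φ₁,…,φ_q : R → ℚ̄`, each fixing `R ∩ ℚ̄` pointwise, such that
`det(φᵢ(bⱼ)) ≠ 0`.  (Here `ℚ̄ = algebraicClosure ℚ ℂ` is the field of algebraic numbers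
in `ℂ`.) -/
theorem exists_specializations_with_nonzero_determinant
    (S : Finset ℂ) (R : Subring ℂ)
    (hR : R ≤ Subring.closure ((algebraicClosure ℚ ℂ : Set ℂ) ∪ (S : Set ℂ)))
    (q : ℕ) (b : Fin q → R)
    (hb : LinearIndependent (algebraicClosure ℚ ℂ) (fun i => (b i : ℂ))) :
    ∃ φ : Fin q → (R →+* ℂ),
      -- each `φᵢ` takes values in `ℚ̄` :
      (∀ i : Fin q, ∀ x : R, φ i x ∈ algebraicClosure ℚ ℂ) ∧
      -- each `φᵢ` fixes `R ∩ ℚ̄` pointwise :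
      (∀ i : Fin q, ∀ x : R, (x : ℂ) ∈ algebraicClosure ℚ ℂ → φ i x = x) ∧
      Matrix.det (Matrix.of fun i j : Fin q => φ i (b j)) ≠ 0 := by
  have : IsAlgClosed (algebraicClosure ℚ ℂ) :=
    (algebraicClosure.isAlgClosure ℚ ℂ).isAlgClosed
  let A : Subalgebra (algebraicClosure ℚ ℂ) ℂ := Algebra.adjoin (algebraicClosure ℚ ℂ) (S : Set ℂ)
  have : Algebra.FiniteType (algebraicClosure ℚ ℂ) A :=
    (Subalgebra.fg_iff_finiteType A).1 ⟨S, rfl⟩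
  have hRA : R ≤ A.toSubring := by
    have : A.toSubring = _ := Algebra.adjoin_eq_ring_closure (R := algebraicClosure ℚ ℂ) (S : Set ℂ)
    have e : Set.range (algebraMap (algebraicClosure ℚ ℂ) ℂ) = (algebraicClosure ℚ ℂ : Set ℂ) :=
      Subtype.range_coe
    rw [this, e]
    exact hR
  let ι : R →+* A := Subring.inclusion hRA
  have hb' : LinearIndependent (algebraicClosure ℚ ℂ) (fun i => ι (b i)) :=
    LinearIndependent.of_comp A.val.toLinearMap hb
  obtain ⟨f, hf⟩ := aux_exists_det q _ hb'
  refine ⟨fun i => (algebraMap (algebraicClosure ℚ ℂ) ℂ).comp ((f i).toRingHom.comp ι),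
    fun i x => (f i (ι x)).2, fun i x hx => ?_, ?_⟩
  · have : ι x = algebraMap (algebraicClosure ℚ ℂ) A ⟨x, hx⟩ := Subtype.ext rfl
    change ((f i (ι x) : algebraicClosure ℚ ℂ) : ℂ) = x
    rw [this, AlgHom.commutes]
    rfl
  · intro h
    apply hf
    apply (algebraMap (algebraicClosure ℚ ℂ) ℂ).injective
    rw [RingHom.map_det, map_zero, ← h]
    rfl
end

section
/- Let L be a field of characteristic zero containing all roots of unity, and suppose L is a finitely generated field extension of ℚ(𝕌), the subfield of L generated over ℚ by all roots of unity. Then the quotient group L^×/𝕌 of the multiplicative group of L by its subgroup of roots of unity (equivalently, by the torsion subgroup of L^×) is a free abelian group. -/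
universe u

section

/-- Pontryagin property modulo torsion. -/
def PontP (M : Type*) [AddCommGroup M] : Prop :=
  ∀ N : Submodule ℤ M, N.FG → ∃ N' : Submodule ℤ M, N'.FG ∧
    ∀ (x : M) (n : ℤ), n ≠ 0 → n • x ∈ N → ∃ y ∈ N', ∃ m : ℤ, m ≠ 0 ∧ m • (x - y) = 0

theorem pontP_of_finite (M : Type*) [AddCommGroup M] [Module.Finite ℤ M] : PontP M :=
  fun _ _ => ⟨⊤, Module.Finite.fg_top, fun x _ _ _ => ⟨x, trivial, 1, one_ne_zero, by simp⟩⟩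

theorem fg_of_le_fg {M : Type*} [AddCommGroup M] {N N' : Submodule ℤ M} (h : N ≤ N')
    (hN' : N'.FG) : N.FG := by
  have : Module.Finite ℤ N' := Module.Finite.iff_fg.mpr hN'
  have : IsNoetherian ℤ N' := inferInstance
  have := (isNoetherian_submodule.mp this) N h
  exact this

theorem fg_comap {M A : Type*} [AddCommGroup M] [AddCommGroup A] (i : A →ₗ[ℤ] M)
    (hi : Function.Injective i) {N : Submodule ℤ M} (hN : N.FG) : (N.comap i).FG := by
  refine Submodule.fg_of_fg_map_injective i hi (fg_of_le_fg (Submodule.map_comap_le _ _) hN)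

theorem exists_fg_lift {M C : Type*} [AddCommGroup M] [AddCommGroup C] (f : M →ₗ[ℤ] C)
    {N : Submodule ℤ C} (hN : N.FG) (h : N ≤ LinearMap.range f) :
    ∃ N1 : Submodule ℤ M, N1.FG ∧ N1.map f = N := by
  classical
  obtain ⟨s, hs⟩ := hN
  have : ∀ x ∈ s, ∃ y, f y = x := fun x hx => h (hs ▸ Submodule.subset_span hx)
  choose! g hg using this
  refine ⟨Submodule.span ℤ (g '' (s : Set C)), Submodule.fg_span ((Finset.finite_toSet s).image g), ?_⟩
  rw [Submodule.map_span, ← hs, Set.image_image]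
  congr 1
  ext x
  constructor
  · rintro ⟨y, hy, rfl⟩
    simpa [hg y hy] using hy
  · intro hx
    exact ⟨x, hx, hg x hx⟩

theorem pontP_ext {A M C : Type*} [AddCommGroup A] [AddCommGroup M] [AddCommGroup C]
    (i : A →ₗ[ℤ] M) (f : M →ₗ[ℤ] C) (hi : Function.Injective i)
    (hker : LinearMap.ker f ≤ LinearMap.range i)
    (hC0 : ∀ (n : ℤ) (c : C), n ≠ 0 → n • c = 0 → c = 0)
    (hA : PontP A) (hC : PontP C) : PontP M := by
  intro N hN
  obtain ⟨C', hC', h1⟩ := hC (N.map f) (hN.map f)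
  obtain ⟨N1, hN1, hN1'⟩ := exists_fg_lift f (fg_of_le_fg (inf_le_left : C' ⊓ LinearMap.range f ≤ C') hC')
    inf_le_right
  obtain ⟨A', hA', h2⟩ := hA ((N1 ⊔ N).comap i) (fg_comap i hi (hN1.sup hN))
  refine ⟨N1 ⊔ A'.map i, hN1.sup (hA'.map i), fun x n hn hx => ?_⟩
  have hfx : f x ∈ C' ⊓ LinearMap.range f := by
    refine ⟨?_, ⟨x, rfl⟩⟩
    obtain ⟨c, hc, m, hm, hmc⟩ := h1 (f x) n hn ⟨n • x, hx, by simp⟩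
    have := hC0 _ _ hm hmc
    rw [sub_eq_zero] at this
    rwa [this]
  rw [← hN1'] at hfx
  obtain ⟨y, hy, hyx⟩ := hfx
  obtain ⟨a, ha⟩ := hker (show x - y ∈ LinearMap.ker f by simp [hyx])
  obtain ⟨b, hb, m, hm, hmb⟩ := h2 a n hn (by
    rw [Submodule.mem_comap, map_smul, ha, smul_sub]
    exact sub_mem (Submodule.mem_sup_right hx) (Submodule.mem_sup_left (Submodule.smul_mem _ _ hy)))
  refine ⟨y + i b, add_mem (Submodule.mem_sup_left hy)
    (Submodule.mem_sup_right (Submodule.mem_map_of_mem hb)), m, hm, ?_⟩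
  have : x - (y + i b) = i (a - b) := by rw [map_sub, ha]; abel
  rw [this, ← map_smul, hmb, map_zero]

theorem pontP_prod {A B : Type*} [AddCommGroup A] [AddCommGroup B]
    (hB0 : ∀ (n : ℤ) (c : B), n ≠ 0 → n • c = 0 → c = 0)
    (hA : PontP A) (hB : PontP B) : PontP (A × B) :=
  pontP_ext (LinearMap.inl ℤ A B) (LinearMap.snd ℤ A B) LinearMap.inl_injective
    (by rw [LinearMap.range_inl]) hB0 hA hB

theorem pontP_finsupp (I : Type*) : PontP (I →₀ ℤ) := by
  classical
  intro N hN
  obtain ⟨s, rfl⟩ := hN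
  let S : Finset I := s.biUnion Finsupp.support
  have key : ∀ T : Finset I, (Finsupp.supported ℤ ℤ (T : Set I)).FG := by
    intro T
    rw [Finsupp.supported_eq_span_single]
    exact Submodule.fg_span ((Finset.finite_toSet T).image _)
  refine ⟨Finsupp.supported ℤ ℤ (S : Set I), key S, fun x n hn hx => ⟨x, ?_, 1, one_ne_zero, by simp⟩⟩
  have : Submodule.span ℤ (s : Set (I →₀ ℤ)) ≤ Finsupp.supported ℤ ℤ (S : Set I) := by
    rw [Submodule.span_le]
    intro y hy
    rw [SetLike.mem_coe, Finsupp.mem_supported]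
    exact_mod_cast Finset.subset_biUnion_of_mem Finsupp.support hy
  have h := this hx
  rw [Finsupp.mem_supported] at h ⊢
  rwa [Finsupp.support_smul_eq hn] at h

theorem pontP_quot {M Q : Type*} [AddCommGroup M] [AddCommGroup Q] (q : M →ₗ[ℤ] Q)
    (hq : Function.Surjective q) (hker : ∀ x, q x = 0 → ∃ m : ℤ, m ≠ 0 ∧ m • x = 0)
    (hM : PontP M) : PontP Q := by
  intro N hN
  obtain ⟨N1, hN1, rfl⟩ := exists_fg_lift q hN (by rw [LinearMap.range_eq_top.mpr hq]; exact le_top)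
  obtain ⟨N', hN', h⟩ := hM N1 hN1
  refine ⟨N'.map q, hN'.map q, fun x n hn hx => ?_⟩
  obtain ⟨x, rfl⟩ := hq x
  obtain ⟨z, hz, hzx⟩ := hx
  obtain ⟨m, hm, hmz⟩ := hker (n • x - z) (by simp [hzx])
  obtain ⟨y, hy, k, hk, hky⟩ := h x (m * n) (mul_ne_zero hm hn) (by
    rw [smul_sub, sub_eq_zero] at hmz
    rw [mul_smul, hmz]
    exact Submodule.smul_mem _ _ hz)
  refine ⟨q y, Submodule.mem_map_of_mem hy, k, hk, ?_⟩
  rw [← map_sub, ← map_smul, hky, map_zero]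

/-- saturation -/
def satur {M : Type*} [AddCommGroup M] (N : Submodule ℤ M) : Submodule ℤ M where
  carrier := {x | ∃ n : ℤ, n ≠ 0 ∧ n • x ∈ N}
  add_mem' := by
    rintro x y ⟨n, hn, hx⟩ ⟨m, hm, hy⟩
    refine ⟨n * m, mul_ne_zero hn hm, ?_⟩
    rw [smul_add]
    refine add_mem ?_ ?_
    · rw [mul_comm, mul_smul]; exact N.smul_mem _ hx
    · rw [mul_smul]; exact N.smul_mem _ hy
  zero_mem' := ⟨1, one_ne_zero, by simp⟩
  smul_mem' := by
    rintro c x ⟨n, hn, hx⟩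
    exact ⟨n, hn, by rw [smul_comm]; exact N.smul_mem _ hx⟩

theorem satur_step {R M : Type*} [CommRing R] [IsDomain R] [IsPrincipalIdealRing R]
    [AddCommGroup M] [Module R M] (N N' : Submodule R M) (hle : N ≤ N')
    (hN' : N'.FG) (hs : ∀ (n : R) (x : M), n ≠ 0 → n • x ∈ N → x ∈ N)
    (B : Set M) (hB : LinearIndepOn R id B) (hBs : Submodule.span R B = N) :
    ∃ B' : Set M, B ⊆ B' ∧ LinearIndepOn R id B' ∧ Submodule.span R B' = N' := by
  -- quotient image
  let Q := N'.map N.mkQ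
  have hQ : Q.FG := hN'.map _
  have : Module.Finite R Q := Module.Finite.iff_fg.mpr hQ
  have : Module.IsTorsionFree R Q := by
    refine Module.IsTorsionFree.of_smul_eq_zero ?_
    rintro r ⟨_, x, hx, rfl⟩ h
    by_cases hr : r = 0
    · exact Or.inl hr
    refine Or.inr (Subtype.ext ?_)
    have h' : N.mkQ (r • x) = 0 := by
      rw [map_smul]; exact congrArg Subtype.val h
    exact (Submodule.Quotient.mk_eq_zero N).mpr
      (hs r x hr ((Submodule.Quotient.mk_eq_zero N).mp h'))
  obtain ⟨n, b⟩ := Module.basisOfFiniteTypeTorsionFree' (R := R) (M := Q)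
  have hg : ∀ j, ∃ y ∈ N', N.mkQ y = (b j : M ⧸ N) := fun j => (b j).2
  choose g hgN hg using hg
  have hli : LinearIndependent R (Submodule.Quotient.mk (p := N) ∘ g) := by
    have h := b.linearIndependent.map' Q.subtype Q.ker_subtype
    have h' : (Submodule.Quotient.mk (p := N) ∘ g) = Q.subtype ∘ b := by
      funext j
      exact hg j
    rw [h']
    exact h
  have hspanB : ∀ x ∈ B, x ∈ N := fun x hx => hBs ▸ Submodule.subset_span hx
  let f : B → N := fun x => ⟨x, hspanB x x.2⟩
  have hf : LinearIndependent R f := by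
    apply LinearIndependent.of_comp N.subtype
    exact hB
  have := LinearIndependent.sumElim_of_quotient hf g hli
  refine ⟨B ∪ Set.range g, Set.subset_union_left, ?_, ?_⟩
  · have h2 := this.linearIndepOn_id
    rw [Set.Sum.elim_range] at h2
    have h3 : (Set.range fun x => ((f x : N) : M)) = B := by
      ext x; simp [f]
    rwa [h3] at h2
  · rw [Submodule.span_union, hBs]
    apply le_antisymm
    · refine sup_le hle ?_
      rw [Submodule.span_le]
      rintro _ ⟨j, rfl⟩
      exact hgN j
    · intro x hx
      have hxQ : N.mkQ x ∈ Q := Submodule.mem_map_of_mem hx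
      have h3 : (⟨N.mkQ x, hxQ⟩ : Q) ∈ Submodule.span R (Set.range b) := by
        rw [b.span_eq]; trivial
      have h4 := Submodule.mem_map_of_mem (f := Q.subtype) h3
      rw [Submodule.map_span, ← Set.range_comp] at h4
      have h5 : (Q.subtype ∘ b) = N.mkQ ∘ g := by
        funext j; exact (hg j).symm
      rw [h5, Set.range_comp, ← Submodule.map_span] at h4
      obtain ⟨y, hy, hyx⟩ := h4
      have h6 : x - y ∈ N := by
        rw [← Submodule.Quotient.eq]
        exact hyx.symm
      have : x = (x - y) + y := by abel
      rw [this]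
      exact add_mem (Submodule.mem_sup_left h6) (Submodule.mem_sup_right hy)

theorem free_of_pontP (M : Type*) [AddCommGroup M] [Countable M]
    (h0 : ∀ (n : ℤ) (c : M), n ≠ 0 → n • c = 0 → c = 0) (hM : PontP M) : Module.Free ℤ M := by
  obtain ⟨e, he⟩ := exists_surjective_nat M
  let A : ℕ → Submodule ℤ M := fun n => satur (Submodule.span ℤ (e '' {k | k < n}))
  have hmono : ∀ n, A n ≤ A (n+1) := by
    rintro n x ⟨m, hm, hx⟩
    refine ⟨m, hm, Submodule.span_mono (Set.image_mono ?_) hx⟩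
    intro k hk
    exact Nat.lt_succ_of_lt hk
  have hsat : ∀ n (m : ℤ) (x : M), m ≠ 0 → m • x ∈ A n → x ∈ A n := by
    rintro n m x hm ⟨k, hk, hx⟩
    exact ⟨k * m, mul_ne_zero hk hm, by rwa [mul_smul]⟩
  have hfg : ∀ n, (A n).FG := by
    intro n
    obtain ⟨N', hN', h⟩ := hM (Submodule.span ℤ (e '' {k | k < n}))
      (Submodule.fg_span ((Set.finite_lt_nat n).image e))
    refine fg_of_le_fg ?_ hN'
    rintro x ⟨m, hm, hx⟩
    obtain ⟨y, hy, k, hk, hky⟩ := h x m hm hx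
    have := h0 _ _ hk hky
    rw [sub_eq_zero] at this
    rwa [this]
  have hA0 : A 0 = ⊥ := by
    rw [eq_bot_iff]
    rintro x ⟨m, hm, hx⟩
    simp at hx
    simpa using h0 m x hm (by simpa using hx)
  let T : ℕ → Type _ := fun n => {B : Set M // LinearIndepOn ℤ id B ∧ Submodule.span ℤ B = A n}
  have step : ∀ n (B : T n), ∃ B' : T (n+1), B.1 ⊆ B'.1 := by
    rintro n ⟨B, hB, hBs⟩
    obtain ⟨B', h1, h2, h3⟩ := satur_step (A n) (A (n+1)) (hmono n) (hfg (n+1)) (hsat n) B hB hBs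
    exact ⟨⟨B', h2, h3⟩, h1⟩
  choose g hg using step
  let B0 : T 0 := ⟨∅, linearIndepOn_empty _ _, by rw [hA0]; simp⟩
  let B : ∀ n, T n := fun n => Nat.rec B0 (fun n b => g n b) n
  have hBmono : Monotone (fun n => (B n).1) := monotone_nat_of_le_succ fun n => hg n (B n)
  have hli : LinearIndepOn ℤ id (⋃ n, (B n).1) :=
    linearIndepOn_iUnion_of_directed (hBmono.directed_le) fun n => (B n).2.1
  have hsp : ⊤ ≤ Submodule.span ℤ (⋃ n, (B n).1) := by
    intro x _
    obtain ⟨k, rfl⟩ := he x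
    have : e k ∈ A (k+1) := ⟨1, one_ne_zero, by
      rw [one_smul]; exact Submodule.subset_span ⟨k, Nat.lt_succ_self k, rfl⟩⟩
    rw [← (B (k+1)).2.2] at this
    exact Submodule.span_mono (Set.subset_iUnion (fun n => (B n).1) (k+1)) this
  refine Module.Free.of_basis (Module.Basis.mk (v := ((↑) : (⋃ n, (B n).1) → M)) hli ?_)
  rw [Subtype.range_coe]
  exact hsp

end

section

open IsDedekindDomain

theorem exists_divisor_map (D K : Type*) [CommRing D] [IsDedekindDomain D] [Field K] [Algebra D K]
    [IsFractionRing D K] :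
    ∃ f : Additive Kˣ →ₗ[ℤ] (HeightOneSpectrum D →₀ ℤ),
      ∀ x : Additive Kˣ, f x = 0 → ((x.toMul : Kˣ) : K) ∈ (algebraMap D K).range := by
  classical
  have hfin : ∀ x : Kˣ, (Function.support fun v : HeightOneSpectrum D =>
      WithZero.log (v.valuation K (x : K))).Finite := by
    intro x
    refine ((HeightOneSpectrum.Support.finite D (x : K)).union
      (HeightOneSpectrum.Support.finite D ((x : K)⁻¹))).subset ?_
    intro v hv
    by_contra hcon
    rw [Set.mem_union, not_or] at hcon
    obtain ⟨h1, h2⟩ := hcon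
    have h1' : v.valuation K (x : K) ≤ 1 := not_lt.mp h1
    have h2' : v.valuation K ((x : K)⁻¹) ≤ 1 := not_lt.mp h2
    have h0 : v.valuation K (x : K) ≠ 0 := (Valuation.ne_zero_iff _).mpr x.ne_zero
    rw [map_inv₀] at h2'
    have h3 : v.valuation K (x : K) = 1 :=
      le_antisymm h1' ((inv_le_one₀ (zero_lt_iff.mpr h0)).mp h2')
    exact hv (by simp [h3])
  let f : Additive Kˣ →+ (HeightOneSpectrum D →₀ ℤ) :=
    { toFun := fun x => Finsupp.ofSupportFinite _ (hfin x.toMul)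
      map_zero' := by ext v; simp [Finsupp.ofSupportFinite_coe]
      map_add' := by
        intro x y
        ext v
        have hx : v.valuation K (x.toMul : K) ≠ 0 := (Valuation.ne_zero_iff _).mpr x.toMul.ne_zero
        have hy : v.valuation K (y.toMul : K) ≠ 0 := (Valuation.ne_zero_iff _).mpr y.toMul.ne_zero
        simp [Finsupp.ofSupportFinite_coe] }
  refine ⟨f.toIntLinearMap, fun x hx => ?_⟩
  apply HeightOneSpectrum.mem_integers_of_valuation_le_one
  intro v
  have h0 : v.valuation K (x.toMul : K) ≠ 0 := (Valuation.ne_zero_iff _).mpr x.toMul.ne_zero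
  have h1 : WithZero.log (v.valuation K (x.toMul : K)) = 0 := DFunLike.congr_fun hx v
  have : v.valuation K (x.toMul : K) = 1 := by
    rw [← WithZero.exp_log h0, h1]; rfl
  exact this.le

theorem finsupp_tf (I : Type*) (n : ℤ) (c : I →₀ ℤ) (hn : n ≠ 0) (h : n • c = 0) : c = 0 :=
  (smul_eq_zero.mp h).resolve_left hn

theorem pontP_numberField (K : Type*) [Field K] [NumberField K] : PontP (Additive Kˣ) := by
  obtain ⟨f, hf⟩ := exists_divisor_map (NumberField.RingOfIntegers K) K
  let i : Additive (NumberField.RingOfIntegers K)ˣ →ₗ[ℤ] Additive Kˣ :=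
    (MonoidHom.toAdditive (Units.map (algebraMap (NumberField.RingOfIntegers K) K).toMonoidHom)).toIntLinearMap
  refine pontP_ext i f ?_ ?_ (finsupp_tf _) (pontP_of_finite _) (pontP_finsupp _)
  · exact Units.map_injective (f := (algebraMap (NumberField.RingOfIntegers K) K).toMonoidHom)
      (FaithfulSMul.algebraMap_injective (NumberField.RingOfIntegers K) K)
  · intro x hx
    obtain ⟨a, ha⟩ := hf x hx
    obtain ⟨b, hb⟩ := hf (-x) (by rw [map_neg, LinearMap.mem_ker.mp hx, neg_zero])
    have hab : a * b = 1 := by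
      apply FaithfulSMul.algebraMap_injective (NumberField.RingOfIntegers K) K
      rw [map_mul, ha, hb]
      simp
    refine ⟨Additive.ofMul ⟨a, b, hab, by rw [mul_comm, hab]⟩, ?_⟩
    apply Additive.toMul.injective
    ext
    exact ha

theorem finite_torsion_numberField (K : Type*) [Field K] [NumberField K] :
    ∃ w : ℕ, 0 < w ∧ ∀ (d : ℕ) (z : K), 0 < d → IsPrimitiveRoot z d → d ∣ w := by
  refine ⟨NumberField.Units.torsionOrder K, NumberField.Units.torsionOrder_pos K, ?_⟩
  intro d z hd hz
  have : NeZero d := ⟨hd.ne'⟩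
  have hint : IsIntegral ℤ z := hz.isIntegral hd
  let a : NumberField.RingOfIntegers K := ⟨z, hint⟩
  have ha : IsPrimitiveRoot a d := IsPrimitiveRoot.of_map_of_injective
    (f := algebraMap (NumberField.RingOfIntegers K) K) hz
    (FaithfulSMul.algebraMap_injective (NumberField.RingOfIntegers K) K)
  have hu : IsPrimitiveRoot (ha.isUnit hd.ne').unit d := ha.isUnit_unit hd.ne'
  have hmem : (ha.isUnit hd.ne').unit ∈ NumberField.Units.torsion K := by
    rw [NumberField.Units.torsion, CommGroup.mem_torsion, isOfFinOrder_iff_pow_eq_one]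
    exact ⟨d, hd, hu.pow_eq_one⟩
  have h1 := orderOf_dvd_natCard (⟨_, hmem⟩ : NumberField.Units.torsion K)
  rw [← Subgroup.orderOf_coe, ← hu.eq_orderOf] at h1
  rwa [NumberField.Units.torsionOrder]

end

section

open IsDedekindDomain
open scoped IntermediateField

theorem exists_val_of_not_algebraic (k K : Type*) [Field k] [Field K] [Algebra k K] (x : K)
    (hx : ¬ IsAlgebraic k x) :
    ∃ V : ValuationSubring K, (∀ c : k, algebraMap k K c ∈ V) ∧ x ∉ V := by
  have hx' : x ∉ (integralClosure k K).toSubring := fun h => hx (IsIntegral.isAlgebraic h)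
  obtain ⟨V, h1, h2⟩ := Subring.exists_le_valuationSubring_of_isIntegrallyClosedIn hx'
  exact ⟨V, fun c => h1 (Subalgebra.algebraMap_mem _ c), h2⟩

theorem mem_val_of_integral {k K : Type*} [Field k] [Field K] [Algebra k K] (t x : K)
    (hx : x ∈ integralClosure (Algebra.adjoin k {t}) K) (V : ValuationSubring K)
    (hk : ∀ c : k, algebraMap k K c ∈ V) (ht : t ∈ V) : x ∈ V := by
  have hA : ∀ a : Algebra.adjoin k {t}, (a : K) ∈ V := by
    rintro ⟨a, ha⟩
    induction ha using Algebra.adjoin_induction with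
    | mem x hx => obtain rfl := Set.mem_singleton_iff.mp hx; exact ht
    | algebraMap r => exact hk r
    | add x y _ _ h1 h2 => exact add_mem h1 h2
    | mul x y _ _ h1 h2 => exact mul_mem h1 h2
  let f : Algebra.adjoin k {t} →+* V := (algebraMap (Algebra.adjoin k {t}) K).codRestrict V.toSubring hA
  obtain ⟨p, hp, hpx⟩ := hx
  have : IsIntegral V x := by
    refine ⟨p.map f, hp.map f, ?_⟩
    rw [Polynomial.eval₂_map]
    exact hpx
  obtain ⟨y, hy⟩ := IsIntegrallyClosed.isIntegral_iff.mp this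
  rw [← hy]
  exact y.2

theorem algebraic_of_integral_both {k K : Type*} [Field k] [Field K] [Algebra k K] (t x : K)
    (hx : x ∈ integralClosure (Algebra.adjoin k {t}) K)
    (hx' : x ∈ integralClosure (Algebra.adjoin k {t⁻¹}) K) : IsAlgebraic k x := by
  by_contra h
  obtain ⟨V, h1, h2⟩ := exists_val_of_not_algebraic k K x h
  rcases V.mem_or_inv_mem t with ht | ht
  · exact h2 (mem_val_of_integral t x hx V h1 ht)
  · exact h2 (mem_val_of_integral _ x hx' V h1 ht)

section
open scoped IntermediateField.algebraAdjoinAdjoin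

theorem isPrincipal_adjoin {k K : Type*} [Field k] [Field K] [Algebra k K] (t : K)
    (ht : Transcendental k t) : IsPrincipalIdealRing (Algebra.adjoin k {t}) :=
  IsPrincipalIdealRing.of_surjective (Polynomial.algEquivOfTranscendental k t ht)
    (Polynomial.algEquivOfTranscendental k t ht).surjective

theorem dedekind_adjoin {k K : Type*} [Field k] [CharZero k] [Field K] [Algebra k K] (t : K)
    (ht : Transcendental k t) [FiniteDimensional k⟮t⟯ K] :
    IsDedekindDomain (integralClosure (Algebra.adjoin k {t}) K) ∧
    IsFractionRing (integralClosure (Algebra.adjoin k {t}) K) K ∧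
    Module.Finite (Algebra.adjoin k {t}) (integralClosure (Algebra.adjoin k {t}) K) := by
  have := isPrincipal_adjoin t ht
  have : CharZero k⟮t⟯ := charZero_of_injective_algebraMap (algebraMap k k⟮t⟯).injective
  refine ⟨integralClosure.isDedekindDomain _ k⟮t⟯ K,
    integralClosure.isFractionRing_of_finite_extension k⟮t⟯ K, ?_⟩
  exact IsIntegralClosure.finite (Algebra.adjoin k {t}) k⟮t⟯ K _

theorem adjoin_decomp {k K : Type*} [Field k] [Field K] [Algebra k K] (t : K)
    (a : Algebra.adjoin k {t}) : ∃ (c : k) (b : Algebra.adjoin k {t}),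
      a = algebraMap k _ c + ⟨t, Algebra.self_mem_adjoin_singleton k t⟩ * b := by
  obtain ⟨a, ha⟩ := a
  rw [Algebra.adjoin_singleton_eq_range_aeval] at ha
  obtain ⟨p, rfl⟩ := ha
  refine ⟨p.coeff 0, ⟨Polynomial.aeval t p.divX, Polynomial.aeval_mem_adjoin_singleton k t⟩, ?_⟩
  apply Subtype.ext
  change Polynomial.aeval t p = algebraMap k K (p.coeff 0) + t * Polynomial.aeval t p.divX
  conv_lhs => rw [← Polynomial.divX_mul_X_add p]
  simp
  ring

theorem finite_quot_aux {k A D : Type*} [CommRing k] [CommRing A] [CommRing D] [Algebra k A]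
    [Algebra A D] [Algebra k D] [IsScalarTower k A D] [Module.Finite A D] (τ : A)
    (hdec : ∀ a : A, ∃ (c : k) (b : A), a = algebraMap k A c + τ * b)
    (P : Ideal D) (hTP : algebraMap A D τ ∈ P) : Module.Finite k (D ⧸ P) := by
  classical
  obtain ⟨G, hG⟩ := (inferInstance : Module.Finite A D).fg_top
  have hspan : ∀ d : D, Ideal.Quotient.mk P d ∈
      Submodule.span k ((Ideal.Quotient.mk P) '' (G : Set D)) := by
    intro d
    have hd : d ∈ Submodule.span A (G : Set D) := by rw [hG]; trivial
    induction hd using Submodule.span_induction with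
    | mem x hx => exact Submodule.subset_span ⟨x, hx, rfl⟩
    | zero => rw [map_zero]; exact zero_mem _
    | add x y _ _ h1 h2 => rw [map_add]; exact add_mem h1 h2
    | smul a x _ h1 =>
      obtain ⟨c, b, hab⟩ := hdec a
      have h8 : a • x = c • x + algebraMap A D τ * (b • x) := by
        rw [hab, add_smul, algebraMap_smul, mul_smul, Algebra.smul_def τ]
      rw [h8, map_add, map_mul, Ideal.Quotient.eq_zero_iff_mem.mpr hTP, zero_mul, add_zero]
      exact Submodule.smul_mem _ c h1
  refine ⟨⟨G.image (Ideal.Quotient.mk P), ?_⟩⟩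
  rw [eq_top_iff, Finset.coe_image]
  rintro x -
  obtain ⟨d, rfl⟩ := Ideal.Quotient.mk_surjective x
  exact hspan d

theorem finite_algebraicClosure {k K : Type*} [Field k] [CharZero k] [Field K] [Algebra k K] (t : K)
    (ht : Transcendental k t) [FiniteDimensional k⟮t⟯ K] :
    FiniteDimensional k (algebraicClosure k K) := by
  classical
  obtain ⟨_, _, hfin⟩ := dedekind_adjoin t ht
  let A := Algebra.adjoin k {t}
  let D := integralClosure A K
  let τ : A := ⟨t, Algebra.self_mem_adjoin_singleton k t⟩
  let T : D := algebraMap A D τ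
  have hT : ¬ IsUnit T := by
    intro h
    obtain ⟨u, hu⟩ := h.exists_right_inv
    have h1 : t * (u : K) = 1 := congrArg Subtype.val hu
    have h2 : (u : K) = t⁻¹ := eq_inv_of_mul_eq_one_right h1
    have h3 : t⁻¹ ∈ integralClosure A K := h2 ▸ u.2
    have h4 : ¬ IsAlgebraic k t⁻¹ := fun h => ht (by simpa using h.inv)
    obtain ⟨V, h5, h6⟩ := exists_val_of_not_algebraic k K _ h4
    have h7 : t ∈ V := by
      rcases V.mem_or_inv_mem t with h | h
      · exact h
      · exact absurd h h6
    exact h6 (mem_val_of_integral t _ h3 V h5 h7)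
  obtain ⟨P, hP, hTP⟩ := exists_max_ideal_of_mem_nonunits hT
  have hle : ∀ x ∈ algebraicClosure k K, x ∈ integralClosure A K := by
    intro x hx
    have : IsIntegral k x := (mem_algebraicClosure_iff.mp hx).isIntegral
    exact this.tower_top
  let g0 : algebraicClosure k K →+* D := (algebraMap (algebraicClosure k K) K).codRestrict
    (integralClosure A K).toSubring (fun x => hle x x.2)
  let g : algebraicClosure k K →ₐ[k] D ⧸ P :=
    { (Ideal.Quotient.mk P).comp g0 with
      commutes' := fun r => by
        change Ideal.Quotient.mk P _ = Ideal.Quotient.mk P (algebraMap k D r)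
        rfl }
  have : Nontrivial (D ⧸ P) := Ideal.Quotient.nontrivial_iff.mpr hP.ne_top
  have hg : Function.Injective g := g.toRingHom.injective
  have : Module.Finite k (D ⧸ P) := finite_quot_aux (A := A) τ (adjoin_decomp t) P hTP
  exact FiniteDimensional.of_injective g.toLinearMap hg

end


/-- All finite extensions have property. -/
def QQ (k : Type u) [Field k] : Prop :=
  ∀ (k' : Type u) [Field k'] [Algebra k k'], FiniteDimensional k k' → PontP (Additive k'ˣ)

theorem pontP_step (k K : Type u) [Field k] [CharZero k] [Field K] [Algebra k K] (t : K)
    (h : FiniteDimensional k⟮t⟯ K) (hQ : QQ k) : PontP (Additive Kˣ) := by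
  by_cases ht : IsAlgebraic k t
  · have : FiniteDimensional k k⟮t⟯ := IntermediateField.adjoin.finiteDimensional ht.isIntegral
    exact hQ K (Module.Finite.trans k⟮t⟯ K)
  have ht' : Transcendental k t⁻¹ := fun h => ht (by simpa using h.inv)
  have heq : k⟮t⟯ = k⟮t⁻¹⟯ := by
    apply le_antisymm
    · rw [IntermediateField.adjoin_simple_le_iff]
      simpa using inv_mem (IntermediateField.mem_adjoin_simple_self k t⁻¹)
    · rw [IntermediateField.adjoin_simple_le_iff]
      exact inv_mem (IntermediateField.mem_adjoin_simple_self k t)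
  have h' : FiniteDimensional k⟮t⁻¹⟯ K := by rw [← heq]; exact h
  obtain ⟨_, _, _⟩ := dedekind_adjoin t ht
  obtain ⟨_, _, _⟩ := dedekind_adjoin t⁻¹ ht'
  have hfd := finite_algebraicClosure t ht
  obtain ⟨f1, hf1⟩ := exists_divisor_map (integralClosure (Algebra.adjoin k {t}) K) K
  obtain ⟨f2, hf2⟩ := exists_divisor_map (integralClosure (Algebra.adjoin k {t⁻¹}) K) K
  have hP := hQ (algebraicClosure k K) hfd
  let i : Additive (algebraicClosure k K)ˣ →ₗ[ℤ] Additive Kˣ :=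
    (MonoidHom.toAdditive (Units.map (algebraMap (algebraicClosure k K) K).toMonoidHom)).toIntLinearMap
  refine pontP_ext i (f1.prod f2) ?_ ?_ ?_ hP
    (pontP_prod (finsupp_tf _) (pontP_finsupp _) (pontP_finsupp _))
  · exact Units.map_injective (f := (algebraMap (algebraicClosure k K) K).toMonoidHom)
      (algebraMap (algebraicClosure k K) K).injective
  · intro x hx
    rw [LinearMap.ker_prod] at hx
    obtain ⟨⟨a, ha⟩, ⟨b, hb⟩⟩ := And.intro (hf1 x hx.1) (hf2 x hx.2)
    have hal : IsAlgebraic k ((x.toMul : Kˣ) : K) :=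
      algebraic_of_integral_both t _ (ha ▸ a.2) (hb ▸ b.2)
    let y : algebraicClosure k K := ⟨_, mem_algebraicClosure_iff.mpr hal⟩
    have hy : y ≠ 0 := fun h => x.toMul.ne_zero (congrArg Subtype.val h)
    refine ⟨Additive.ofMul (Units.mk0 y hy), ?_⟩
    apply Additive.toMul.injective
    ext
    rfl
  · rintro n ⟨c1, c2⟩ hn hc
    have h1 := congrArg Prod.fst hc
    have h2 := congrArg Prod.snd hc
    exact Prod.ext (finsupp_tf _ n c1 hn h1) (finsupp_tf _ n c2 hn h2)

end

section

theorem kummer_descent (K E : Type*) [Field K] [Field E] [Algebra K E] [IsAbelianGalois K E]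
    (hroots : ∀ n : ℕ, 0 < n → ∃ ζ : E, IsPrimitiveRoot ζ n)
    (w : ℕ) (hw : ∀ (d : ℕ) (z : K), 0 < d → IsPrimitiveRoot z d → d ∣ w)
    (x : Eˣ) (n : ℕ) (hn : 0 < n) (a : K) (hx : algebraMap K E a = (x : E) ^ n) :
    ∃ η : Eˣ, (∃ m : ℕ, 0 < m ∧ η ^ m = 1) ∧
      ∃ z : Kˣ, x ^ w = η * Units.map (algebraMap K E).toMonoidHom z := by
  let s : (E ≃ₐ[K] E) → (Eˣ →* Eˣ) := fun σ => Units.map (σ : E →* E)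
  have hs : ∀ σ (u : Eˣ), ((s σ u : Eˣ) : E) = σ u := fun σ u => rfl
  have hcomm : ∀ σ τ (u : Eˣ), s σ (s τ u) = s τ (s σ u) := by
    intro σ τ u
    ext
    have : σ * τ = τ * σ := mul_comm' σ τ
    exact congrArg (fun f : E ≃ₐ[K] E => f (u : E)) this
  let J : AddSubgroup ℤ :=
    { carrier := {j | ∃ η : Eˣ, (∃ m : ℕ, 0 < m ∧ η ^ m = 1) ∧
        ∀ τ, (s τ x * x⁻¹) ^ j = s τ η * η⁻¹}
      zero_mem' := ⟨1, ⟨1, one_pos, by simp⟩, by simp⟩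
      add_mem' := by
        rintro i j ⟨η, ⟨m, hm, hη⟩, h1⟩ ⟨θ, ⟨l, hl, hθ⟩, h2⟩
        refine ⟨η * θ, ⟨m * l, Nat.mul_pos hm hl, ?_⟩, fun τ => ?_⟩
        · rw [mul_pow, pow_mul, hη, mul_comm m l, pow_mul, hθ]; simp
        · rw [zpow_add, h1, h2, map_mul, mul_inv]
          exact mul_mul_mul_comm _ _ _ _
      neg_mem' := by
        rintro i ⟨η, ⟨m, hm, hη⟩, h1⟩
        refine ⟨η⁻¹, ⟨m, hm, by rw [inv_pow, hη, inv_one]⟩, fun τ => ?_⟩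
        rw [zpow_neg, h1, map_inv, mul_inv] }
  have hr : ∀ τ, (s τ x * x⁻¹) ^ n = 1 := by
    intro τ
    rw [mul_pow, ← map_pow, inv_pow, mul_inv_eq_one]
    ext
    rw [hs, Units.val_pow_eq_pow_val, ← hx, AlgEquiv.commutes]
  have hnJ : (n : ℤ) ∈ J := ⟨1, ⟨1, one_pos, by simp⟩, fun τ => by rw [zpow_natCast, hr]; simp⟩
  obtain ⟨ζ0, hζ0⟩ := hroots n hn
  have hζ := hζ0.isUnit_unit hn.ne'
  set ζ : Eˣ := (hζ0.isUnit hn.ne').unit with hζdef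
  have : NeZero n := ⟨hn.ne'⟩
  have hpow : ∀ u : Eˣ, u ^ n = 1 → ∃ i : ℕ, ζ ^ i = u := by
    intro u hu
    obtain ⟨i, _, hi⟩ := hζ0.eq_pow_of_pow_eq_one (ξ := (u : E)) (by
      rw [← Units.val_pow_eq_pow_val, hu, Units.val_one])
    exact ⟨i, by ext; exact hi⟩
  have hc : ∀ σ, ∃ c : ℕ, ∀ u : Eˣ, u ^ n = 1 → s σ u = u ^ c := by
    intro σ
    obtain ⟨c, hc⟩ := hpow (s σ ζ) (by rw [← map_pow, hζ.pow_eq_one, map_one])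
    refine ⟨c, fun u hu => ?_⟩
    obtain ⟨i, rfl⟩ := hpow u hu
    rw [map_pow, ← hc, ← pow_mul, ← pow_mul, mul_comm]
  choose c hc using hc
  have hcJ : ∀ σ, (c σ : ℤ) - 1 ∈ J := by
    intro σ
    refine ⟨s σ x * x⁻¹, ⟨n, hn, hr σ⟩, fun τ => ?_⟩
    have h1 := hc σ _ (hr τ)
    rw [zpow_sub, zpow_natCast, ← h1, zpow_one, map_mul, map_mul, map_inv, map_inv, hcomm σ τ]
    rw [mul_inv, mul_inv, inv_inv]
    exact mul_mul_mul_comm _ _ _ _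
  obtain ⟨d0, hd0⟩ := Int.subgroup_cyclic J
  have hJ : ∀ j : ℤ, j ∈ J ↔ d0 ∣ j := by
    intro j
    rw [hd0, ← AddSubgroup.zmultiples_eq_closure, Int.mem_zmultiples_iff]
  let d := d0.natAbs
  have hdn : d ∣ n := by
    have := (hJ n).mp hnJ
    exact Int.natAbs_dvd_natAbs.mpr this
  obtain ⟨e, he⟩ := hdn
  have hd : 0 < d := Nat.pos_of_ne_zero fun h => by rw [h, zero_mul] at he; omega
  have hζ' : IsPrimitiveRoot (ζ ^ e) d := hζ.pow hn (by rw [he, mul_comm])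
  have hfix : ∀ σ, s σ (ζ ^ e) = ζ ^ e := by
    intro σ
    rw [hc σ (ζ ^ e) (by rw [← pow_mul, mul_comm, pow_mul, hζ.pow_eq_one, one_pow])]
    have h1 : (d : ℤ) ∣ (c σ : ℤ) - 1 := Int.natAbs_dvd.mpr ((hJ _).mp (hcJ σ))
    have h2 : (ζ ^ e) ^ ((c σ : ℤ) - 1) = 1 := (hζ'.zpow_eq_one_iff_dvd _).mpr h1
    rw [zpow_sub, zpow_natCast, zpow_one, mul_inv_eq_one] at h2
    exact h2
  have hrange : ∀ u : Eˣ, (∀ σ, s σ u = u) → ∃ z : K, algebraMap K E z = u := by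
    intro u hu
    exact (InfiniteGalois.mem_range_algebraMap_iff_fixed (k := K) (u : E)).mpr
      (fun σ => congrArg Units.val (hu σ))
  obtain ⟨z, hz⟩ := hrange _ hfix
  have hzp : IsPrimitiveRoot z d := by
    apply IsPrimitiveRoot.of_map_of_injective (f := algebraMap K E) _ (algebraMap K E).injective
    rw [hz]
    exact IsPrimitiveRoot.coe_units_iff.mpr hζ'
  have hdw : d0 ∣ (w : ℤ) := Int.natAbs_dvd.mp (by exact_mod_cast hw d z hd hzp)
  obtain ⟨η, hη, hηw⟩ := (hJ w).mpr hdw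
  refine ⟨η, hη, ?_⟩
  obtain ⟨y, hy⟩ := hrange (η⁻¹ * x ^ w) (by
    intro σ
    have h := hηw σ
    rw [zpow_natCast, mul_pow, ← map_pow, inv_pow, mul_inv_eq_iff_eq_mul] at h
    rw [map_mul, h, map_inv]
    group)
  have hy0 : y ≠ 0 := by
    rintro rfl
    rw [map_zero] at hy
    exact (η⁻¹ * x ^ w).ne_zero hy.symm
  refine ⟨Units.mk0 y hy0, ?_⟩
  have : Units.map (algebraMap K E).toMonoidHom (Units.mk0 y hy0) = η⁻¹ * x ^ w := by
    ext
    exact hy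
  rw [this, mul_inv_cancel_left]


theorem pontP_descent {M : Type u} [AddCommGroup M]
    (h : ∀ N : Submodule ℤ M, N.FG → ∃ (A : Type u) (_ : AddCommGroup A) (i : A →ₗ[ℤ] M),
      Function.Injective i ∧ PontP A ∧ ∃ w : ℤ, w ≠ 0 ∧ N ≤ LinearMap.range i ∧
      ∀ (x : M) (n : ℤ), n ≠ 0 → n • x ∈ N →
        ∃ (η : M) (z : A), (∃ m : ℤ, m ≠ 0 ∧ m • η = 0) ∧ w • x = η + i z) : PontP M := by
  intro N hN
  obtain ⟨A, _, i, hi, hA, w, hw, hNi, hx⟩ := h N hN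
  obtain ⟨N1, hN1, hN1'⟩ := hA (N.comap i) (fg_comap i hi hN)
  have key : ∀ (x : M) (n : ℤ), n ≠ 0 → n • x ∈ N →
      ∃ y ∈ N1.map i, ∃ m : ℤ, m ≠ 0 ∧ m • (w • x - y) = 0 := by
    intro x n hn hxn
    obtain ⟨η, z, ⟨m, hm, hη⟩, hz⟩ := hx x n hn hxn
    obtain ⟨y, hy, l, hl, hly⟩ := hN1' z (m * n) (mul_ne_zero hm hn) (by
      rw [Submodule.mem_comap, map_smul]
      have : i z = w • x - η := by rw [hz]; abel
      have h2 : (m * n) • (w • x - η) = (m * w) • (n • x) - n • (m • η) := by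
        module
      rw [this, h2, hη, smul_zero, sub_zero]
      exact N.smul_mem _ hxn)
    refine ⟨i y, Submodule.mem_map_of_mem hy, m * l, mul_ne_zero hm hl, ?_⟩
    have : (m * l) • (w • x - i y) = l • (m • η) + m • i (l • (z - y)) := by
      rw [hz, map_smul, map_sub]; module
    rw [this, hη, hly, map_zero, smul_zero, smul_zero, add_zero]
  let T : Submodule ℤ M := satur ⊥
  let μ : (M ⧸ T) →ₗ[ℤ] (M ⧸ T) := w • LinearMap.id
  have hμ : Function.Injective μ := by
    rw [injective_iff_map_eq_zero]
    intro u hu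
    obtain ⟨x, rfl⟩ := T.mkQ_surjective u
    have h1 : T.mkQ (w • x) = 0 := by rw [map_smul]; exact hu
    obtain ⟨m, hm, hmx⟩ := (Submodule.Quotient.mk_eq_zero T).mp h1
    refine (Submodule.Quotient.mk_eq_zero T).mpr ⟨m * w, mul_ne_zero hm hw, ?_⟩
    rwa [mul_smul]
  have hfg := fg_comap μ hμ ((hN1.map i).map T.mkQ)
  obtain ⟨N3, hN3, hN3'⟩ := exists_fg_lift T.mkQ hfg (by rw [Submodule.range_mkQ]; exact le_top)
  refine ⟨N3, hN3, fun x n hn hxn => ?_⟩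
  obtain ⟨y, hy, m, hm, hmy⟩ := key x n hn hxn
  have h1 : T.mkQ x ∈ Submodule.comap μ ((N1.map i).map T.mkQ) := by
    refine ⟨y, hy, ?_⟩
    have h2 : T.mkQ (w • x - y) = 0 :=
      (Submodule.Quotient.mk_eq_zero T).mpr ⟨m, hm, by rw [hmy]; exact zero_mem _⟩
    rw [map_sub, sub_eq_zero, map_smul] at h2
    exact h2.symm
  rw [← hN3'] at h1
  obtain ⟨y', hy', h3⟩ := h1
  have h4 : T.mkQ (x - y') = 0 := by rw [map_sub, h3, sub_self]
  obtain ⟨k, hk, hk'⟩ := (Submodule.Quotient.mk_eq_zero T).mp h4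
  exact ⟨y', hy', k, hk, hk'⟩

open IntermediateField in
theorem pontP_base (E : Type u) [Field E] [CharZero E] [Algebra.IsAlgebraic ℚ E]
    (hroots : ∀ n : ℕ, 0 < n → ∃ ζ : E, IsPrimitiveRoot ζ n)
    (S : Set E) (hS : S.Finite)
    (hgen : IntermediateField.adjoin ℚ ({x : E | ∃ m : ℕ, 0 < m ∧ x ^ m = 1} ∪ S) = ⊤) :
    PontP (Additive Eˣ) := by
  classical
  refine pontP_descent fun N hN => ?_
  obtain ⟨F, hF⟩ := hN
  let F' : Set E := (fun x : Additive Eˣ => ((x.toMul : Eˣ) : E)) '' (F : Set (Additive Eˣ))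
  have hF' : F'.Finite := F.finite_toSet.image _
  have hfin : (S ∪ F').Finite := hS.union hF'
  let K : IntermediateField ℚ E := IntermediateField.adjoin ℚ (S ∪ F')
  have : FiniteDimensional ℚ K := by
    have : Finite (S ∪ F' : Set E) := hfin
    exact IntermediateField.finiteDimensional_adjoin
      (fun x _ => (Algebra.IsAlgebraic.isAlgebraic (R := ℚ) x).isIntegral)
  have : NumberField K := { }
  have hcyc : IsCyclotomicExtension Set.univ K E := by
    rw [IsCyclotomicExtension.iff_adjoin_eq_top]
    refine ⟨fun n _ hn => hroots n (Nat.pos_of_ne_zero hn), ?_⟩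
    have hKalg : Algebra.IsAlgebraic K E := Algebra.IsAlgebraic.tower_top (K := ℚ) K
    rw [← IntermediateField.adjoin_eq_top_iff]
    rw [eq_top_iff]
    rintro x -
    have hx : x ∈ IntermediateField.adjoin ℚ ({x : E | ∃ m : ℕ, 0 < m ∧ x ^ m = 1} ∪ S) := by
      rw [hgen]; trivial
    let R := (IntermediateField.adjoin K {b : E | ∃ n : ℕ, n ∈ Set.univ ∧ n ≠ 0 ∧ b ^ n = 1}).restrictScalars ℚ
    have hle : IntermediateField.adjoin ℚ ({x : E | ∃ m : ℕ, 0 < m ∧ x ^ m = 1} ∪ S) ≤ R := by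
      rw [IntermediateField.adjoin_le_iff]
      rintro y (⟨m, hm, hy⟩ | hy)
      · exact IntermediateField.subset_adjoin K _ ⟨m, trivial, hm.ne', hy⟩
      · exact IntermediateField.algebraMap_mem (IntermediateField.adjoin K _)
          (⟨y, IntermediateField.subset_adjoin ℚ _ (Or.inl hy)⟩ : K)
    exact hle hx
  have hab := IsCyclotomicExtension.isAbelianGalois Set.univ K E
  obtain ⟨w, hw0, hw⟩ := finite_torsion_numberField K
  let i : Additive Kˣ →ₗ[ℤ] Additive Eˣ :=
    (MonoidHom.toAdditive (Units.map (algebraMap K E).toMonoidHom)).toIntLinearMap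
  have hi : Function.Injective i := Units.map_injective (f := (algebraMap K E).toMonoidHom)
    (algebraMap K E).injective
  have hNi : N ≤ LinearMap.range i := by
    rw [← hF, Submodule.span_le]
    intro x hx
    let y : K := ⟨((x.toMul : Eˣ) : E), IntermediateField.subset_adjoin ℚ _ (Or.inr ⟨x, hx, rfl⟩)⟩
    have hy : y ≠ 0 := fun h => x.toMul.ne_zero (congrArg Subtype.val h)
    refine ⟨Additive.ofMul (Units.mk0 y hy), ?_⟩
    apply Additive.toMul.injective
    ext
    rfl
  refine ⟨Additive Kˣ, inferInstance, i, hi, pontP_numberField K, w, by exact_mod_cast hw0.ne', hNi, ?_⟩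
  intro x n hn hx
  have hx' : (n.natAbs : ℤ) • x ∈ N := by
    rcases Int.natAbs_eq n with h | h
    · rwa [← h]
    · rw [h, neg_smul] at hx
      exact neg_mem_iff.mp hx
  obtain ⟨a, ha⟩ := hNi hx'
  have hxa : algebraMap K E ((a.toMul : Kˣ) : K) = ((x.toMul : Eˣ) : E) ^ n.natAbs := by
    have h1 := congrArg (fun u : Additive Eˣ => ((u.toMul : Eˣ) : E)) ha
    have h2 : ((((n.natAbs : ℤ) • x).toMul : Eˣ) : E) = ((x.toMul : Eˣ) : E) ^ n.natAbs := by
      rw [toMul_zsmul, zpow_natCast, Units.val_pow_eq_pow_val]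
    exact h1.trans h2
  obtain ⟨η, ⟨m, hm, hη⟩, z, hz⟩ := kummer_descent K E hroots w hw x.toMul n.natAbs
    (Int.natAbs_pos.mpr hn) _ hxa
  refine ⟨Additive.ofMul η, Additive.ofMul z, ⟨m, by exact_mod_cast hm.ne', ?_⟩, ?_⟩
  · apply Additive.toMul.injective
    rw [toMul_zsmul, zpow_natCast]
    exact hη
  · apply Additive.toMul.injective
    rw [toMul_zsmul, zpow_natCast]
    exact hz

end

section


open scoped IntermediateField

theorem QQ_of_finite (k k1 : Type u) [Field k] [Field k1] [Algebra k k1] [FiniteDimensional k k1]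
    (h : QQ k) : QQ k1 := by
  intro k' _ _ hfin
  letI : Algebra k k' := ((algebraMap k1 k').comp (algebraMap k k1)).toAlgebra
  haveI : IsScalarTower k k1 k' := IsScalarTower.of_algebraMap_eq fun _ => rfl
  exact h k' (Module.Finite.trans k1 k')

theorem QQ_step (K L : Type u) [Field K] [CharZero K] [Field L] [Algebra K L] (x : L) (h : QQ K) :
    QQ K⟮x⟯ := by
  intro k' _ _ hfin
  letI : Algebra K k' := ((algebraMap K⟮x⟯ k').comp (algebraMap K K⟮x⟯)).toAlgebra
  haveI : IsScalarTower K K⟮x⟯ k' := IsScalarTower.of_algebraMap_eq fun _ => rfl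
  let t : k' := algebraMap K⟮x⟯ k' (IntermediateField.AdjoinSimple.gen K x)
  have hmem : ∀ y : K⟮x⟯, algebraMap K⟮x⟯ k' y ∈ K⟮t⟯ := by
    rintro ⟨y, hy⟩
    induction hy using IntermediateField.adjoin_induction with
    | mem y hy =>
      obtain rfl := Set.mem_singleton_iff.mp hy
      exact IntermediateField.mem_adjoin_simple_self K t
    | algebraMap r => exact IntermediateField.algebraMap_mem K⟮t⟯ r
    | add a b ha hb h1 h2 =>
      have := add_mem h1 h2
      rw [← map_add] at this
      exact this
    | inv a ha h1 =>
      have := inv_mem h1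
      rw [← map_inv₀] at this
      exact this
    | mul a b ha hb h1 h2 =>
      have := mul_mem h1 h2
      rw [← map_mul] at this
      exact this
  letI : Algebra K⟮x⟯ K⟮t⟯ := ((algebraMap K⟮x⟯ k').codRestrict K⟮t⟯.toSubfield hmem).toAlgebra
  haveI : IsScalarTower K⟮x⟯ K⟮t⟯ k' := IsScalarTower.of_algebraMap_eq fun _ => rfl
  exact pontP_step K k' t (Module.Finite.of_restrictScalars_finite K⟮x⟯ K⟮t⟯ k') h

theorem QQ_base (L : Type u) [Field L] [CharZero L]
    (hU : ∀ m : ℕ, 0 < m → ∃ ζ : L, IsPrimitiveRoot ζ m) :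
    QQ (Subfield.closure {x : L | ∃ m : ℕ, 0 < m ∧ x ^ m = 1}) := by
  set E := Subfield.closure {x : L | ∃ m : ℕ, 0 < m ∧ x ^ m = 1} with hE
  intro k' _ _ hfin
  have : CharZero k' := charZero_of_injective_algebraMap (algebraMap E k').injective
  have hEalg : Algebra.IsAlgebraic ℚ E := by
    refine ⟨fun x => ?_⟩
    have hle : E ≤ (algebraicClosure ℚ L).toSubfield := by
      rw [hE, Subfield.closure_le]
      rintro y ⟨m, hm, hy⟩
      refine mem_algebraicClosure_iff.mpr (IsIntegral.isAlgebraic ?_)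
      exact IsIntegral.of_pow hm (by rw [hy]; exact isIntegral_one)
    have := mem_algebraicClosure_iff.mp (hle x.2)
    exact (isAlgebraic_algebraMap_iff (A := L) (algebraMap E L).injective).mp this
  have : Algebra.IsAlgebraic E k' := Algebra.IsAlgebraic.of_finite E k'
  have : Algebra.IsAlgebraic ℚ k' := Algebra.IsAlgebraic.trans ℚ E k'
  obtain ⟨S, hS⟩ := hfin.fg_top
  refine pontP_base k' ?_ S S.finite_toSet ?_
  · intro n hn
    obtain ⟨ζ, hζ⟩ := hU n hn
    let z : E := ⟨ζ, Subfield.subset_closure ⟨n, hn, hζ.pow_eq_one⟩⟩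
    have hz : IsPrimitiveRoot z n := IsPrimitiveRoot.of_map_of_injective (f := algebraMap E L) hζ
      (algebraMap E L).injective
    exact ⟨_, hz.map_of_injective (algebraMap E k').injective⟩
  · set R := IntermediateField.adjoin ℚ ({x : k' | ∃ m : ℕ, 0 < m ∧ x ^ m = 1} ∪ (S : Set k'))
      with hR
    have hmem : ∀ y : E, algebraMap E k' y ∈ R := by
      rintro ⟨y, hy⟩
      induction hy using Subfield.closure_induction with
      | mem y hy =>
        obtain ⟨m, hm, hym⟩ := hy
        refine IntermediateField.subset_adjoin ℚ _ (Or.inl ⟨m, hm, ?_⟩)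
        rw [← map_pow, ← map_one (algebraMap E k')]
        congr 1
        exact Subtype.ext hym
      | one => 
        have := one_mem R
        rw [← map_one (algebraMap E k')] at this
        exact this
      | add a b ha hb h1 h2 =>
        have := add_mem h1 h2
        rw [← map_add] at this
        exact this
      | neg a ha h1 =>
        have := neg_mem h1
        rw [← map_neg] at this
        exact this
      | inv a ha h1 =>
        have := inv_mem h1
        rw [← map_inv₀] at this
        exact this
      | mul a b ha hb h1 h2 =>
        have := mul_mem h1 h2
        rw [← map_mul] at this
        exact this
    rw [eq_top_iff]
    rintro x -
    have hx : x ∈ Submodule.span E (S : Set k') := by rw [hS]; trivial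
    induction hx using Submodule.span_induction with
    | mem x hx => exact IntermediateField.subset_adjoin ℚ _ (Or.inr hx)
    | zero => exact zero_mem _
    | add x y _ _ h1 h2 => exact add_mem h1 h2
    | smul a x _ h1 => rw [Algebra.smul_def]; exact mul_mem (hmem a) h1

theorem countable_of_gen (L : Type u) [Field L] (S : Finset L)
    (h : Subfield.closure (({x : L | ∃ m : ℕ, 0 < m ∧ x ^ m = 1}) ∪ (S : Set L)) = ⊤) :
    Countable L := by
  classical
  have hc : (({x : L | ∃ m : ℕ, 0 < m ∧ x ^ m = 1}) ∪ (S : Set L)).Countable := by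
    refine Set.Countable.union ?_ S.countable_toSet
    have : {x : L | ∃ m : ℕ, 0 < m ∧ x ^ m = 1} ⊆
        ⋃ m : ℕ, ((Polynomial.nthRoots (m + 1) (1 : L)).toFinset : Set L) := by
      rintro x ⟨m, hm, hx⟩
      rw [Set.mem_iUnion]
      refine ⟨m - 1, ?_⟩
      have : m - 1 + 1 = m := by omega
      simp [this, Polynomial.mem_nthRoots hm, hx]
    exact (Set.countable_iUnion fun m => Finset.countable_toSet _).mono this
  have h1 := Subfield.cardinalMk_closure_le_max
    (({x : L | ∃ m : ℕ, 0 < m ∧ x ^ m = 1}) ∪ (S : Set L))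
  rw [max_eq_right (Cardinal.le_aleph0_iff_set_countable.mpr hc), Cardinal.mk_le_aleph0_iff, h] at h1
  exact (Subfield.topEquiv (K := L)).symm.injective.countable


end

theorem units_modulo_roots_of_unity_free_abelian
    (L : Type*) [Field L] [CharZero L]
    -- `L` contains all roots of unity :
    (hU : ∀ m : ℕ, 0 < m → ∃ ζ : L, IsPrimitiveRoot ζ m)
    -- `L` is a finitely generated field extension of `ℚ(𝕌)` :
    (hfg : ∃ S : Finset L,
      Subfield.closure (({x : L | ∃ m : ℕ, 0 < m ∧ x ^ m = 1}) ∪ (S : Set L)) = ⊤) :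
    Module.Free ℤ (Additive (Lˣ ⧸ CommGroup.torsion Lˣ)) := by
  obtain ⟨S, hS⟩ := hfg
  have hcount : Countable L := countable_of_gen L S hS
  have hP : PontP (Additive Lˣ) := by
    have hbase := QQ_base L hU
    set E := Subfield.closure {x : L | ∃ m : ℕ, 0 < m ∧ x ^ m = 1} with hE
    have htop : IntermediateField.adjoin E (S : Set L) = ⊤ := by
      rw [eq_top_iff]
      rintro x -
      have hx : x ∈ Subfield.closure (({x : L | ∃ m : ℕ, 0 < m ∧ x ^ m = 1}) ∪ (S : Set L)) := by
        rw [hS]; trivial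
      have hle : Subfield.closure (({x : L | ∃ m : ℕ, 0 < m ∧ x ^ m = 1}) ∪ (S : Set L)) ≤
          (IntermediateField.adjoin E (S : Set L)).toSubfield := by
        rw [Subfield.closure_le]
        rintro y (hy | hy)
        · exact IntermediateField.algebraMap_mem (IntermediateField.adjoin E (S : Set L))
            (⟨y, Subfield.subset_closure hy⟩ : E)
        · exact IntermediateField.subset_adjoin E _ hy
      exact hle hx
    have hQ : QQ (IntermediateField.adjoin E (S : Set L)) := by
      refine IntermediateField.induction_on_adjoin_finset S (fun K => QQ K) ?_ ?_
      · exact QQ_of_finite E (⊥ : IntermediateField E L) hbase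
      · intro K x _ hK
        exact QQ_step K L x hK
    refine hQ L ?_
    rw [htop]
    exact Module.Finite.of_surjective (Algebra.linearMap (⊤ : IntermediateField E L) L)
      (fun x => ⟨⟨x, trivial⟩, rfl⟩)
  let q : Additive Lˣ →ₗ[ℤ] Additive (Lˣ ⧸ CommGroup.torsion Lˣ) :=
    (MonoidHom.toAdditive (QuotientGroup.mk' (CommGroup.torsion Lˣ))).toIntLinearMap
  have hq : Function.Surjective q := QuotientGroup.mk'_surjective (CommGroup.torsion Lˣ)
  have hker : ∀ x, q x = 0 → ∃ m : ℤ, m ≠ 0 ∧ m • x = 0 := by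
    intro x hx
    have hx' : x.toMul ∈ CommGroup.torsion Lˣ := (QuotientGroup.eq_one_iff (N := CommGroup.torsion Lˣ) x.toMul).mp hx
    obtain ⟨m, hm, h⟩ := isOfFinOrder_iff_pow_eq_one.mp hx'
    refine ⟨m, by exact_mod_cast hm.ne', ?_⟩
    apply Additive.toMul.injective
    rw [toMul_zsmul, zpow_natCast]
    exact h
  have hker' : ∀ (x : Additive Lˣ) (m : ℤ), m ≠ 0 → m • x = 0 → q x = 0 := by
    intro x m hm hx
    refine (QuotientGroup.eq_one_iff (N := CommGroup.torsion Lˣ) x.toMul).mpr ?_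
    refine isOfFinOrder_iff_zpow_eq_one.mpr ⟨m, hm, ?_⟩
    have := congrArg Additive.toMul hx
    rw [toMul_zsmul] at this
    exact this
  have hc2 : Countable (Additive Lˣ) := by
    have : Countable Lˣ := Units.val_injective.countable
    exact this
  have : Countable (Additive (Lˣ ⧸ CommGroup.torsion Lˣ)) := hq.countable
  refine free_of_pontP _ ?_ (pontP_quot q hq hker hP)
  intro n c hn hc
  obtain ⟨x, rfl⟩ := hq c
  rw [← map_smul] at hc
  obtain ⟨m, hm, hmx⟩ := hker _ hc
  exact hker' x (m * n) (mul_ne_zero hm hn) (by rw [mul_smul]; exact hmx)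
end

section
/- Let A be a finite subset of ℂ^×, let E := ℚ(𝕌 ∪ A) be the subfield of ℂ generated by all roots of unity together with A, and let G := ⟨A⟩_{E^×} be the smallest radical subgroup of E^× containing A. Then the quotient of G by its torsion subgroup (the roots of unity lying in G) is a finitely generated free abelian group. -/
theorem sub_fg {X : Type*} [CommGroup X] {N Γ : Subgroup X} (hΓ : Γ.FG) (h : N ≤ Γ) : N.FG := by
  rw [Subgroup.fg_iff_add_fg, AddSubgroup.fg_iff_addSubmonoid_fg] at *
  have e : ∀ P : Subgroup X, P.toAddSubgroup.toAddSubmonoid.FG ↔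
      (AddSubgroup.toIntSubmodule P.toAddSubgroup).FG := by
    intro P
    rw [← AddSubgroup.fg_iff_addSubmonoid_fg, Submodule.fg_iff_addSubgroup_fg]; rfl
  rw [e] at *
  have : IsNoetherian ℤ (AddSubgroup.toIntSubmodule Γ.toAddSubgroup) :=
    isNoetherian_of_fg_of_noetherian _ hΓ
  exact Submodule.FG.of_le hΓ h

theorem fg_of_map_inf {X Y : Type*} [CommGroup X] [CommGroup Y] (f : X →* Y) {H : Subgroup X}
    (h1 : (H.map f).FG) (h2 : (H ⊓ f.ker).FG) : H.FG := by
  rw [Subgroup.fg_iff_add_fg] at *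
  have e : ∀ {M : Type _} [AddCommGroup M] (P : AddSubgroup M), P.FG ↔
      (AddSubgroup.toIntSubmodule P).FG := by
    intro M _ P
    rw [Submodule.fg_iff_addSubgroup_fg]; rfl
  have e' : ∀ {M : Type _} [AddCommGroup M] (P : AddSubgroup M), P.FG ↔
      (AddSubgroup.toIntSubmodule P).FG := by
    intro M _ P
    rw [Submodule.fg_iff_addSubgroup_fg]; rfl
  rw [e] at h2 ⊢
  rw [e'] at h1
  refine Submodule.fg_of_fg_map_of_fg_inf_ker (MonoidHom.toAdditive f).toIntLinearMap ?_ ?_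
  · exact h1
  · exact h2

def FinRk {X : Type*} [CommGroup X] (H : Subgroup X) : Prop :=
  ∃ Γ : Subgroup X, Γ.FG ∧ ∀ h ∈ H, ∃ m : ℕ, 0 < m ∧ h ^ m ∈ Γ

theorem FinRk.mono {X : Type*} [CommGroup X] {H N : Subgroup X} (h : FinRk H) (hN : N ≤ H) :
    FinRk N := by
  obtain ⟨Γ, h1, h2⟩ := h
  exact ⟨Γ, h1, fun x hx => h2 x (hN hx)⟩

theorem fg_of_val {X ι : Type*} [CommGroup X] (f : ι → X →* Multiplicative ℤ)
    (hf : ∀ x, {i | f i x ≠ 1}.Finite) {H : Subgroup X} (hH : FinRk H)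
    (hk : ∀ N : Subgroup X, N ≤ H → (∀ x ∈ N, ∀ i, f i x = 1) → N.FG) : H.FG := by
  obtain ⟨Γ, ⟨s, rfl⟩, h2⟩ := hH
  have hS : (⋃ x ∈ s, {i | f i x ≠ 1}).Finite := s.finite_toSet.biUnion fun x _ => hf x
  set S := (⋃ x ∈ s, {i | f i x ≠ 1}) with hSd
  have : Finite S := hS
  let g : X →* (S → Multiplicative ℤ) := MonoidHom.pi fun i => f i
  have hz : ∀ i ∉ S, ∀ x ∈ Subgroup.closure (s : Set X), f i x = 1 := by
    intro i hi
    change Subgroup.closure (s : Set X) ≤ (f i).ker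
    rw [Subgroup.closure_le]
    intro x hx
    by_contra hne
    exact hi (Set.mem_biUnion (show x ∈ (s : Set X) from hx) hne)
  refine fg_of_map_inf g ?_ ?_
  · refine sub_fg (Γ := ⊤) ?_ le_top
    rw [← Group.fg_def]; infer_instance
  · refine hk _ inf_le_left ?_
    rintro x ⟨hxH, hx⟩ i
    by_cases hi : i ∈ S
    · exact congrFun (show g x = 1 from hx) ⟨i, hi⟩
    · obtain ⟨m, hm, hxm⟩ := h2 x hxH
      have := hz i hi _ hxm
      rw [map_pow] at this
      exact (pow_eq_one_iff_left hm.ne').1 this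

open IsDedekindDomain in
theorem support_fin {R K : Type*} [CommRing R] [IsDedekindDomain R] [Field K] [Algebra R K]
    [IsFractionRing R K] (x : Kˣ) :
    {v : HeightOneSpectrum R | v.valuationOfNeZero (K := K) x ≠ 1}.Finite := by
  refine ((HeightOneSpectrum.Support.finite R (x : K)).union
    (HeightOneSpectrum.Support.finite R ((x⁻¹ : Kˣ) : K))).subset ?_
  intro v hv
  simp only [Set.mem_ofPred_eq] at hv
  rcases lt_or_gt_of_ne hv with h | h
  · right
    change 1 < v.valuation K _
    rw [← HeightOneSpectrum.valuationOfNeZero_eq, map_inv]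
    rw [← WithZero.coe_one, WithZero.coe_lt_coe]
    exact one_lt_inv'.2 h
  · left
    change 1 < v.valuation K _
    rw [← HeightOneSpectrum.valuationOfNeZero_eq]
    rw [← WithZero.coe_one, WithZero.coe_lt_coe]
    exact h

open IsDedekindDomain in
theorem val_int {R K : Type*} [CommRing R] [IsDedekindDomain R] [Field K] [Algebra R K]
    [IsFractionRing R K] (x : Kˣ)
    (hx : ∀ v : HeightOneSpectrum R, v.valuationOfNeZero (K := K) x = 1) :
    ∃ r : R, algebraMap R K r = x := by
  refine HeightOneSpectrum.mem_integers_of_valuation_le_one K (x : K) fun v => ?_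
  rw [← HeightOneSpectrum.valuationOfNeZero_eq, hx v]; rfl

def Good (K : Type) [Field K] : Prop := ∀ H : Subgroup Kˣ, FinRk H → H.FG

def VGood (F : Type) [Field F] : Prop :=
  ∀ (K : Type) [Field K] [Algebra F K], FiniteDimensional F K → Good K

theorem vgood_rat : VGood ℚ := by
  intro K _ iA hfd H hH
  have hA : iA = @DivisionRing.toRatAlgebra K _ (charZero_of_injective_algebraMap
    (algebraMap ℚ K).injective) := Subsingleton.elim _ _
  have : CharZero K := charZero_of_injective_algebraMap (algebraMap ℚ K).injective
  have : NumberField K := by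
    refine @NumberField.mk _ _ this ?_
    rw [hA] at hfd
    exact hfd
  refine fg_of_val (fun v : IsDedekindDomain.HeightOneSpectrum (NumberField.RingOfIntegers K) =>
    v.valuationOfNeZero (K := K)) (fun x => support_fin x) hH ?_
  intro N hN h
  have hfg : (Units.map (algebraMap (NumberField.RingOfIntegers K) K).toMonoidHom).range.FG := by
    rw [← Group.fg_iff_subgroup_fg]
    have : Group.FG (NumberField.RingOfIntegers K)ˣ := Group.fg_iff_monoid_fg.2 inferInstance
    infer_instance
  refine sub_fg hfg ?_
  intro x hx
  obtain ⟨r, hr⟩ := val_int x (h x hx)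
  obtain ⟨r', hr'⟩ := val_int x⁻¹ (h _ (N.inv_mem hx))
  have h1 : r * r' = 1 := by
    apply FaithfulSMul.algebraMap_injective (NumberField.RingOfIntegers K) K
    rw [map_mul, hr, hr']; simp
  refine ⟨⟨r, r', h1, by rw [mul_comm, h1]⟩, ?_⟩
  ext
  exact hr

theorem sg_map {X Y : Type*} [CommGroup X] [CommGroup Y] (f : X →* Y) {H : Subgroup X}
    (h : H.FG) : (H.map f).FG := by
  classical
  obtain ⟨s, rfl⟩ := h
  exact ⟨s.image f, by rw [MonoidHom.map_closure, Finset.coe_image]⟩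

open Polynomial IntermediateField

section
variable {F L K : Type} [Field F] [Field L] [Field K] [Algebra F L] [Algebra L K] [Algebra F K]
  [IsScalarTower F L K]

theorem adjoin_pid (t : L) : IsPrincipalIdealRing (Algebra.adjoin F {t}) := by
  rw [Algebra.adjoin_singleton_eq_range_aeval]
  exact IsPrincipalIdealRing.of_surjective (aeval (R := F) t).rangeRestrict.toRingHom
    (aeval (R := F) t).rangeRestrict_surjective

theorem adjoin_frac {t : L} (ht : F⟮t⟯ = ⊤) : IsFractionRing (Algebra.adjoin F {t}) L := by
  refine IsFractionRing.of_field _ _ fun z => ?_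
  have hz : z ∈ F⟮t⟯ := ht ▸ mem_top
  rw [mem_adjoin_iff_div] at hz
  obtain ⟨r, hr, s, hs, rfl⟩ := hz
  exact ⟨⟨r, hr⟩, ⟨s, hs⟩, rfl⟩

theorem exists_family [CharZero L] [FiniteDimensional L K] {t : L} (ht : F⟮t⟯ = ⊤) :
    ∃ (ι : Type) (f : ι → Kˣ →* Multiplicative ℤ), (∀ x, {i | f i x ≠ 1}.Finite) ∧
      ∀ x : Kˣ, (∀ i, f i x = 1) → IsIntegral (Algebra.adjoin F {t}) (x : K) := by
  have := adjoin_pid (F := F) t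
  have := adjoin_frac ht
  have : IsDedekindDomain (integralClosure (Algebra.adjoin F {t}) K) :=
    integralClosure.isDedekindDomain _ L _
  have : IsFractionRing (integralClosure (Algebra.adjoin F {t}) K) K :=
    integralClosure.isFractionRing_of_finite_extension L K
  refine ⟨IsDedekindDomain.HeightOneSpectrum (integralClosure (Algebra.adjoin F {t}) K),
    fun v => v.valuationOfNeZero (K := K), fun x => support_fin x, fun x hx => ?_⟩
  obtain ⟨r, hr⟩ := val_int x hx
  rw [← hr]
  exact r.2

theorem const_of_both {t : L} (hT : Transcendental F t) {c : L}
    (h1 : c ∈ Algebra.adjoin F {t}) (h2 : c ∈ Algebra.adjoin F {t⁻¹}) :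
    c ∈ (algebraMap F L).range := by
  rw [Algebra.adjoin_singleton_eq_range_aeval] at h1 h2
  obtain ⟨p, hp⟩ := h1
  obtain ⟨q, hq⟩ := h2
  change aeval t p = c at hp
  change aeval t⁻¹ q = c at hq
  have ht0 : t ≠ 0 := by rintro rfl; exact hT (isAlgebraic_zero)
  have key : aeval t (p * X ^ q.natDegree) = aeval t q.reverse := by
    let _ : Invertible t⁻¹ := invertibleOfNonzero (inv_ne_zero ht0)
    have h3 := eval₂_reverse_mul_pow (algebraMap F L) t⁻¹ q
    rw [invOf_eq_inv, inv_inv, ← aeval_def, ← aeval_def, hq, ← hp] at h3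
    rw [map_mul, ← h3, map_pow, aeval_X, mul_assoc, ← mul_pow, inv_mul_cancel₀ ht0, one_pow,
      mul_one]
  have key2 := transcendental_iff_injective.1 hT key
  by_cases hp0 : p = 0
  · rw [← hp, hp0]; simp
  have hd : p.natDegree = 0 := by
    have h3 := q.reverse_natDegree_le
    rw [← key2, natDegree_mul_X_pow _ hp0] at h3
    omega
  rw [natDegree_eq_zero] at hd
  obtain ⟨a, rfl⟩ := hd
  exact ⟨a, by rw [← hp]; simp⟩

theorem isAlg_of_both [CharZero L] [FiniteDimensional L K] {t : L} (hT : Transcendental F t)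
    (ht : F⟮t⟯ = ⊤) (ht' : F⟮t⁻¹⟯ = ⊤) {x : K} (h1 : IsIntegral (Algebra.adjoin F {t}) x)
    (h2 : IsIntegral (Algebra.adjoin F {t⁻¹}) x) : IsAlgebraic F x := by
  have := adjoin_pid (F := F) t
  have := adjoin_frac ht
  have := adjoin_pid (F := F) t⁻¹
  have := adjoin_frac ht'
  have e1 := minpoly.isIntegrallyClosed_eq_field_fractions' L h1
  have e2 := minpoly.isIntegrallyClosed_eq_field_fractions' L h2
  have hl : minpoly L x ∈ Polynomial.lifts (algebraMap F L) := by
    rw [Polynomial.lifts_iff_coeff_lifts]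
    intro n
    apply const_of_both hT
    · rw [e1, coeff_map]; exact Subtype.property _
    · rw [e2, coeff_map]; exact Subtype.property _
  obtain ⟨P, hP⟩ := (Polynomial.mem_lifts _).1 hl
  refine ⟨P, ?_, ?_⟩
  · rintro rfl
    rw [Polynomial.map_zero] at hP
    exact minpoly.ne_zero (IsIntegral.of_finite L x) hP.symm
  · have := minpoly.aeval L x
    rwa [← hP, aeval_map_algebraMap] at this

theorem fin_algClosure [FiniteDimensional L K] {t : L} (hT : Transcendental F t)
    (ht : F⟮t⟯ = ⊤) : FiniteDimensional F (algebraicClosure F K) := by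
  have := adjoin_frac ht
  let b := Module.Basis.ofVectorSpace F (algebraicClosure F K)
  have hT' : Transcendental F (algebraMap L K t) :=
    (transcendental_algebraMap_iff (algebraMap L K).injective).2 hT
  have hT2 := hT'.algebraicClosure
  have hli : LinearIndependent (Algebra.adjoin F {t}) (fun i => (b i : K)) := by
    rw [linearIndependent_iff']
    intro s g hg
    have hh : ∀ i, ∃ p : F[X], aeval t p = (g i : L) := by
      intro i
      have := (Algebra.adjoin_singleton_eq_range_aeval F t).le (g i).2
      exact this
    choose p hp using hh
    have hP : (∑ i ∈ s, C (b i) * (p i).map (algebraMap F (algebraicClosure F K))) = 0 := by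
      apply transcendental_iff_injective.1 hT2
      rw [map_sum, map_zero, ← hg]
      refine Finset.sum_congr rfl fun i _ => ?_
      rw [map_mul, aeval_C, aeval_map_algebraMap, aeval_algebraMap_apply, hp, Algebra.smul_def,
        mul_comm]
      rfl
    intro i hi
    have : p i = 0 := by
      ext n
      have h3 := congrArg (fun q => coeff q n) hP
      simp only [finsetSum_coeff, coeff_C_mul, coeff_map, coeff_zero] at h3
      have h4 := linearIndependent_iff'.1 b.linearIndependent s (fun i => (p i).coeff n) (by
        rw [← h3]
        refine Finset.sum_congr rfl fun i _ => ?_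
        rw [Algebra.smul_def, mul_comm]) i hi
      simpa using h4
    have h5 := hp i
    rw [this, map_zero] at h5
    exact Subtype.ext h5.symm
  rw [LinearIndependent.iff_fractionRing _ L] at hli
  have := hli.finite
  exact Module.Finite.of_basis b

theorem good_func [CharZero L] [FiniteDimensional L K] {t : L} (hT : Transcendental F t)
    (ht : F⟮t⟯ = ⊤) (hF : VGood F) : Good K := by
  have ht' : F⟮t⁻¹⟯ = ⊤ := by
    rw [eq_top_iff, ← ht, adjoin_simple_le_iff]
    simpa using inv_mem (mem_adjoin_simple_self F t⁻¹)
  obtain ⟨ι, f, hf1, hf2⟩ := exists_family (K := K) ht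
  obtain ⟨κ, g, hg1, hg2⟩ := exists_family (K := K) ht'
  intro H hH
  have hfd : FiniteDimensional F (algebraicClosure F K) := fin_algClosure (L := L) hT ht
  refine fg_of_val (Sum.elim f g) ?_ hH ?_
  · intro x
    refine (((hf1 x).image Sum.inl).union ((hg1 x).image Sum.inr)).subset ?_
    rintro (i | i) hi
    · left; exact ⟨i, hi, rfl⟩
    · right; exact ⟨i, hi, rfl⟩
  · intro N hN h
    have hal : ∀ x ∈ N, (x : K) ∈ algebraicClosure F K := by
      intro x hx
      rw [mem_algebraicClosure_iff]
      exact isAlg_of_both hT ht ht' (hf2 x fun i => h x hx (Sum.inl i))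
        (hg2 x fun i => h x hx (Sum.inr i))
    let φ : (algebraicClosure F K)ˣ →* Kˣ :=
      Units.map (algebraMap (algebraicClosure F K) K).toMonoidHom
    have hφ : Function.Injective φ := Units.map_injective (algebraMap (algebraicClosure F K) K).injective
    have hNle : N ≤ φ.range := by
      intro x hx
      have hx0 : (⟨x, hal x hx⟩ : algebraicClosure F K) ≠ 0 := by
        intro h0
        exact x.ne_zero (congrArg Subtype.val h0)
      exact ⟨Units.mk0 _ hx0, by ext; rfl⟩
    rw [← Subgroup.map_comap_eq_self hNle]
    refine sg_map _ (hF _ hfd _ ?_)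
    obtain ⟨Γ, hΓ, h2⟩ := hH.mono hN
    have hΓN : (Γ ⊓ N).FG := sub_fg hΓ inf_le_left
    refine ⟨(Γ ⊓ N).comap φ, ?_, ?_⟩
    · refine fg_of_map_inf φ (sub_fg hΓN (Subgroup.map_comap_le _ _)) ?_
      rw [(MonoidHom.ker_eq_bot_iff φ).2 hφ, inf_bot_eq]
      exact Subgroup.FG.bot
    · intro y hy
      obtain ⟨m, hm, hm2⟩ := h2 _ hy
      refine ⟨m, hm, ?_⟩
      rw [Subgroup.mem_comap, map_pow]
      exact ⟨hm2, pow_mem hy m⟩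

end

theorem vgood_step {F L : Type} [Field F] [Field L] [Algebra F L] [CharZero L] {t : L}
    (ht : F⟮t⟯ = ⊤) (hF : VGood F) : VGood L := by
  intro K _ _ hK
  let _ : Algebra F K := ((algebraMap L K).comp (algebraMap F L)).toAlgebra
  have : IsScalarTower F L K := IsScalarTower.of_algebraMap_eq fun _ => rfl
  by_cases hT : Transcendental F t
  · exact good_func hT ht hF
  · have h1 : FiniteDimensional F F⟮t⟯ :=
      adjoin.finiteDimensional (not_not.1 hT : IsAlgebraic F t).isIntegral
    have : FiniteDimensional F L := by
      rw [ht] at h1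
      exact Module.Finite.equiv (topEquiv (F := F) (E := L)).toLinearEquiv
    exact hF K (FiniteDimensional.trans F L K)

theorem vgood_adjoin (s : Finset ℂ) : VGood (adjoin ℚ (s : Set ℂ)) := by
  refine induction_on_adjoin_finset s (fun K => VGood K) ?_ ?_
  · have : ℚ⟮(0 : (⊥ : IntermediateField ℚ ℂ))⟯ = ⊤ := by
      rw [eq_top_iff]
      rintro ⟨x, hx⟩ _
      obtain ⟨q, rfl⟩ := mem_bot.1 hx
      exact IntermediateField.algebraMap_mem ℚ⟮(0 : (⊥ : IntermediateField ℚ ℂ))⟯ q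
    exact vgood_step this vgood_rat
  · intro K x _ hK
    have : ∃ t : K⟮x⟯, K⟮t⟯ = ⊤ := by
      refine ⟨AdjoinSimple.gen K x, ?_⟩
      apply lift_injective
      rw [lift_adjoin_simple, lift_top]
      rfl
    obtain ⟨t, ht⟩ := this
    have := vgood_step ht hK
    exact this

theorem kummer_fin {K L : Type} [Field K] [Field L] [Algebra K L] [FiniteDimensional K L]
    [IsAbelianGalois K L] {N : ℕ} (hN : 0 < N) {ζ : L} (hζ : IsPrimitiveRoot ζ N) {x : L}
    (hx0 : x ≠ 0) (hx : x ^ N ∈ Set.range (algebraMap K L)) {w : ℕ}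
    (hw : ∀ u : K, u ^ N = 1 → u ^ w = 1) :
    ∃ (b : K) (η : L), η ^ N = 1 ∧ x ^ w = algebraMap K L b * η := by
  have : NeZero N := ⟨hN.ne'⟩
  have hζ0 : ζ ≠ 0 := hζ.ne_zero hN.ne'
  let S : AddSubgroup ℤ :=
    { carrier := {k | ∃ (b : K) (η : L), η ^ N = 1 ∧ x ^ k = algebraMap K L b * η}
      zero_mem' := ⟨1, 1, by simp, by simp⟩
      add_mem' := by
        rintro k l ⟨b, η, h1, h2⟩ ⟨b', η', h1', h2'⟩
        refine ⟨b * b', η * η', by rw [mul_pow, h1, h1', one_mul], ?_⟩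
        rw [zpow_add₀ hx0, h2, h2', map_mul]; ring
      neg_mem' := by
        rintro k ⟨b, η, h1, h2⟩
        refine ⟨b⁻¹, η⁻¹, by rw [inv_pow, h1, inv_one], ?_⟩
        rw [zpow_neg, h2, map_inv₀, mul_inv] }
  have hSN : (N : ℤ) ∈ S := by
    obtain ⟨b, hb⟩ := hx
    exact ⟨b, 1, by simp, by rw [zpow_natCast, mul_one, hb]⟩
  have hroot : ∀ τ : Gal(L/K), (τ x / x) ^ N = 1 := by
    intro τ
    obtain ⟨b, hb⟩ := hx
    rw [div_pow, ← map_pow, ← hb, AlgEquiv.commutes, hb, div_self (pow_ne_zero _ hx0)]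
  have hchar : ∀ σ : Gal(L/K), ∃ c : ℕ, σ ζ = ζ ^ c ∧ ((c : ℤ) - 1) ∈ S := by
    intro σ
    obtain ⟨c, -, hc⟩ := hζ.eq_pow_of_pow_eq_one (ξ := σ ζ) (by rw [← map_pow, hζ.pow_eq_one, map_one])
    have hact : ∀ η : L, η ^ N = 1 → σ η = η ^ c := by
      intro η hη
      obtain ⟨i, -, rfl⟩ := hζ.eq_pow_of_pow_eq_one hη
      rw [map_pow, ← hc, ← pow_mul, ← pow_mul, mul_comm]
    refine ⟨c, hc.symm, ?_⟩
    have hσx : σ x ≠ 0 := by simpa using hx0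
    have hy : x ^ c / σ x ∈ Set.range (algebraMap K L) := by
      rw [IsGalois.mem_range_algebraMap_iff_fixed]
      intro τ
      have h1 := hact _ (hroot τ)
      have hτx : τ x ≠ 0 := by simpa using hx0
      have h2 : σ (τ x) = τ (σ x) := by
        have := mul_comm' σ τ
        exact DFunLike.congr_fun this x
      have h3 : τ (σ x) ≠ 0 := by simpa using hx0
      rw [map_div₀, h2, div_pow, div_eq_div_iff hσx (pow_ne_zero _ hx0)] at h1
      rw [map_div₀, map_pow, div_eq_div_iff h3 hσx]
      rw [← h1]; ring
    obtain ⟨b, hb⟩ := hy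
    refine ⟨b, σ x / x, hroot σ, ?_⟩
    rw [hb, zpow_sub₀ hx0, zpow_natCast, zpow_one]
    field_simp
  obtain ⟨d, hd⟩ := Int.subgroup_cyclic S
  have hmem : ∀ k, k ∈ S ↔ ∃ n : ℤ, n * d = k := by
    intro k
    rw [hd, AddSubgroup.mem_closure_singleton]
    simp
  obtain ⟨n, hn⟩ := (hmem _).1 hSN
  have hn0 : n ≠ 0 := by
    rintro rfl
    simp at hn
    omega
  have hu : ζ ^ n ∈ Set.range (algebraMap K L) := by
    rw [IsGalois.mem_range_algebraMap_iff_fixed]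
    intro σ
    obtain ⟨c, hc, hcS⟩ := hchar σ
    obtain ⟨n', hn'⟩ := (hmem _).1 hcS
    rw [map_zpow₀, hc, ← zpow_natCast, ← zpow_mul]
    have : (c : ℤ) * n = n + N * n' := by rw [← hn]; linear_combination (-n) * hn'
    rw [this, zpow_add₀ hζ0, zpow_mul, zpow_natCast, hζ.pow_eq_one, one_zpow, mul_one]
  obtain ⟨v, hv⟩ := hu
  have hvN : v ^ N = 1 := by
    apply (algebraMap K L).injective
    rw [map_pow, hv, map_one, ← zpow_natCast, ← zpow_mul, mul_comm, zpow_mul, zpow_natCast,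
      hζ.pow_eq_one, one_zpow]
  have h5 := congrArg (algebraMap K L) (hw v hvN)
  rw [map_pow, hv, map_one, ← zpow_natCast, ← zpow_mul, hζ.zpow_eq_one_iff_dvd, ← hn] at h5
  have h6 : d ∣ w := (mul_dvd_mul_iff_left hn0).1 h5
  obtain ⟨e, he⟩ := h6
  obtain ⟨b, η, h7, h8⟩ := (hmem w).2 ⟨e, by rw [he, mul_comm]⟩
  exact ⟨b, η, h7, by rw [← h8, zpow_natCast]⟩

noncomputable def zt (n : ℕ) : ℂ := Complex.exp (2 * Real.pi * Complex.I / n)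

theorem zt_prim {n : ℕ} (hn : 0 < n) : IsPrimitiveRoot (zt n) n :=
  Complex.isPrimitiveRoot_exp n hn.ne'

theorem root_mem (K : IntermediateField ℚ ℂ) {n : ℕ} (hn : 0 < n) {z : ℂ} (hz : z ^ n = 1) :
    z ∈ K⟮zt n⟯ := by
  have : NeZero n := ⟨hn.ne'⟩
  obtain ⟨i, -, rfl⟩ := (zt_prim hn).eq_pow_of_pow_eq_one hz
  exact pow_mem (mem_adjoin_simple_self K _) i

theorem zt_le (K : IntermediateField ℚ ℂ) {n m : ℕ} (hm : 0 < m) (h : n ∣ m) :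
    K⟮zt n⟯ ≤ K⟮zt m⟯ := by
  rw [adjoin_simple_le_iff]
  refine root_mem K hm ?_
  obtain ⟨k, rfl⟩ := h
  rw [pow_mul, (zt_prim (Nat.pos_of_mul_pos_right hm)).pow_eq_one, one_pow]

theorem mem_level (A : Finset ℂ) {x : ℂ}
    (hx : x ∈ Subfield.closure ({z : ℂ | ∃ m : ℕ, 0 < m ∧ z ^ m = 1} ∪ (A : Set ℂ))) :
    ∃ n : ℕ, 0 < n ∧ x ∈ (adjoin ℚ (A : Set ℂ))⟮zt n⟯ := by
  set K := adjoin ℚ (A : Set ℂ) with hK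
  induction hx using Subfield.closure_induction with
  | mem x hx =>
    rcases hx with ⟨m, hm, h⟩ | h
    · exact ⟨m, hm, root_mem K hm h⟩
    · exact ⟨1, one_pos, IntermediateField.algebraMap_mem K⟮zt 1⟯ ⟨x, subset_adjoin _ _ h⟩⟩
  | one => exact ⟨1, one_pos, one_mem _⟩
  | add x y _ _ h1 h2 =>
    obtain ⟨n, hn, h1⟩ := h1
    obtain ⟨m, hm, h2⟩ := h2
    exact ⟨n * m, by positivity, add_mem (zt_le K (by positivity) (Dvd.intro _ rfl) h1)
      (zt_le K (by positivity) (Dvd.intro_left _ rfl) h2)⟩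
  | neg x _ h1 =>
    obtain ⟨n, hn, h1⟩ := h1
    exact ⟨n, hn, neg_mem h1⟩
  | inv x _ h1 =>
    obtain ⟨n, hn, h1⟩ := h1
    exact ⟨n, hn, inv_mem h1⟩
  | mul x y _ _ h1 h2 =>
    obtain ⟨n, hn, h1⟩ := h1
    obtain ⟨m, hm, h2⟩ := h2
    exact ⟨n * m, by positivity, mul_mem (zt_le K (by positivity) (Dvd.intro _ rfl) h1)
      (zt_le K (by positivity) (Dvd.intro_left _ rfl) h2)⟩

theorem kummer_C (K : IntermediateField ℚ ℂ) {n m : ℕ} (hn : 0 < n) (hm : 0 < m) {x : ℂ}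
    (hx0 : x ≠ 0) (hx : x ∈ K⟮zt n⟯) (hxm : x ^ m ∈ K) {w : ℕ}
    (hw : ∀ u : K, ∀ N : ℕ, 0 < N → u ^ N = 1 → u ^ w = 1) :
    ∃ (b : K) (η : ℂ) (N : ℕ), 0 < N ∧ η ^ N = 1 ∧ x ^ w = b * η := by
  have hN : 0 < n * m := by positivity
  have : NeZero (n * m) := ⟨hN.ne'⟩
  have hp := zt_prim hN
  have hx' := zt_le K hN (Dvd.intro m rfl) hx
  have hcyc : IsCyclotomicExtension {n * m} K K⟮zt (n * m)⟯ := by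
    have hal : IsAlgebraic K (zt (n * m)) := (hp.isIntegral hN).tower_top.isAlgebraic
    change IsCyclotomicExtension {n * m} K K⟮zt (n * m)⟯.toSubalgebra
    rw [adjoin_simple_toSubalgebra_of_isAlgebraic hal]
    exact hp.adjoin_isCyclotomicExtension K
  have hfd : FiniteDimensional K K⟮zt (n * m)⟯ :=
    IsCyclotomicExtension.finiteDimensional {n * m} K K⟮zt (n * m)⟯
  have hab : IsAbelianGalois K K⟮zt (n * m)⟯ := IsCyclotomicExtension.isAbelianGalois {n * m} K _
  have hζ : IsPrimitiveRoot (⟨zt (n * m), mem_adjoin_simple_self K _⟩ : K⟮zt (n * m)⟯) (n * m) :=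
    IsPrimitiveRoot.coe_submonoidClass_iff.1 hp
  obtain ⟨b, η, h1, h2⟩ := kummer_fin hN hζ (x := ⟨x, hx'⟩) (fun h => hx0 (congrArg Subtype.val h))
    ⟨⟨x ^ (n * m), by rw [mul_comm, pow_mul]; exact pow_mem hxm n⟩, by ext; rfl⟩ (hw · _ hN)
  exact ⟨b, η, n * m, hN, congrArg Subtype.val h1, congrArg Subtype.val h2⟩

theorem exists_w_s11 {K : Type} [Field K] (hK : Good K) :
    ∃ w : ℕ, 0 < w ∧ ∀ u : K, ∀ N : ℕ, 0 < N → u ^ N = 1 → u ^ w = 1 := by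
  have hfg : (CommGroup.torsion Kˣ).FG := by
    refine hK _ ⟨⊥, Subgroup.FG.bot, ?_⟩
    intro h hh
    obtain ⟨m, hm, h1⟩ := isOfFinOrder_iff_pow_eq_one.1 (show IsOfFinOrder h from hh)
    exact ⟨m, hm, h1⟩
  have : Group.FG (CommGroup.torsion Kˣ) := (Group.fg_iff_subgroup_fg _).2 hfg
  have hfin : Finite (CommGroup.torsion Kˣ) := CommGroup.finite_of_fg_isMulTorsion _ (by
    rintro ⟨x, hx⟩
    exact Submonoid.isOfFinOrder_coe.1 hx)
  refine ⟨Nat.card (CommGroup.torsion Kˣ), Nat.card_pos, ?_⟩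
  intro u N hN hu
  have hu0 : u ≠ 0 := by
    rintro rfl
    rw [zero_pow hN.ne'] at hu
    exact zero_ne_one hu
  have hm : Units.mk0 u hu0 ∈ CommGroup.torsion Kˣ := by
    change IsOfFinOrder _
    rw [isOfFinOrder_iff_pow_eq_one]
    exact ⟨N, hN, by ext; simpa using hu⟩
  have := pow_card_eq_one' (x := (⟨Units.mk0 u hu0, hm⟩ : CommGroup.torsion Kˣ))
  have h2 := congrArg (fun z : CommGroup.torsion Kˣ => ((z : Kˣ) : K)) this
  exact h2

/-- For a finite set `A ⊆ ℂ^×`, with `E := ℚ(𝕌 ∪ A)` and `G := ⟨A⟩_{E^×}` the smallest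
radical subgroup of `E^×` containing `A`, the quotient of `G` by its torsion subgroup
(the roots of unity lying in `G`) is a finitely generated free abelian group. -/
theorem radical_subgroup_modulo_torsion_finitely_generated_free
    (A : Finset ℂ) (hA0 : (0 : ℂ) ∉ A)
    (E : Subfield ℂ)
    (hE : E = Subfield.closure ({z : ℂ | ∃ m : ℕ, 0 < m ∧ z ^ m = 1} ∪ (A : Set ℂ)))
    -- `G = ⟨A⟩_{E^×}` viewed inside `ℂ^×` : `G = {x ∈ E^× : xᵐ ∈ [A] for some m ≥ 1}`
    (G : Subgroup ℂˣ)
    (hG : ∀ x : ℂˣ, x ∈ G ↔ ((x : ℂ) ∈ E ∧ ∃ m : ℕ, 0 < m ∧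
      x ^ m ∈ Subgroup.closure {u : ℂˣ | (u : ℂ) ∈ A})) :
    Module.Free ℤ (Additive (↥G ⧸ CommGroup.torsion ↥G)) ∧
    Module.Finite ℤ (Additive (↥G ⧸ CommGroup.torsion ↥G)) := by
  suffices hfg : Group.FG (↥G ⧸ CommGroup.torsion ↥G) by
    have h2 : Module.Finite ℤ (Additive (↥G ⧸ CommGroup.torsion ↥G)) :=
      Module.Finite.iff_addGroup_fg.2 inferInstance
    exact ⟨inferInstance, h2⟩
  set Γ := Subgroup.closure {u : ℂˣ | (u : ℂ) ∈ A} with hΓ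
  set K := IntermediateField.adjoin ℚ (A : Set ℂ) with hKdef
  have hgood : Good K := vgood_adjoin A K inferInstance
  obtain ⟨w, hw0, hw⟩ := exists_w_s11 hgood
  let φ : Kˣ →* ℂˣ := Units.map (algebraMap K ℂ).toMonoidHom
  have hφ : Function.Injective φ := Units.map_injective (algebraMap K ℂ).injective
  have hΓfg : Γ.FG := by
    rw [Subgroup.fg_iff]
    exact ⟨_, rfl, A.finite_toSet.preimage Units.val_injective.injOn⟩
  have hΓK : ∀ u ∈ Γ, (u : ℂ) ∈ K := by
    have hle : Γ ≤ φ.range := by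
      rw [hΓ, Subgroup.closure_le]
      intro u hu
      have hu' : (u : ℂ) ∈ K := IntermediateField.subset_adjoin _ _ hu
      have hx0 : (⟨u, hu'⟩ : K) ≠ 0 := fun h0 => u.ne_zero (congrArg Subtype.val h0)
      exact ⟨Units.mk0 _ hx0, by ext; rfl⟩
    intro u hu
    obtain ⟨v, rfl⟩ := hle hu
    exact (v : K).2
  let H : Subgroup Kˣ :=
    { carrier := {b | ∃ m : ℕ, 0 < m ∧ φ b ^ m ∈ Γ}
      one_mem' := ⟨1, one_pos, by simp⟩
      mul_mem' := by
        rintro a b ⟨m, hm, h1⟩ ⟨n, hn, h2⟩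
        refine ⟨m * n, by positivity, ?_⟩
        rw [map_mul, mul_pow]
        refine mul_mem ?_ ?_
        · rw [pow_mul]; exact pow_mem h1 n
        · rw [mul_comm, pow_mul]; exact pow_mem h2 m
      inv_mem' := by
        rintro a ⟨m, hm, h1⟩
        exact ⟨m, hm, by rw [map_inv, inv_pow]; exact inv_mem h1⟩ }
  have hHfg : H.FG := by
    refine hgood H ⟨Γ.comap φ, ?_, ?_⟩
    · refine fg_of_map_inf φ (sub_fg hΓfg (Subgroup.map_comap_le _ _)) ?_
      rw [(MonoidHom.ker_eq_bot_iff φ).2 hφ, inf_bot_eq]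
      exact Subgroup.FG.bot
    · rintro b ⟨m, hm, h1⟩
      exact ⟨m, hm, by rw [Subgroup.mem_comap, map_pow]; exact h1⟩
  let ψ : G →* ℂˣ ⧸ CommGroup.torsion ℂˣ :=
    (powMonoidHom w).comp ((QuotientGroup.mk' (CommGroup.torsion ℂˣ)).comp G.subtype)
  have hψ : ∀ x : G, ψ x = ((x : ℂˣ) : ℂˣ ⧸ CommGroup.torsion ℂˣ) ^ w := fun _ => rfl
  have hker : ψ.ker = CommGroup.torsion G := by
    ext x
    rw [MonoidHom.mem_ker, hψ, pow_eq_one_iff_left hw0.ne', QuotientGroup.eq_one_iff]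
    exact Submonoid.isOfFinOrder_coe
  have hrange : ψ.range ≤ (H.map φ).map (QuotientGroup.mk' (CommGroup.torsion ℂˣ)) := by
    rintro _ ⟨x, rfl⟩
    obtain ⟨hxE, m, hm, hxm⟩ := (hG x).1 x.2
    rw [hE] at hxE
    obtain ⟨n, hn, hxn⟩ := mem_level A hxE
    obtain ⟨b, η, N, hN, hη, hb⟩ := kummer_C K hn hm (x : ℂˣ).ne_zero hxn
      (by simpa using hΓK _ hxm) hw
    have hbη : (b : ℂ) * η ≠ 0 := by rw [← hb]; exact pow_ne_zero _ (x : ℂˣ).ne_zero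
    have hη0 : η ≠ 0 := right_ne_zero_of_mul hbη
    have hb0 : b ≠ 0 := fun h => left_ne_zero_of_mul hbη (by rw [h]; rfl)
    have hηN : (Units.mk0 η hη0) ^ N = 1 := by ext; simpa using hη
    have hx : (x : ℂˣ) ^ w = φ (Units.mk0 b hb0) * Units.mk0 η hη0 := by
      ext; rw [Units.val_pow_eq_pow_val]; exact hb
    refine ⟨φ (Units.mk0 b hb0), ⟨Units.mk0 b hb0, ⟨m * N, by positivity, ?_⟩, rfl⟩, ?_⟩
    · have : φ (Units.mk0 b hb0) ^ (m * N) = ((x : ℂˣ) ^ m) ^ (w * N) := by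
        rw [← pow_mul, show m * (w * N) = w * (m * N) by ring, pow_mul (x : ℂˣ) w, hx, mul_pow,
          show (Units.mk0 η hη0) ^ (m * N) = 1 by rw [mul_comm, pow_mul, hηN, one_pow], mul_one]
      rw [this]
      exact pow_mem hxm _
    · rw [hψ, ← QuotientGroup.mk_pow, hx, QuotientGroup.mk_mul,
        (QuotientGroup.eq_one_iff (Units.mk0 η hη0)).2
          (isOfFinOrder_iff_pow_eq_one.2 ⟨N, hN, hηN⟩), mul_one]
      rfl
  have hrfg : Group.FG ψ.range :=
    (Group.fg_iff_subgroup_fg _).2 (sub_fg (sg_map _ (sg_map _ hHfg)) hrange)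
  let e : ψ.range ≃* (G ⧸ CommGroup.torsion G) :=
    (QuotientGroup.quotientKerEquivRange ψ).symm.trans (QuotientGroup.quotientMulEquivOfEq hker)
  exact Group.fg_of_surjective (f := e.toMonoidHom) e.surjective
end

section
/- Let A be a finite subset of ℂ^×, let Γ := ⟨A⟩_{ℂ^×} be the smallest radical subgroup of ℂ^× containing A, let E := ℚ(𝕌 ∪ A) be the subfield of ℂ generated by all roots of unity together with A, and let G := ⟨A⟩_{E^×} be the smallest radical subgroup of E^× containing A. Then for any λ_1,…,λ_n ∈ E^×, every nondegenerate solution in Γ^n of the equation λ_1x_1+⋯+λ_nx_n = 1 lies in G^n. -/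
lemma aux_sum {E L : Type*} [Field E] [Field L] [Algebra E L] [IsGalois E L] [CharZero L]
    (hroot : ∀ (z : L) (m : ℕ), 0 < m → z ^ m = 1 → ∃ e : E, algebraMap E L e = z)
    {ι : Type*} [DecidableEq ι] (v : ι → L) (hv0 : ∀ i, v i ≠ 0)
    (hvm : ∀ i, ∃ m : ℕ, 0 < m ∧ ∃ e : E, algebraMap E L e = v i ^ m) (s : Finset ι) :
    (∀ i ∈ s, ¬ ∃ e : E, algebraMap E L e = v i) →
    (∃ e : E, algebraMap E L e = ∑ i ∈ s, v i) → ∑ i ∈ s, v i = 0 := by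
  classical
  induction s using Finset.strongInduction with
  | H s ih =>
  intro hs hc
  rcases s.eq_empty_or_nonempty with rfl | ⟨j, hj⟩
  · simp
  obtain ⟨c, hc⟩ := hc
  have hσ : ∃ σ : L ≃ₐ[E] L, σ (v j) ≠ v j := by
    by_contra! h
    exact hs j hj (by
      have := (InfiniteGalois.mem_bot_iff_fixed (k := E) (v j)).2 h
      exact IntermediateField.mem_bot.1 this)
  obtain ⟨σ, hσ⟩ := hσ
  choose m hm e he using hvm
  let z : ι → L := fun i => σ (v i) / v i
  have hz : ∀ i, σ (v i) = z i * v i := fun i => (div_mul_cancel₀ _ (hv0 i)).symm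
  have hzm : ∀ i, z i ^ m i = 1 := by
    intro i
    have h1 : σ (v i ^ m i) = v i ^ m i := by rw [← he]; simp
    rw [div_pow, ← map_pow, h1, div_self (pow_ne_zero _ (hv0 i))]
  have hσz : ∀ i, σ (z i) = z i := by
    intro i
    obtain ⟨a, ha⟩ := hroot (z i) (m i) (hm i) (hzm i)
    rw [← ha]; simp
  have hpow : ∀ i (k : ℕ), (σ ^ k) (v i) = z i ^ k * v i := by
    intro i k
    induction k with
    | zero => simp
    | succ k ihk =>
      rw [pow_succ', AlgEquiv.mul_apply, ihk, map_mul, map_pow, hσz, hz]; ring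
  let N := ∏ i ∈ s, m i
  have hN : (N : L) ≠ 0 := by
    have : 0 < N := Finset.prod_pos fun i _ => hm i
    exact_mod_cast this.ne'
  have hzN : ∀ i ∈ s, z i ^ N = 1 := by
    intro i hi
    obtain ⟨d, hd⟩ := Finset.dvd_prod_of_mem m hi
    change z i ^ (∏ i ∈ s, m i) = 1
    rw [hd, pow_mul, hzm, one_pow]
  have havg : (N : L) * ∑ i ∈ s, v i = N * ∑ i ∈ s with z i = 1, v i := by
    have h1 : (N : L) * ∑ i ∈ s, v i = ∑ k ∈ Finset.range N, (σ ^ k) (∑ i ∈ s, v i) := by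
      rw [← hc]; simp
    rw [h1]
    simp only [map_sum, hpow]
    rw [Finset.sum_comm, Finset.mul_sum, Finset.sum_filter]
    refine Finset.sum_congr rfl fun i hi => ?_
    rw [← Finset.sum_mul]
    split_ifs with h
    · simp [h]
    · have := geom_sum_mul (z i) N
      rw [hzN i hi, sub_self] at this
      rcases mul_eq_zero.1 this with h' | h'
      · rw [h', zero_mul]
      · exact absurd (sub_eq_zero.1 h') h
  have heq := mul_left_cancel₀ hN havg
  rw [heq]
  refine ih _ ?_ (fun i hi => hs i (Finset.mem_filter.1 hi).1) ⟨c, hc.trans heq⟩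
  refine Finset.filter_ssubset.2 ⟨j, hj, fun h => hσ ?_⟩
  rw [hz, h, one_mul]

/-- For a finite set `A ⊆ ℂ^×`, with `Γ := ⟨A⟩_{ℂ^×}` the smallest radical subgroup of
`ℂ^×` containing `A`, `E := ℚ(𝕌 ∪ A)`, and `G := ⟨A⟩_{E^×}` the smallest radical subgroup
of `E^×` containing `A`: for any `λ₁,…,λ_n ∈ E^×`, every nondegenerate solution in `Γ` of
`λ₁x₁+⋯+λ_nx_n = 1` lies in `G`. -/
theorem nondegenerate_solutions_in_radical_closure_lie_in_E
    (A : Finset ℂ) (hA0 : (0 : ℂ) ∉ A)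
    (E : Subfield ℂ)
    (hE : E = Subfield.closure ({z : ℂ | ∃ m : ℕ, 0 < m ∧ z ^ m = 1} ∪ (A : Set ℂ)))
    (n : ℕ) (lam : Fin n → ℂ) (hlamE : ∀ i, lam i ∈ E) (hlam0 : ∀ i, lam i ≠ 0)
    (γ : Fin n → ℂˣ)
    -- each `γᵢ` lies in `Γ = ⟨A⟩_{ℂ^×} = {x ∈ ℂ^× : xᵐ ∈ [A] for some m ≥ 1}` :
    (hγΓ : ∀ i, ∃ m : ℕ, 0 < m ∧ γ i ^ m ∈ Subgroup.closure {u : ℂˣ | (u : ℂ) ∈ A})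
    -- `γ` is a nondegenerate solution of `λ₁x₁+⋯+λ_nx_n = 1` :
    (hsol : ∑ i, lam i * (γ i : ℂ) = 1)
    (hnondeg : ∀ I : Finset (Fin n), I.Nonempty → I ≠ Finset.univ →
      (∑ i ∈ I, lam i * (γ i : ℂ)) ≠ 0) :
    -- conclusion: each `γᵢ` lies in `G = ⟨A⟩_{E^×} = {x ∈ E^× : xᵐ ∈ [A] for some m ≥ 1}` :
    ∀ i, (γ i : ℂ) ∈ E ∧ ∃ m : ℕ, 0 < m ∧
      γ i ^ m ∈ Subgroup.closure {u : ℂˣ | (u : ℂ) ∈ A} := by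
  classical
  have hrootE : ∀ (z : ℂ) (m : ℕ), 0 < m → z ^ m = 1 → z ∈ E := by
    intro z m hm hz
    rw [hE]
    exact Subfield.subset_closure (Or.inl ⟨m, hm, hz⟩)
  have hcl : ∀ u ∈ Subgroup.closure {u : ℂˣ | (u : ℂ) ∈ A}, (u : ℂ) ∈ E := by
    intro u hu
    induction hu using Subgroup.closure_induction with
    | mem x hx => rw [hE]; exact Subfield.subset_closure (Or.inr hx)
    | one => simpa using E.one_mem
    | mul x y _ _ hx hy => simpa using E.mul_mem hx hy
    | inv x _ hx => simpa using E.inv_mem hx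
  have hpowE : ∀ i, ∃ m : ℕ, 0 < m ∧ (lam i * (γ i : ℂ)) ^ m ∈ E := by
    intro i
    obtain ⟨m, hm, h⟩ := hγΓ i
    refine ⟨m, hm, ?_⟩
    rw [mul_pow]
    exact E.mul_mem (E.pow_mem (hlamE i) m) (by simpa using hcl _ h)
  have halg : ∀ i, lam i * (γ i : ℂ) ∈ algebraicClosure E ℂ := by
    intro i
    obtain ⟨m, hm, h⟩ := hpowE i
    rw [mem_algebraicClosure_iff]
    exact IsAlgebraic.of_pow hm (isAlgebraic_algebraMap (⟨_, h⟩ : E))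
  let v : Fin n → algebraicClosure E ℂ := fun i => ⟨_, halg i⟩
  have hcoe : ∀ x : algebraicClosure E ℂ,
      (∃ e : E, algebraMap E (algebraicClosure E ℂ) e = x) ↔ (x : ℂ) ∈ E := by
    intro x
    constructor
    · rintro ⟨e, rfl⟩
      exact e.2
    · intro h
      exact ⟨⟨x, h⟩, Subtype.ext rfl⟩
  have hIsG : IsGalois E (algebraicClosure E ℂ) := inferInstance
  have key := aux_sum (E := E) (L := algebraicClosure E ℂ)
    (fun z m hm hz => (hcoe z).2 (hrootE z m hm (by
      have := congrArg (fun x : algebraicClosure E ℂ => (x : ℂ)) hz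
      simpa using this)))
    v (fun i h => by
      have := congrArg (fun x : algebraicClosure E ℂ => (x : ℂ)) h
      simp [v, hlam0 i] at this)
    (fun i => by
      obtain ⟨m, hm, h⟩ := hpowE i
      exact ⟨m, hm, (hcoe _).2 (by simpa [v] using h)⟩)
    (Finset.univ.filter fun i => (v i : ℂ) ∉ E)
    (fun i hi h => (Finset.mem_filter.1 hi).2 ((hcoe _).1 h))
  have hvsum : ∀ s : Finset (Fin n), ((∑ i ∈ s, v i : algebraicClosure E ℂ) : ℂ)
      = ∑ i ∈ s, lam i * (γ i : ℂ) := by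
    intro s
    simp [v]
  set s := Finset.univ.filter fun i => (v i : ℂ) ∉ E with hs
  have hsplit : ∑ i ∈ s, lam i * (γ i : ℂ)
      = 1 - ∑ i with ¬ ((v i : ℂ) ∉ E), lam i * (γ i : ℂ) := by
    rw [← hsol, ← Finset.sum_filter_add_sum_filter_not Finset.univ (fun i => (v i : ℂ) ∉ E)]
    simp [hs]
  have hz := key ((hcoe _).2 (by
    rw [hvsum, hsplit]
    refine E.sub_mem E.one_mem (E.sum_mem fun i hi => ?_)
    exact not_not.1 (Finset.mem_filter.1 hi).2))
  have hz' : ∑ i ∈ s, lam i * (γ i : ℂ) = 0 := by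
    rw [← hvsum, hz]; rfl
  have hemp : s = ∅ := by
    by_contra hne
    have hne := Finset.nonempty_iff_ne_empty.2 hne
    by_cases hu : s = Finset.univ
    · rw [hu, hsol] at hz'
      exact one_ne_zero hz'
    · exact hnondeg s hne hu hz'
  intro i
  refine ⟨?_, hγΓ i⟩
  have h1 : (v i : ℂ) ∈ E := by
    by_contra h
    have : i ∈ s := Finset.mem_filter.2 ⟨Finset.mem_univ _, h⟩
    rw [hemp] at this
    simp at this
  have h2 : (γ i : ℂ) = (lam i)⁻¹ * (lam i * γ i) := by
    rw [inv_mul_cancel_left₀ (hlam0 i)]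
  rw [h2]
  exact E.mul_mem (E.inv_mem (hlamE i)) h1
end
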